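/- arXiv:2604.08394 — 4 statements merged into one kernel-verified Lean document; each statement's English description precedes it below -/
import Mathlib

section
/- Let F be a family of finite posets, closed under isomorphism and under taking ideals and filters, such that for every poset P in F the coefficient of n^1 in the order polynomial Ω_P(n) is nonnegative. Then for every P in F, every subposet A ⊆ P with min(P) ∪ max(P) ⊆ A, and every order preserving map λ : A → ℤ, the marked order polytope O_{P,A}(λ) is Ehrhart positive: there exists a polynomial p ∈ ℚ[n] with nonnegative coefficients such that p(n) = Ω_{P,A}(n·λ) for all integers n ≥ 1. -/
/-- The number of order preserving maps `λ̂ : α → ℤ` agreeing with `lam` on the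
marked subset `A` (the lattice points of the marked order polytope `O_{P,A}(λ)`). -/
noncomputable def markedCount {α : Type} [PartialOrder α] (A : Set α) (lam : α → ℤ) : ℕ :=
  Nat.card {f : α → ℤ // Monotone f ∧ ∀ a ∈ A, f a = lam a}

/-- The number of order preserving maps from `α` into the `n`-chain `{1, …, n}`. -/
noncomputable def orderCount (α : Type) [PartialOrder α] (n : ℕ) : ℕ :=
  Nat.card {f : α → Fin n // Monotone f}

/-- Nonnegativity of all coefficients. -/
def CoeffPos (p : Polynomial ℚ) : Prop := ∀ i : ℕ, 0 ≤ p.coeff i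

lemma CoeffPos.mul {p q : Polynomial ℚ} (hp : CoeffPos p) (hq : CoeffPos q) :
    CoeffPos (p * q) := by
  intro i
  rw [Polynomial.coeff_mul]
  exact Finset.sum_nonneg fun x _ => mul_nonneg (hp _) (hq _)

lemma CoeffPos.sum {ι : Type*} (s : Finset ι) (p : ι → Polynomial ℚ)
    (hp : ∀ i ∈ s, CoeffPos (p i)) : CoeffPos (∑ i ∈ s, p i) := by
  intro i
  rw [Polynomial.finsetSum_coeff]
  exact Finset.sum_nonneg fun x hx => hp x hx i

/-- Order preserving integer maps subject to pointwise constraints. -/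
def ConMap (β : Type) [PartialOrder β] (p : β → ℤ → Prop) : Type :=
  {f : β → ℤ // Monotone f ∧ ∀ x, p x (f x)}

/-- Gluing a map on an ideal (values at most `c`) and one on the complement (values above `c`). -/
noncomputable def glue {β : Type} [PartialOrder β] (p : β → ℤ → Prop) (c : ℤ) :
    (Σ I : LowerSet β,
      ConMap (I : Set β) (fun x z => p x z ∧ z ≤ c) ×
      ConMap ((I : Set β)ᶜ : Set β) (fun x z => p x z ∧ c < z)) → ConMap β p := by
  classical
  exact fun s => ⟨fun x => if hx : x ∈ (s.1 : Set β) then s.2.1.1 ⟨x, hx⟩ else s.2.2.1 ⟨x, hx⟩, by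
    obtain ⟨I, ⟨g, hg, hg'⟩, ⟨h, hh, hh'⟩⟩ := s
    refine ⟨?_, ?_⟩
    · intro x y hxy
      dsimp only
      by_cases hx : x ∈ (I : Set β)
      · by_cases hy : y ∈ (I : Set β)
        · rw [dif_pos hx, dif_pos hy]
          exact hg (by exact hxy)
        · rw [dif_pos hx, dif_neg hy]
          have h1 := (hg' ⟨x, hx⟩).2
          have h2 := (hh' ⟨y, hy⟩).2
          omega
      · have hy : y ∉ (I : Set β) := fun hy => hx (I.lower hxy hy)
        rw [dif_neg hx, dif_neg hy]
        exact hh (by exact hxy)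
    · intro x
      dsimp only
      by_cases hx : x ∈ (I : Set β)
      · rw [dif_pos hx]; exact (hg' ⟨x, hx⟩).1
      · rw [dif_neg hx]; exact (hh' ⟨x, hx⟩).1⟩

lemma glue_bijective {β : Type} [PartialOrder β] (p : β → ℤ → Prop) (c : ℤ) :
    Function.Bijective (glue p c) := by
  classical
  constructor
  · rintro ⟨I, ⟨g, hg, hg'⟩, ⟨h, hh, hh'⟩⟩ ⟨J, ⟨k, hk, hk'⟩, ⟨l, hl, hl'⟩⟩ e
    have e1 : ∀ x, (if hx : x ∈ (I : Set β) then g ⟨x, hx⟩ else h ⟨x, hx⟩)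
        = (if hx : x ∈ (J : Set β) then k ⟨x, hx⟩ else l ⟨x, hx⟩) := fun x =>
      congrFun (congrArg Subtype.val e) x
    have hIJ : I = J := by
      ext x
      have := e1 x
      by_cases hx : x ∈ (I : Set β) <;> by_cases hy : x ∈ (J : Set β)
      · exact ⟨fun _ => hy, fun _ => hx⟩
      · rw [dif_pos hx, dif_neg hy] at this
        have h1 := (hg' ⟨x, hx⟩).2
        have h2 := (hl' ⟨x, hy⟩).2
        omega
      · rw [dif_neg hx, dif_pos hy] at this
        have h1 := (hk' ⟨x, hy⟩).2
        have h2 := (hh' ⟨x, hx⟩).2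
        omega
      · exact ⟨fun h => absurd h hx, fun h => absurd h hy⟩
    subst hIJ
    have e2 : g = k := by
      funext ⟨x, hx⟩
      have := e1 x
      rwa [dif_pos hx, dif_pos hx] at this
    have e3 : h = l := by
      funext ⟨x, hx⟩
      have := e1 x
      rwa [dif_neg hx, dif_neg hx] at this
    subst e2
    subst e3
    rfl
  · rintro ⟨f, hf, hf'⟩
    refine ⟨⟨⟨{x | f x ≤ c}, fun x y hxy hx => (hf hxy).trans hx⟩,
      ⟨fun x => f x.1, fun x y hxy => hf hxy, fun x => ⟨hf' x.1, x.2⟩⟩,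
      ⟨fun x => f x.1, fun x y hxy => hf hxy, fun x => ⟨hf' x.1, not_le.1 x.2⟩⟩⟩, ?_⟩
    apply Subtype.ext
    funext x
    simp only [glue]
    split_ifs <;> rfl

instance lowerSetFinite (β : Type) [Finite β] [PartialOrder β] : Finite (LowerSet β) :=
  Finite.of_injective (fun I : LowerSet β => (I : Set β)) SetLike.coe_injective

noncomputable instance lowerSetFintype (β : Type) [Finite β] [PartialOrder β] :
    Fintype (LowerSet β) := Fintype.ofFinite _

lemma conMap_finite {β : Type} [Finite β] [PartialOrder β] (p : β → ℤ → Prop) (c : ℤ)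
    (h : ∀ I : LowerSet β, Finite (ConMap (I : Set β) (fun x z => p x z ∧ z ≤ c) ×
      ConMap ((I : Set β)ᶜ : Set β) (fun x z => p x z ∧ c < z))) : Finite (ConMap β p) :=
  Finite.of_surjective _ (glue_bijective p c).2

lemma conMap_card {β : Type} [Finite β] [PartialOrder β] (p : β → ℤ → Prop) (c : ℤ)
    (h : ∀ I : LowerSet β, Finite (ConMap (I : Set β) (fun x z => p x z ∧ z ≤ c) ×
      ConMap ((I : Set β)ᶜ : Set β) (fun x z => p x z ∧ c < z))) :
    Nat.card (ConMap β p) = ∑ I : LowerSet β,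
      Nat.card (ConMap (I : Set β) (fun x z => p x z ∧ z ≤ c)) *
      Nat.card (ConMap ((I : Set β)ᶜ : Set β) (fun x z => p x z ∧ c < z)) := by
  rw [← Nat.card_eq_of_bijective _ (glue_bijective p c), Nat.card_sigma]
  simp only [Nat.card_prod]

/-- Order preserving maps into a chain of length `n`, as integer maps to `(c, c+n]`. -/
noncomputable def chainEquiv (β : Type) [PartialOrder β] (c : ℤ) (n : ℕ) (p : β → ℤ → Prop)
    (hp : ∀ x z, p x z ↔ c < z ∧ z ≤ c + n) :
    {f : β → Fin n // Monotone f} ≃ ConMap β p where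
  toFun f := ⟨fun x => c + 1 + (f.1 x : ℕ), fun x y hxy => by
      have : (f.1 x : ℕ) ≤ (f.1 y : ℕ) := f.2 hxy
      dsimp only; omega, fun x => by
      rw [hp]; have := (f.1 x).2; dsimp only; omega⟩
  invFun f := ⟨fun x => ⟨(f.1 x - c - 1).toNat, by
      have := (hp _ _).1 (f.2.2 x); omega⟩, fun x y hxy => by
      have := f.2.1 hxy
      simp only [Fin.mk_le_mk]; omega⟩
  left_inv f := by
    apply Subtype.ext; funext x; apply Fin.ext
    dsimp only; omega
  right_inv f := by
    apply Subtype.ext; funext x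
    have := (hp _ _).1 (f.2.2 x)
    simp only; omega

lemma orderCount_add (β : Type) [Finite β] [PartialOrder β] (m n : ℕ) :
    orderCount β (m + n) = ∑ I : LowerSet β,
      orderCount (I : Set β) m * orderCount ((I : Set β)ᶜ : Set β) n := by
  have e1 : ∀ I : LowerSet β, _ := fun I => chainEquiv (I : Set β) 0 m
    (fun x z => (0 < z ∧ z ≤ (0 : ℤ) + ((m + n : ℕ) : ℤ)) ∧ z ≤ m) (by intro x z; push_cast; omega)
  have e2 : ∀ I : LowerSet β, _ := fun I => chainEquiv ((I : Set β)ᶜ : Set β) m n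
    (fun x z => (0 < z ∧ z ≤ (0 : ℤ) + ((m + n : ℕ) : ℤ)) ∧ (m : ℤ) < z) (by intro x z; push_cast; omega)
  have e := chainEquiv β 0 (m + n) (fun x z => (0 < z ∧ z ≤ (0 : ℤ) + ((m + n : ℕ) : ℤ)))
    (fun _ _ => Iff.rfl)
  unfold orderCount
  rw [Nat.card_congr e, conMap_card _ (m : ℤ)]
  · refine Finset.sum_congr rfl fun I _ => ?_
    rw [Nat.card_congr (e1 I), Nat.card_congr (e2 I)]
  · intro I
    have := Finite.of_equiv _ (e1 I)
    have := Finite.of_equiv _ (e2 I)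
    infer_instance

lemma orderCount_one (β : Type) [PartialOrder β] : orderCount β 1 = 1 := by
  unfold orderCount
  rw [Nat.card_eq_one_iff_unique]
  exact ⟨inferInstance, ⟨⟨fun _ => 0, fun _ _ _ => le_rfl⟩⟩⟩

lemma orderCount_empty (β : Type) [PartialOrder β] [IsEmpty β] (n : ℕ) : orderCount β n = 1 := by
  unfold orderCount
  rw [Nat.card_eq_one_iff_unique]
  exact ⟨inferInstance, ⟨⟨fun x => isEmptyElim x, fun x => isEmptyElim x⟩⟩⟩

lemma orderCount_zero (β : Type) [PartialOrder β] [Nonempty β] : orderCount β 0 = 0 := by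
  unfold orderCount
  have : IsEmpty {f : β → Fin 0 // Monotone f} :=
    ⟨fun f => (f.1 (Classical.arbitrary β)).elim0⟩
  exact Nat.card_of_isEmpty

/-- Summation of a polynomial is polynomial. -/
lemma exists_sum_poly (q : Polynomial ℚ) :
    ∃ p : Polynomial ℚ, ∀ n : ℕ, p.eval (n : ℚ) = ∑ k ∈ Finset.range n, q.eval (k : ℚ) := by
  induction q using Polynomial.induction_on' with
  | add a b ha hb =>
    obtain ⟨p, hp⟩ := ha
    obtain ⟨r, hr⟩ := hb
    exact ⟨p + r, fun n => by
      simp only [Polynomial.eval_add, hp, hr, Finset.sum_add_distrib]⟩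
  | monomial d a =>
    refine ⟨Polynomial.C a * ∑ i ∈ Finset.range (d + 1),
      Polynomial.C (bernoulli i * ((d + 1).choose i : ℚ) / (d + 1)) * Polynomial.X ^ (d + 1 - i),
      fun n => ?_⟩
    simp only [Polynomial.eval_monomial, ← Finset.mul_sum, sum_range_pow, Polynomial.eval_mul,
      Polynomial.eval_C, Polynomial.eval_finsetSum, Polynomial.eval_pow, Polynomial.eval_X]
    congr 1
    refine Finset.sum_congr rfl fun i _ => ?_
    ring

lemma card_compl_lt (β : Type) [Finite β] [PartialOrder β] (I : LowerSet β) (hI : I ≠ ⊥) :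
    Nat.card ((I : Set β)ᶜ : Set β) < Nat.card β := by
  have : ∃ x, x ∈ I := by
    by_contra h
    push Not at h
    exact hI (by ext x; simpa using h x)
  obtain ⟨x, hx⟩ := this
  have h2 : ((I : Set β)ᶜ : Set β).ncard < (Set.univ : Set β).ncard := by
    apply Set.ncard_lt_ncard _ Set.finite_univ
    rw [Set.ssubset_univ_iff]
    intro h
    have : x ∈ ((I : Set β)ᶜ : Set β) := h ▸ Set.mem_univ x
    exact this hx
  rwa [Set.ncard_univ] at h2

lemma orderCount_compl_bot (β : Type) [PartialOrder β] (n : ℕ) :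
    orderCount (((⊥ : LowerSet β) : Set β)ᶜ : Set β) n = orderCount β n := by
  have hmem : ∀ x : β, x ∈ (((⊥ : LowerSet β) : Set β)ᶜ : Set β) := by simp
  unfold orderCount
  refine Nat.card_congr ⟨fun f => ⟨fun x => f.1 ⟨x, hmem x⟩, fun x y h => f.2 (by exact h)⟩,
    fun f => ⟨fun x => f.1 x.1, fun x y h => f.2 h⟩, fun f => rfl, fun f => rfl⟩

lemma exists_orderPoly (N : ℕ) : ∀ (β : Type) [Finite β] [PartialOrder β], Nat.card β = N →
    ∃ p : Polynomial ℚ, ∀ n : ℕ, p.eval (n : ℚ) = orderCount β n := by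
  classical
  induction N using Nat.strong_induction_on with
  | _ N ih =>
  intro β _ _ hN
  have h1 : ∀ I : LowerSet β, ∃ p : Polynomial ℚ, I ≠ ⊥ →
      ∀ n : ℕ, p.eval (n : ℚ) = orderCount ((I : Set β)ᶜ : Set β) n := by
    intro I
    by_cases hI : I = ⊥
    · exact ⟨0, fun h => absurd hI h⟩
    · obtain ⟨p, hp⟩ := ih _ (hN ▸ card_compl_lt β I hI) ((I : Set β)ᶜ : Set β) rfl
      exact ⟨p, fun _ => hp⟩
  choose q hq using h1
  obtain ⟨p, hp⟩ := exists_sum_poly (∑ I ∈ Finset.univ.erase (⊥ : LowerSet β), q I)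
  refine ⟨p + Polynomial.C (orderCount β 0 : ℚ), fun n => ?_⟩
  rw [Polynomial.eval_add, Polynomial.eval_C, hp]
  induction n with
  | zero => simp
  | succ n ihn =>
    rw [Finset.sum_range_succ, add_right_comm, ihn, add_comm n 1, orderCount_add,
      ← Finset.add_sum_erase _ _ (Finset.mem_univ (⊥ : LowerSet β)), orderCount_compl_bot,
      orderCount_one]
    push_cast
    rw [one_mul, Polynomial.eval_finsetSum]
    congr 1
    refine Finset.sum_congr rfl fun I hI => ?_
    rw [hq I (Finset.ne_of_mem_erase hI), orderCount_one]
    simp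

lemma poly_ext_nat (p q : Polynomial ℚ) (h : ∀ n : ℕ, p.eval (n : ℚ) = q.eval (n : ℚ)) :
    p = q := by
  apply Polynomial.eq_of_infinite_eval_eq
  refine Set.Infinite.mono (s := Set.range (fun n : ℕ => (n : ℚ))) ?_
    (Set.infinite_range_of_injective Nat.cast_injective)
  rintro _ ⟨n, rfl⟩
  exact h n

lemma orderPoly_pos
    (F : (α : Type) → [Finite α] → [PartialOrder α] → Prop)
    (hideal : ∀ (α : Type) [Finite α] [PartialOrder α],
      F α → ∀ I : Set α, IsLowerSet I → F I)
    (hfilter : ∀ (α : Type) [Finite α] [PartialOrder α],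
      F α → ∀ I : Set α, IsUpperSet I → F I)
    (hlin : ∀ (α : Type) [Finite α] [PartialOrder α], F α →
      ∀ Ω : Polynomial ℚ, (∀ n : ℕ, 1 ≤ n → Ω.eval (n : ℚ) = orderCount α n) →
        0 ≤ Ω.coeff 1) (N : ℕ) :
    ∀ (β : Type) [Finite β] [PartialOrder β], Nat.card β = N → F β →
      ∀ p : Polynomial ℚ, (∀ n : ℕ, p.eval (n : ℚ) = orderCount β n) → CoeffPos p := by
  classical
  induction N using Nat.strong_induction_on with
  | _ N ih =>
  intro β _ _ hN hF p hp
  have hA : ∀ I : LowerSet β, ∃ q : Polynomial ℚ,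
      ∀ n : ℕ, q.eval (n : ℚ) = orderCount (I : Set β) n :=
    fun I => exists_orderPoly _ (I : Set β) rfl
  have hB : ∀ I : LowerSet β, ∃ q : Polynomial ℚ,
      ∀ n : ℕ, q.eval (n : ℚ) = orderCount ((I : Set β)ᶜ : Set β) n :=
    fun I => exists_orderPoly _ ((I : Set β)ᶜ : Set β) rfl
  choose a ha using hA
  choose b hb using hB
  have hder : Polynomial.derivative p = ∑ I : LowerSet β, Polynomial.C ((a I).coeff 1) * b I := by
    apply poly_ext_nat
    intro n
    have h1 : p.comp (Polynomial.X + Polynomial.C (n : ℚ))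
        = ∑ I : LowerSet β, a I * Polynomial.C ((b I).eval (n : ℚ)) := by
      apply poly_ext_nat
      intro m
      have := hp (m + n)
      rw [orderCount_add] at this
      push_cast at this
      simp only [Polynomial.eval_comp, Polynomial.eval_add, Polynomial.eval_X, Polynomial.eval_C,
        Polynomial.eval_finsetSum, Polynomial.eval_mul, this, ha, hb]
      rfl
    have h2 := congrArg (fun r => (Polynomial.derivative r).eval 0) h1
    simp only [Polynomial.derivative_comp, Polynomial.derivative_sum] at h2
    simp only [Polynomial.eval_finsetSum, Polynomial.eval_mul, Polynomial.eval_C]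
    simp only [Polynomial.derivative_add, Polynomial.derivative_X, Polynomial.derivative_C,
      Polynomial.derivative_mul, Polynomial.eval_finsetSum, Polynomial.eval_mul,
      Polynomial.eval_add, Polynomial.eval_comp, Polynomial.eval_X, Polynomial.eval_C,
      Polynomial.eval_one, Polynomial.eval_zero, add_zero, zero_add, mul_zero, mul_one, one_mul]
      at h2
    rw [h2]
    refine Finset.sum_congr rfl fun I _ => ?_
    rw [← Polynomial.coeff_zero_eq_eval_zero, Polynomial.coeff_derivative]
    simp
  intro i
  cases i with
  | zero =>
    rw [Polynomial.coeff_zero_eq_eval_zero]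
    have := hp 0
    rw [Nat.cast_zero] at this
    rw [this]
    positivity
  | succ i =>
    have h3 : 0 ≤ (Polynomial.derivative p).coeff i := by
      rw [hder]
      refine CoeffPos.sum _ _ (fun I _ => ?_) i
      by_cases hI : I = ⊥
      · have : a I = 1 := by
          apply poly_ext_nat
          intro n
          have : IsEmpty (I : Set β) := by subst hI; simp
          rw [ha, orderCount_empty]; simp
        rw [this]
        intro j
        simp [Polynomial.coeff_one]
      · have hc : 0 ≤ (a I).coeff 1 :=
          hlin (I : Set β) (hideal β hF I I.lower) (a I) (fun n _ => ha I n)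
        have hbp : CoeffPos (b I) := ih _ (hN ▸ card_compl_lt β I hI) ((I : Set β)ᶜ : Set β) rfl
          (hfilter β hF _ I.lower.compl) (b I) (hb I)
        intro j
        rw [Polynomial.coeff_C_mul]
        exact mul_nonneg hc (hbp j)
    rw [Polynomial.coeff_derivative] at h3
    exact nonneg_of_mul_nonneg_left h3 (by positivity)

/-- The free part of the slab `I`: elements of `I` not above a marked element of `I`. -/
def freePart {β : Type} [PartialOrder β] (A : Set β) (I : LowerSet β) : Set β :=
  {x | x ∈ I ∧ ∀ a ∈ A, ¬ a ≤ x}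

lemma freePart_lower {β : Type} [PartialOrder β] (A : Set β) (I : LowerSet β) :
    IsLowerSet (freePart A I) :=
  fun _ _ hyx hx => ⟨I.lower hyx hx.1, fun a ha hay => hx.2 a ha (hay.trans hyx)⟩

/-- Slab maps are maps on the free part. -/
noncomputable def slabEquiv {β : Type} [PartialOrder β] (A : Set β) (I : LowerSet β)
    (lam : β → ℤ) (t : ℤ) (n : ℕ) (hn : 1 ≤ n) (hc : ∀ a ∈ A, a ∈ I → lam a = t + 1) :
    ConMap (I : Set β) (fun x z => ((x.1 ∈ A → z = n * lam x) ∧ n * t < z) ∧ z ≤ n * (t + 1)) ≃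
    ConMap (freePart A I) (fun _ z => n * t < z ∧ z ≤ n * t + n) := by
  classical
  have hn' : (n : ℤ) * (t + 1) = n * t + n := by ring
  have hn1 : (1 : ℤ) ≤ n := by exact_mod_cast hn
  exact
  { toFun := fun f => ⟨fun x => f.1 ⟨x.1, x.2.1⟩, fun x y h => f.2.1 (by exact h), fun x => by
      have := f.2.2 ⟨x.1, x.2.1⟩
      dsimp only
      exact ⟨this.1.2, by rw [← hn']; exact this.2⟩⟩
    invFun := fun f => ⟨fun x => if hx : x.1 ∈ freePart A I then f.1 ⟨x.1, hx⟩ else n * t + n, by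
      intro x y hxy
      dsimp only
      by_cases hy : y.1 ∈ freePart A I
      · have hx : x.1 ∈ freePart A I := freePart_lower A I hxy hy
        rw [dif_pos hx, dif_pos hy]
        exact f.2.1 (by exact hxy)
      · rw [dif_neg hy]
        split_ifs with hx
        · exact (f.2.2 ⟨x.1, hx⟩).2
        · exact le_rfl, by
      intro x
      dsimp only
      split_ifs with hx
      · have := f.2.2 ⟨x.1, hx⟩
        exact ⟨⟨fun hA => absurd le_rfl (hx.2 _ hA), this.1⟩, by rw [hn']; exact this.2⟩
      · exact ⟨⟨fun hA => by rw [hc _ hA x.2, hn'], by omega⟩, by omega⟩⟩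
    left_inv := by
      rintro ⟨f, hf, hf'⟩
      apply Subtype.ext
      funext x
      dsimp only
      split_ifs with hx
      · rfl
      · have : ∃ a ∈ A, a ≤ x.1 := by
          by_contra h
          push Not at h
          exact hx ⟨x.2, h⟩
        obtain ⟨a, ha, hax⟩ := this
        have haI : a ∈ I := I.lower hax x.2
        have h1 := (hf' ⟨a, haI⟩).1.1 ha
        have h2 : f ⟨a, haI⟩ ≤ f x := hf (by exact hax)
        have h3 := (hf' x).2
        dsimp only at h1
        rw [hc a ha haI] at h1
        omega
    right_inv := by
      rintro ⟨f, hf, hf'⟩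
      apply Subtype.ext
      funext x
      dsimp only
      rw [dif_pos x.2] }

lemma slab_empty {β : Type} [PartialOrder β] (A : Set β) (I : LowerSet β)
    (lam : β → ℤ) (t : ℤ) (n : ℕ) (hn : 1 ≤ n) (hc : ¬ ∀ a ∈ A, a ∈ I → lam a = t + 1) :
    IsEmpty (ConMap (I : Set β)
      (fun x z => ((x.1 ∈ A → z = n * lam x) ∧ n * t < z) ∧ z ≤ n * (t + 1))) := by
  have hn1 : (0 : ℤ) < n := by exact_mod_cast hn
  push Not at hc
  obtain ⟨a, ha, haI, hne⟩ := hc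
  refine ⟨fun f => hne ?_⟩
  have h := f.2.2 ⟨a, haI⟩
  have h1 := h.1.1 ha
  have h2 := h.1.2
  have h3 := h.2
  rw [h1] at h2 h3
  have h4 := lt_of_mul_lt_mul_left h2 hn1.le
  have h5 := le_of_mul_le_mul_left h3 hn1
  dsimp only at h4 h5
  omega

lemma marked_aux
    (F : (α : Type) → [Finite α] → [PartialOrder α] → Prop)
    (hideal : ∀ (α : Type) [Finite α] [PartialOrder α],
      F α → ∀ I : Set α, IsLowerSet I → F I)
    (hfilter : ∀ (α : Type) [Finite α] [PartialOrder α],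
      F α → ∀ I : Set α, IsUpperSet I → F I)
    (hlin : ∀ (α : Type) [Finite α] [PartialOrder α], F α →
      ∀ Ω : Polynomial ℚ, (∀ n : ℕ, 1 ≤ n → Ω.eval (n : ℚ) = orderCount α n) →
        0 ≤ Ω.coeff 1) (k : ℕ) :
    ∀ (β : Type) [Finite β] [PartialOrder β], F β → ∀ (A : Set β) (lam : β → ℤ) (t : ℤ),
      (∀ x, IsMax x → x ∈ A) → (∀ a ∈ A, lam a ≤ t + k) →
      ∃ p : Polynomial ℚ, CoeffPos p ∧ ∀ n : ℕ, 1 ≤ n →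
        Finite (ConMap β (fun x z => (x ∈ A → z = n * lam x) ∧ n * t < z)) ∧
        p.eval (n : ℚ) =
          Nat.card (ConMap β (fun x z => (x ∈ A → z = n * lam x) ∧ n * t < z)) := by
  classical
  induction k with
  | zero =>
    intro β _ _ hF A lam t hmax hlam
    rcases isEmpty_or_nonempty β with hβ | hβ
    · refine ⟨1, fun i => by rw [Polynomial.coeff_one]; split_ifs <;> norm_num, fun n _ => ?_⟩
      have hs : Subsingleton (ConMap β (fun x z => (x ∈ A → z = n * lam x) ∧ n * t < z)) :=
        ⟨fun f g => Subtype.ext (funext fun x => isEmptyElim x)⟩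
      refine ⟨inferInstance, ?_⟩
      have : Nat.card (ConMap β (fun x z => (x ∈ A → z = n * lam x) ∧ n * t < z)) = 1 := by
        rw [Nat.card_eq_one_iff_unique]
        exact ⟨hs, ⟨⟨fun x => isEmptyElim x, fun x => isEmptyElim x, fun x => isEmptyElim x⟩⟩⟩
      rw [this]; simp
    · refine ⟨0, fun i => by simp, fun n hn => ?_⟩
      have hs : IsEmpty (ConMap β (fun x z => (x ∈ A → z = n * lam x) ∧ n * t < z)) := by
        refine ⟨fun f => ?_⟩
        obtain ⟨m, hm⟩ := Set.Finite.exists_maximal (Set.finite_univ (α := β)) Set.univ_nonempty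
        have hmA : m ∈ A := hmax m fun y hy => hm.2 (Set.mem_univ y) hy
        have h := f.2.2 m
        have h1 := h.1 hmA
        have h2 := h.2
        rw [h1] at h2
        have h4 := lt_of_mul_lt_mul_left h2 (by positivity)
        have := hlam m hmA
        simp at this
        omega
      exact ⟨inferInstance, by rw [Nat.card_of_isEmpty]; simp⟩
  | succ k ih =>
    intro β _ _ hF A lam t hmax hlam
    have hQ : ∀ I : LowerSet β, ∃ p : Polynomial ℚ, CoeffPos p ∧ ∀ n : ℕ, 1 ≤ n →
        Finite (ConMap ((I : Set β)ᶜ : Set β)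
          (fun x z => (x.1 ∈ A → z = n * lam x) ∧ n * (t + 1) < z)) ∧
        p.eval (n : ℚ) = Nat.card (ConMap ((I : Set β)ᶜ : Set β)
          (fun x z => (x.1 ∈ A → z = n * lam x) ∧ n * (t + 1) < z)) := by
      intro I
      refine ih ((I : Set β)ᶜ : Set β) (hfilter β hF _ I.lower.compl) {x | x.1 ∈ A}
        (fun x => lam x.1) (t + 1) ?_ ?_
      · intro x hx
        refine hmax x.1 fun y hy => ?_
        have hyI : y ∈ ((I : Set β)ᶜ : Set β) := I.lower.compl hy x.2
        exact hx (b := ⟨y, hyI⟩) hy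
      · intro a ha
        have := hlam a.1 ha
        push_cast at this
        omega
    have hR : ∀ I : LowerSet β, ∃ q : Polynomial ℚ, CoeffPos q ∧
        ∀ n : ℕ, q.eval (n : ℚ) = orderCount (freePart A I) n := by
      intro I
      obtain ⟨q, hq⟩ := exists_orderPoly _ (freePart A I) rfl
      exact ⟨q, orderPoly_pos F hideal hfilter hlin _ (freePart A I) rfl
        (hideal β hF _ (freePart_lower A I)) q hq, hq⟩
    choose q hqp hq using hQ
    choose r hrp hr using hR
    refine ⟨∑ I : LowerSet β,
      (if ∀ a ∈ A, a ∈ I → lam a = t + 1 then r I else 0) * q I, ?_, ?_⟩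
    · refine CoeffPos.sum _ _ fun I _ => CoeffPos.mul ?_ (hqp I)
      split_ifs
      · exact hrp I
      · intro i; simp
    · intro n hn
      have hn1 : (0 : ℤ) < n := by exact_mod_cast hn
      -- the lower slab
      have hslab : ∀ I : LowerSet β, Finite (ConMap (I : Set β)
          (fun x z => ((x.1 ∈ A → z = n * lam x) ∧ n * t < z) ∧ z ≤ n * (t + 1))) ∧
          (Polynomial.eval (n : ℚ) (if ∀ a ∈ A, a ∈ I → lam a = t + 1 then r I else 0)) =
          Nat.card (ConMap (I : Set β)
          (fun x z => ((x.1 ∈ A → z = n * lam x) ∧ n * t < z) ∧ z ≤ n * (t + 1))) := by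
        intro I
        by_cases hc : ∀ a ∈ A, a ∈ I → lam a = t + 1
        · have e := (chainEquiv (freePart A I) (n * t) n _ (fun _ _ => Iff.rfl)).trans
            (slabEquiv A I lam t n hn hc).symm
          refine ⟨Finite.of_equiv _ e, ?_⟩
          rw [if_pos hc, hr, orderCount, Nat.card_congr e]
        · have := slab_empty A I lam t n hn hc
          refine ⟨inferInstance, ?_⟩
          rw [if_neg hc, Nat.card_of_isEmpty]; simp
      -- the upper part
      have hup : ∀ I : LowerSet β, (fun (x : ↥((I : Set β)ᶜ : Set β)) (z : ℤ) =>
          ((x.1 ∈ A → z = n * lam x) ∧ n * t < z) ∧ n * (t + 1) < z) =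
          (fun (x : ↥((I : Set β)ᶜ : Set β)) (z : ℤ) =>
            (x.1 ∈ A → z = n * lam x) ∧ n * (t + 1) < z) := by
        intro I
        funext x z
        have : (n : ℤ) * (t + 1) = n * t + n := by ring
        apply propext
        constructor
        · exact fun h => ⟨h.1.1, h.2⟩
        · exact fun h => ⟨⟨h.1, by omega⟩, h.2⟩
      have hfin : ∀ I : LowerSet β, Finite (ConMap (I : Set β)
          (fun x z => ((x.1 ∈ A → z = n * lam x) ∧ n * t < z) ∧ z ≤ n * (t + 1)) ×
          ConMap ((I : Set β)ᶜ : Set β)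
          (fun x z => ((x.1 ∈ A → z = n * lam x) ∧ n * t < z) ∧ n * (t + 1) < z)) := by
        intro I
        rw [hup I]
        have := (hslab I).1
        have := (hq I n hn).1
        infer_instance
      refine ⟨conMap_finite _ (n * (t + 1)) hfin, ?_⟩
      rw [conMap_card _ (n * (t + 1)) hfin, Polynomial.eval_finsetSum]
      push_cast
      refine Finset.sum_congr rfl fun I _ => ?_
      rw [Polynomial.eval_mul, (hslab I).2, (hq I n hn).2, hup I]
      rfl

/-- **Theorem (Ehrhart positivity of marked order polytopes).**
Let `F` be a family of finite posets closed under isomorphism, ideals and filters,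
such that for every member the linear coefficient of the order polynomial is
nonnegative.  Then for any member `P`, any subposet `A ⊆ P` containing all minima
and maxima of `P`, and any order preserving `λ : A → ℤ`, the marked order polytope
`O_{P,A}(λ)` is Ehrhart positive: there is a polynomial `p ∈ ℚ[n]` with nonnegative
coefficients such that `p(n) = Ω_{P,A}(n·λ)` for all integers `n ≥ 1`. -/
theorem marked_order_ehrhart_positivity
    (F : (α : Type) → [Finite α] → [PartialOrder α] → Prop)
    (hiso : ∀ (α β : Type) [Finite α] [PartialOrder α] [Finite β] [PartialOrder β],
      F α → Nonempty (α ≃o β) → F β)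
    (hideal : ∀ (α : Type) [Finite α] [PartialOrder α],
      F α → ∀ I : Set α, IsLowerSet I → F I)
    (hfilter : ∀ (α : Type) [Finite α] [PartialOrder α],
      F α → ∀ I : Set α, IsUpperSet I → F I)
    (hlin : ∀ (α : Type) [Finite α] [PartialOrder α], F α →
      ∀ Ω : Polynomial ℚ, (∀ n : ℕ, 1 ≤ n → Ω.eval (n : ℚ) = orderCount α n) →
        0 ≤ Ω.coeff 1)
    (α : Type) [Finite α] [PartialOrder α] (hP : F α)
    (A : Set α) (hminmax : ∀ x : α, IsMin x ∨ IsMax x → x ∈ A)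
    (lam : α → ℤ) (hord : ∀ x ∈ A, ∀ y ∈ A, x ≤ y → lam x ≤ lam y) :
    ∃ p : Polynomial ℚ, (∀ i : ℕ, 0 ≤ p.coeff i) ∧
      ∀ n : ℕ, 1 ≤ n →
        p.eval (n : ℚ) = markedCount A (fun x => (n : ℤ) * lam x) := by
  obtain ⟨B, hB⟩ : ∃ B : ℕ, ∀ x, |lam x| ≤ B := by
    obtain ⟨b, hb⟩ := (Set.finite_range (fun x => (lam x).natAbs)).bddAbove
    refine ⟨b, fun x => ?_⟩
    have : (lam x).natAbs ≤ b := hb ⟨x, rfl⟩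
    rw [Int.abs_eq_natAbs]
    exact_mod_cast this
  obtain ⟨p, hp, hp'⟩ := marked_aux F hideal hfilter hlin (2 * B + 1) α hP A lam (-B - 1)
    (fun x hx => hminmax x (Or.inr hx)) (fun a _ => by
      have := abs_le.1 (hB a)
      push_cast
      omega)
  refine ⟨p, hp, fun n hn => ?_⟩
  rw [(hp' n hn).2, markedCount, ConMap]
  have hn1 : (0 : ℤ) < n := by exact_mod_cast hn
  congr 1
  apply Nat.card_congr
  apply Equiv.subtypeEquivRight
  intro f
  constructor
  · exact fun h => ⟨h.1, fun a ha => (h.2 a).1 ha⟩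
  · refine fun h => ⟨h.1, fun x => ⟨fun hx => h.2 x hx, ?_⟩⟩
    obtain ⟨m, hmx, hm⟩ := Set.Finite.exists_le_minimal (Set.finite_univ (α := α)) (Set.mem_univ x)
    have hmA : m ∈ A := hminmax m (Or.inl fun y hy => hm.2 (Set.mem_univ y) hy)
    have h1 := h.2 m hmA
    have h2 := h.1 hmx
    have h3 := abs_le.1 (hB m)
    have h4 : (n : ℤ) * (-B - 1) < n * lam m := mul_lt_mul_of_pos_left (by omega) hn1
    omega
end

section
/- Let P be the cell poset of a skew shape λ/μ, let A ⊆ P be a subposet containing all minima and maxima of P, and let λ' : A → ℤ be an order preserving map. Then the marked order polytope O_{P,A}(λ') is Ehrhart positive: there exists a polynomial p ∈ ℚ[n] with nonnegative coefficients such that p(n) = Ω_{P,A}(n·λ') for all integers n ≥ 1. -/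
/-- The cell poset of the skew shape `lam/mu`: cells `(i, j)` with `mu i < j ≤ lam i`,
ordered by `(i, j) ≤ (i', j')` iff `i ≥ i'` and `j ≥ j'`. -/
abbrev SkewPoset (k : ℕ) (lam mu : Fin k → ℕ) : Type :=
  {p : (Fin k × ℕ)ᵒᵈ // mu (OrderDual.ofDual p).1 < (OrderDual.ofDual p).2 ∧
      (OrderDual.ofDual p).2 ≤ lam (OrderDual.ofDual p).1}

namespace SkewEhrhart

open Finset Polynomial

section Algebra

variable {R : Type*} [Ring R] [Algebra ℚ R]

/-- Leibniz rule for powers of an element commuting with its derivative. -/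
theorem D_pow (D : R →+ R) (hD : ∀ a b, D (a * b) = D a * b + a * D b) {N : R}
    (hc : Commute N (D N)) (j : ℕ) : D (N ^ (j + 1)) = ((j : ℚ) + 1) • (N ^ j * D N) := by
  induction j with
  | zero => simp
  | succ j ih =>
    rw [pow_succ, hD, ih, smul_mul_assoc, mul_assoc, ← hc.eq, ← mul_assoc, ← pow_succ]
    push_cast
    simp only [add_smul, one_smul]

theorem D_one {R : Type*} [Ring R] (D : R →+ R) (hD : ∀ a b, D (a * b) = D a * b + a * D b) : D 1 = 0 := by
  have := hD 1 1
  simpa using this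

theorem D_exp (D : R →+ R) (hD : ∀ a b, D (a * b) = D a * b + a * D b) {a : R}
    (hc : Commute a (D a)) (ha : IsNilpotent a) :
    D (IsNilpotent.exp a) = IsNilpotent.exp a * D a := by
  obtain ⟨m, hm⟩ := ha
  have hm1 : a ^ (m + 1) = 0 := by rw [pow_succ, hm, zero_mul]
  conv_lhs => rw [IsNilpotent.exp_eq_sum hm1]
  rw [IsNilpotent.exp_eq_sum hm, map_sum, Finset.sum_range_succ', Finset.sum_mul]
  simp only [pow_zero, map_rat_smul, D_one D hD, smul_zero, add_zero]
  refine Finset.sum_congr rfl fun j _ => ?_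
  rw [D_pow D hD hc, smul_smul, smul_mul_assoc]
  congr 1
  rw [Nat.factorial_succ]
  push_cast
  have : (j.factorial : ℚ) ≠ 0 := by positivity
  field_simp

theorem log_exists (D : R →+ R) (hD : ∀ a b, D (a * b) = D a * b + a * D b) {N G : R} {m : ℕ}
    (hm : N ^ m = 0) (hl : D N = (1 + N) * G) (hr : D N = G * (1 + N)) :
    ∃ L V S : R, L = N * S ∧ IsNilpotent L ∧ D L = G ∧ V * (1 + N) = 1 ∧ (1 + N) * V = 1 ∧
      D (V * IsNilpotent.exp L) = 0 := by
  have hc : Commute N (D N) := by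
    have h1 : (1 + N) * D N = D N * (1 + N) := by
      conv_lhs => rw [hr, ← mul_assoc, ← hl]
    have h2 : N * D N = D N * N := by
      have := h1
      rw [add_mul, mul_add, one_mul, mul_one] at this
      exact add_left_cancel this
    exact h2
  set V : R := ∑ j ∈ range m, (-N) ^ j with hV
  have hVN : V * (1 + N) = 1 := by
    have := geom_sum_mul_neg (-N) m
    rw [sub_neg_eq_add, neg_pow N m, hm, mul_zero, sub_zero] at this
    exact this
  have hNV : (1 + N) * V = 1 := by
    have := mul_neg_geom_sum (-N) m
    rw [sub_neg_eq_add, neg_pow N m, hm, mul_zero, sub_zero] at this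
    exact this
  set S : R := ∑ j ∈ range m, (((-1 : ℚ) ^ j) / (j + 1)) • N ^ j with hS
  have hNS : Commute N S := by
    apply Commute.sum_right
    intro j _
    exact ((Commute.refl N).pow_right j).smul_right _
  have hL : N * S = ∑ j ∈ range m, (((-1 : ℚ) ^ j) / (j + 1)) • N ^ (j + 1) := by
    rw [hS, Finset.mul_sum]
    refine Finset.sum_congr rfl fun j _ => ?_
    rw [mul_smul_comm, ← pow_succ']
  have hDL : D (N * S) = V * D N := by
    rw [hL, map_sum, hV, Finset.sum_mul]
    refine Finset.sum_congr rfl fun j _ => ?_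
    rw [map_rat_smul, D_pow D hD hc, smul_smul, neg_pow N j]
    have : ((j : ℚ) + 1) ≠ 0 := by positivity
    rw [div_mul_cancel₀ _ this]
    rcases Nat.even_or_odd j with hj | hj
    · rw [hj.neg_one_pow, hj.neg_one_pow]; simp
    · rw [hj.neg_one_pow, hj.neg_one_pow]; simp
  have hcV : Commute N V := by
    apply Commute.sum_right
    intro j _
    exact ((Commute.refl N).neg_right).pow_right j
  have hDNV : Commute (D N) V := by
    apply Commute.sum_right
    intro j _
    exact (hc.symm.neg_right).pow_right j
  have hDNS : Commute (D N) S := by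
    apply Commute.sum_right
    intro j _
    exact (hc.symm.pow_right j).smul_right _
  have hVS : Commute V S := by
    apply Commute.sum_right
    intro j _
    exact (hcV.symm.pow_right j).smul_right _
  have hnil : IsNilpotent (N * S) := hNS.isNilpotent_mul_right ⟨m, hm⟩
  have hG : V * D N = G := by rw [hl, ← mul_assoc, hVN, one_mul]
  have hcL : Commute (N * S) (D (N * S)) := by
    rw [hDL]
    exact ((hcV.mul_right hc).mul_left (hVS.symm.mul_right hDNS.symm))
  refine ⟨N * S, V, S, rfl, hnil, by rw [hDL, hG], hVN, hNV, ?_⟩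
  have hDV : D V = - (V * D N * V) := by
    have h := hD V (1 + N)
    rw [hVN, D_one D hD, map_add, D_one D hD, zero_add] at h
    have h2 : D V * (1 + N) = - (V * D N) := eq_neg_of_add_eq_zero_left h.symm
    calc D V = D V * (1 + N) * V := by rw [mul_assoc, hNV, mul_one]
      _ = _ := by rw [h2, neg_mul]
  have hE : Commute (D N) (IsNilpotent.exp (N * S)) := by
    rw [IsNilpotent.exp]
    apply Commute.sum_right
    intro j _
    exact ((hc.symm.mul_right hDNS).pow_right j).smul_right _
  have hEV : Commute V (IsNilpotent.exp (N * S)) := by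
    rw [IsNilpotent.exp]
    apply Commute.sum_right
    intro j _
    exact ((hcV.symm.mul_right hVS).pow_right j).smul_right _
  rw [hD, D_exp D hD hcL hnil, hDV, hDL, hEV.symm.mul_right hE.symm |>.eq]
  rw [mul_assoc V (D N) V, hDNV.eq]
  noncomm_ring

end Algebra

section Walk

/-- One step of the boundary walk. -/
noncomputable def kap (u v b : ℤ) : ℚ[X] :=
  if u < b then (if v ≤ u then X * (1 - X) ^ (u - v).toNat else 0) else (if v = b then 1 else 0)

/-- Weight of the walk after it has started. -/
noncomputable def TT : (k : ℕ) → ℤ → (Fin k → ℤ) → (Fin k → ℤ) → ℚ[X]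
  | 0, _, _, _ => 1
  | k + 1, u, ν, β => kap u (ν 0) (β 0) * TT k (ν 0) (Fin.tail ν) (Fin.tail β)

/-- The infinitesimal generator, in recursive form. -/
noncomputable def GG : (k : ℕ) → (Fin k → ℤ) → (Fin k → ℤ) → ℚ[X]
  | 0, _, _ => 0
  | k + 1, ν, β =>
    if ν 0 < β 0 then (1 - X) ^ (β 0 - 1 - ν 0).toNat * TT k (ν 0) (Fin.tail ν) (Fin.tail β)
    else GG k (Fin.tail ν) (Fin.tail β)

noncomputable def ww (a b : ℤ) : ℚ[X] := if a < b then X else 1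

/-- `X ^ (number of nonempty rows)`. -/
noncomputable def Wp {k : ℕ} (α β : Fin k → ℤ) : ℚ[X] := ∏ i, ww (α i) (β i)

noncomputable def box {k : ℕ} (α β : Fin k → ℤ) : Finset (Fin k → ℤ) :=
  Fintype.piFinset fun i => Icc (α i) (β i)

theorem mem_box {k : ℕ} {α β ν : Fin k → ℤ} : ν ∈ box α β ↔ α ≤ ν ∧ ν ≤ β := by
  simp [box, Fintype.mem_piFinset, Pi.le_def, forall_and]

theorem box_sum_succ {M : Type*} [AddCommMonoid M] {k : ℕ} (α β : Fin (k + 1) → ℤ)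
    (F : (Fin (k + 1) → ℤ) → M) :
    ∑ ν ∈ box α β, F ν = ∑ v ∈ Icc (α 0) (β 0), ∑ ν ∈ box (Fin.tail α) (Fin.tail β),
      F (Fin.cons v ν) := by
  rw [← Finset.sum_product']
  refine Finset.sum_bij' (fun ν _ => (ν 0, Fin.tail ν)) (fun p _ => Fin.cons p.1 p.2) ?_ ?_ ?_ ?_ ?_
  · intro ν hν
    simp only [box, Fintype.mem_piFinset, Finset.mem_product] at hν ⊢
    exact ⟨hν 0, fun i => hν i.succ⟩
  · intro p hp
    simp only [box, Fintype.mem_piFinset, Finset.mem_product] at hp ⊢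
    intro i
    refine Fin.cases ?_ ?_ i
    · simpa using hp.1
    · intro j; simpa [Fin.tail] using hp.2 j
  · intro ν _; simp
  · intro p _; simp
  · intro ν _; simp

theorem geo (a u : ℤ) (h : a ≤ u) :
    ∑ v ∈ Icc a u, ww a v * (1 - X : ℚ[X]) ^ (u - v).toNat = 1 := by
  induction u, h using Int.leInduction with
  | base => simp [ww]
  | succ u hu ih =>
    have h1 : Icc a (u + 1) = insert (u + 1) (Icc a u) := by
      ext v; simp only [mem_Icc, mem_insert]; omega
    rw [h1, Finset.sum_insert (by simp)]
    have h2 : ∑ v ∈ Icc a u, ww a v * (1 - X : ℚ[X]) ^ (u + 1 - v).toNat =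
        (1 - X) * ∑ v ∈ Icc a u, ww a v * (1 - X : ℚ[X]) ^ (u - v).toNat := by
      rw [Finset.mul_sum]
      refine Finset.sum_congr rfl fun v hv => ?_
      rw [mem_Icc] at hv
      have : (u + 1 - v).toNat = (u - v).toNat + 1 := by omega
      rw [this, pow_succ]; ring
    rw [h2, ih]
    have : a < u + 1 := by omega
    simp [ww, this]

theorem kap_sum (a b u : ℤ) (hab : a ≤ b) (hau : a ≤ u) :
    ∑ v ∈ Icc a b, ww a v * kap u v b = ww a b := by
  by_cases hub : u < b
  · have h1 : ∀ v ∈ Icc a b, ww a v * kap u v b =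
        if v ≤ u then X * (ww a v * (1 - X : ℚ[X]) ^ (u - v).toNat) else 0 := by
      intro v _
      simp only [kap, hub, if_true]
      split_ifs <;> ring
    rw [Finset.sum_congr rfl h1, ← Finset.sum_filter]
    have h2 : (Icc a b).filter (fun v => v ≤ u) = Icc a u := by
      ext v; simp only [mem_filter, mem_Icc]; omega
    have h3 : a < b := by omega
    rw [h2, ← Finset.mul_sum, geo a u hau, ww, if_pos h3, mul_one]
  · simp [kap, hub, hab]

theorem Wp_cons {k : ℕ} (α : Fin (k + 1) → ℤ) (v : ℤ) (ν : Fin k → ℤ) :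
    Wp α (Fin.cons v ν : Fin (k + 1) → ℤ) = ww (α 0) v * Wp (Fin.tail α) ν := by
  simp [Wp, Fin.prod_univ_succ, Fin.tail]

theorem Wp_succ {k : ℕ} (α β : Fin (k + 1) → ℤ) :
    Wp α β = ww (α 0) (β 0) * Wp (Fin.tail α) (Fin.tail β) := by
  simp [Wp, Fin.prod_univ_succ, Fin.tail]

theorem tail_antitone {k : ℕ} {α : Fin (k + 1) → ℤ} (h : Antitone α) : Antitone (Fin.tail α) :=
  fun _ _ hij => h (Fin.succ_le_succ_iff.2 hij)

theorem sumT : ∀ (k : ℕ) (u : ℤ) (α β : Fin k → ℤ), Antitone α → α ≤ β → (∀ i, α i ≤ u) →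
    ∑ ν ∈ box α β, Wp α ν * TT k u ν β = Wp α β
  | 0, u, α, β, _, _, _ => by simp [box, Wp, TT]
  | k + 1, u, α, β, hα, hαβ, hu => by
    rw [box_sum_succ, Wp_succ, ← kap_sum (α 0) (β 0) u (hαβ 0) (hu 0), Finset.sum_mul]
    refine Finset.sum_congr rfl fun v hv => ?_
    rw [mem_Icc] at hv
    rw [← sumT k v (Fin.tail α) (Fin.tail β) (tail_antitone hα) (fun i => hαβ i.succ)
      (fun i => (hα (Fin.zero_le _)).trans hv.1), Finset.mul_sum]
    refine Finset.sum_congr rfl fun ν _ => ?_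
    rw [Wp_cons, TT]
    simp only [Fin.cons_zero, Fin.tail_cons]
    ring

theorem sumG : ∀ (k : ℕ) (α β : Fin k → ℤ), Antitone α → α ≤ β →
    ∑ ν ∈ box α β, Wp α ν * GG k ν β = derivative (Wp α β)
  | 0, α, β, _, _ => by simp [Wp, GG]
  | k + 1, α, β, hα, hαβ => by
    have key : ∀ v ∈ Icc (α 0) (β 0), ∑ ν ∈ box (Fin.tail α) (Fin.tail β),
        Wp α (Fin.cons v ν : Fin (k + 1) → ℤ) * GG (k + 1) (Fin.cons v ν) β =
        if v < β 0 then ww (α 0) v * (1 - X : ℚ[X]) ^ (β 0 - 1 - v).toNat *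
            Wp (Fin.tail α) (Fin.tail β)
          else ww (α 0) v * derivative (Wp (Fin.tail α) (Fin.tail β)) := by
      intro v hv
      rw [mem_Icc] at hv
      split_ifs with h
      · rw [← sumT k v (Fin.tail α) (Fin.tail β) (tail_antitone hα) (fun i => hαβ i.succ)
          (fun i => (hα (Fin.zero_le _)).trans hv.1), Finset.mul_sum]
        refine Finset.sum_congr rfl fun ν _ => ?_
        rw [Wp_cons, GG]
        simp only [Fin.cons_zero, Fin.tail_cons, h, if_true]
        ring
      · rw [← sumG k (Fin.tail α) (Fin.tail β) (tail_antitone hα) (fun i => hαβ i.succ),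
          Finset.mul_sum]
        refine Finset.sum_congr rfl fun ν _ => ?_
        rw [Wp_cons, GG]
        simp only [Fin.cons_zero, Fin.tail_cons, h, if_false]
        ring
    rw [box_sum_succ, Finset.sum_congr rfl key, Wp_succ, derivative_mul]
    have h00 : α 0 ≤ β 0 := hαβ 0
    by_cases h : α 0 < β 0
    · have h1 : Icc (α 0) (β 0) = insert (β 0) (Icc (α 0) (β 0 - 1)) := by
        ext v; simp only [mem_Icc, mem_insert]; omega
      have h2 : ∀ v ∈ Icc (α 0) (β 0 - 1), (if v < β 0 then
          ww (α 0) v * (1 - X : ℚ[X]) ^ (β 0 - 1 - v).toNat * Wp (Fin.tail α) (Fin.tail β)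
          else ww (α 0) v * derivative (Wp (Fin.tail α) (Fin.tail β))) =
          ww (α 0) v * (1 - X : ℚ[X]) ^ (β 0 - 1 - v).toNat * Wp (Fin.tail α) (Fin.tail β) := by
        intro v hv
        rw [mem_Icc] at hv
        rw [if_pos (by omega)]
      rw [h1, Finset.sum_insert (by simp), Finset.sum_congr rfl h2, ← Finset.sum_mul,
        geo _ _ (by omega)]
      simp [ww, h]
      ring
    · have h' : α 0 = β 0 := by omega
      rw [h']
      simp [ww]

/-- Support of the walk: antitone sequences only. -/
theorem TT_ne_zero : ∀ (k : ℕ) (u : ℤ) (ν β : Fin k → ℤ), ν ≤ β → TT k u ν β ≠ 0 →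
    Antitone ν ∧ ∀ i, ν i ≤ u
  | 0, u, ν, β, _, _ => ⟨fun i => i.elim0, fun i => i.elim0⟩
  | k + 1, u, ν, β, hνβ, h => by
    rw [TT] at h
    obtain ⟨h1, h2⟩ := TT_ne_zero k (ν 0) (Fin.tail ν) (Fin.tail β) (fun i => hνβ i.succ)
      (right_ne_zero_of_mul h)
    have h3 : ν 0 ≤ u := by
      have := left_ne_zero_of_mul h
      by_contra hcon
      apply this
      rw [kap]
      split_ifs
      · rfl
      · have := hνβ 0; omega
      · rfl
    refine ⟨?_, ?_⟩
    · intro i j hij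
      induction i using Fin.cases with
      | zero =>
        induction j using Fin.cases with
        | zero => exact le_rfl
        | succ j => exact h2 j
      | succ i =>
        induction j using Fin.cases with
        | zero => exact absurd hij (by simp)
        | succ j => exact h1 (Fin.succ_le_succ_iff.1 hij)
    · intro i
      induction i using Fin.cases with
      | zero => exact h3
      | succ i => exact (h2 i).trans h3

theorem GG_ne_zero : ∀ (k : ℕ) (ν β : Fin k → ℤ), Antitone β → ν ≤ β → GG k ν β ≠ 0 → Antitone ν
  | 0, ν, β, _, _, _ => fun i => i.elim0
  | k + 1, ν, β, hβ, hνβ, h => by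
    have main : Antitone (Fin.tail ν) ∧ ∀ i, Fin.tail ν i ≤ ν 0 := by
      rw [GG] at h
      split_ifs at h with h0
      · exact TT_ne_zero k (ν 0) (Fin.tail ν) (Fin.tail β) (fun i => hνβ i.succ)
          (right_ne_zero_of_mul h)
      · refine ⟨GG_ne_zero k _ _ (tail_antitone hβ) (fun i => hνβ i.succ) h, fun i => ?_⟩
        exact (hνβ i.succ).trans ((hβ (Fin.zero_le _)).trans (not_lt.1 h0))
    obtain ⟨h1, h2⟩ := main
    intro i j hij
    induction i using Fin.cases with
    | zero =>
      induction j using Fin.cases with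
      | zero => exact le_rfl
      | succ j => exact h2 j
    | succ i =>
      induction j using Fin.cases with
      | zero => exact absurd hij (by simp)
      | succ j => exact h1 (Fin.succ_le_succ_iff.1 hij)

end Walk

section Closed

def dd {k : ℕ} (α β : Fin k → ℤ) : ℕ := (univ.filter fun i : Fin k => α i < β i).card

def EE {k : ℕ} (α β : Fin (k + 1) → ℤ) : Finset (Fin k) :=
  univ.filter fun i : Fin k => α i.castSucc < β i.succ

def qq {k : ℕ} (α β : Fin (k + 1) → ℤ) : ℤ :=
  ∑ i, (β i - α i) - ∑ i ∈ EE α β, (β i.succ - α i.castSucc) - 1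

/-- The infinitesimal generator in closed form. -/
noncomputable def GC {k : ℕ} (α β : Fin (k + 1) → ℤ) : ℚ[X] :=
  if dd α β = (EE α β).card + 1 then X ^ (EE α β).card * (1 - X) ^ (qq α β).toNat else 0

theorem TT_prod : ∀ (k : ℕ) (ν β : Fin (k + 1) → ℤ),
    TT k (ν 0) (Fin.tail ν) (Fin.tail β) =
      ∏ i : Fin k, kap (ν i.castSucc) (ν i.succ) (β i.succ)
  | 0, ν, β => by simp [TT]
  | k + 1, ν, β => by
    rw [TT, TT_prod k (Fin.tail ν) (Fin.tail β), Fin.prod_univ_succ]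
    rfl

theorem dd_succ {k : ℕ} (α β : Fin (k + 1) → ℤ) :
    dd α β = (if α 0 < β 0 then 1 else 0) + dd (Fin.tail α) (Fin.tail β) := by
  simp only [dd, Finset.card_filter, Fin.sum_univ_succ]
  rfl

theorem mem_tail_filter {k : ℕ} {ν β : Fin (k + 1) → ℤ} {i : Fin k} :
    (i ∈ univ.filter fun i : Fin k => Fin.tail ν i < Fin.tail β i) ↔ ν i.succ < β i.succ := by
  rw [mem_filter]
  simp only [mem_univ, true_and]
  rfl

theorem mem_EE {k : ℕ} {ν β : Fin (k + 1) → ℤ} {i : Fin k} :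
    i ∈ EE ν β ↔ ν i.castSucc < β i.succ := by
  simp [EE]

theorem EE_subset {k : ℕ} {ν β : Fin (k + 1) → ℤ} (hν : Antitone ν) :
    EE ν β ⊆ univ.filter fun i : Fin k => Fin.tail ν i < Fin.tail β i := by
  intro i hi
  rw [mem_EE] at hi
  rw [mem_tail_filter]
  exact (hν (Fin.castSucc_le_succ i)).trans_lt hi

theorem TT_closed {k : ℕ} {ν β : Fin (k + 1) → ℤ} (hν : Antitone ν) (hνβ : ν ≤ β) :
    TT k (ν 0) (Fin.tail ν) (Fin.tail β) =
      if dd (Fin.tail ν) (Fin.tail β) = (EE ν β).card then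
        X ^ (EE ν β).card * (1 - X) ^ (∑ i ∈ EE ν β, (ν i.castSucc - ν i.succ)).toNat else 0 := by
  rw [TT_prod]
  split_ifs with h
  · have hEq : EE ν β = univ.filter fun i : Fin k => Fin.tail ν i < Fin.tail β i :=
      Finset.eq_of_subset_of_card_le (EE_subset hν) h.le
    have h1 : ∀ i : Fin k, kap (ν i.castSucc) (ν i.succ) (β i.succ) =
        if i ∈ EE ν β then X * (1 - X) ^ (ν i.castSucc - ν i.succ).toNat else 1 := by
      intro i
      by_cases hi : i ∈ EE ν β
      · have h2 : ν i.castSucc < β i.succ := by simpa [EE] using hi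
        rw [kap, if_pos h2, if_pos (hν (Fin.castSucc_le_succ i)), if_pos hi]
      · have h2 : ¬ ν i.castSucc < β i.succ := by simpa [EE] using hi
        have h3 : ¬ ν i.succ < β i.succ := by
          rwa [hEq, mem_tail_filter] at hi
        have h4 : ν i.succ ≤ β i.succ := hνβ i.succ
        rw [kap, if_neg h2, if_pos (by omega), if_neg hi]
    rw [Finset.prod_congr rfl fun i _ => h1 i, Finset.prod_ite_mem, Finset.univ_inter,
      Finset.prod_mul_distrib, Finset.prod_const, Finset.prod_pow_eq_pow_sum]
    congr 2
    have h5 : ((∑ i ∈ EE ν β, (ν i.castSucc - ν i.succ).toNat : ℕ) : ℤ) =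
        ∑ i ∈ EE ν β, (ν i.castSucc - ν i.succ) := by
      push_cast
      refine Finset.sum_congr rfl fun i _ => ?_
      have : ν i.succ ≤ ν i.castSucc := hν (Fin.castSucc_le_succ i)
      omega
    omega
  · have h1 : ∃ i ∈ univ.filter (fun i : Fin k => Fin.tail ν i < Fin.tail β i), i ∉ EE ν β := by
      by_contra hcon
      push Not at hcon
      exact h (le_antisymm (Finset.card_le_card hcon) (Finset.card_le_card (EE_subset hν)))
    obtain ⟨i, hi, hiE⟩ := h1
    have h2 : ¬ ν i.castSucc < β i.succ := by simpa [EE] using hiE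
    have h3 : ν i.succ < β i.succ := mem_tail_filter.1 hi
    refine Finset.prod_eq_zero (mem_univ i) ?_
    rw [kap, if_neg h2, if_neg h3.ne]

theorem GG_closed : ∀ (k : ℕ) (ν β : Fin (k + 1) → ℤ), Antitone ν → Antitone β → ν ≤ β →
    GG (k + 1) ν β = GC ν β := by
  intro k
  induction k with
  | zero =>
    intro ν β hν hβ hνβ
    rw [GG, GC, dd_succ]
    by_cases h : ν 0 < β 0
    · simp [h, dd, EE, qq, TT, sub_right_comm]
    · simp [h, dd, EE, GG]
  | succ k ih =>
    intro ν β hν hβ hνβ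
    rw [GG, GC, dd_succ]
    by_cases h : ν 0 < β 0
    · rw [if_pos h, if_pos h, TT_closed hν hνβ]
      by_cases h2 : dd (Fin.tail ν) (Fin.tail β) = (EE ν β).card
      · rw [if_pos h2, if_pos (by omega)]
        have hEq : EE ν β = univ.filter fun i : Fin (k + 1) => Fin.tail ν i < Fin.tail β i :=
          Finset.eq_of_subset_of_card_le (EE_subset hν) h2.le
        have h3 : qq ν β = (β 0 - 1 - ν 0) + ∑ i ∈ EE ν β, (ν i.castSucc - ν i.succ) := by
          have h4 : ∑ i : Fin (k + 1), (β i.succ - ν i.succ) =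
              ∑ i ∈ EE ν β, (β i.succ - ν i.succ) := by
            symm
            apply Finset.sum_subset (Finset.subset_univ _)
            intro i _ hi
            have h5 : ¬ ν i.succ < β i.succ := by rwa [hEq, mem_tail_filter] at hi
            have h6 : ν i.succ ≤ β i.succ := hνβ i.succ
            omega
          have h7 : ∑ i ∈ EE ν β, (ν i.castSucc - ν i.succ) =
              ∑ i ∈ EE ν β, (β i.succ - ν i.succ) - ∑ i ∈ EE ν β, (β i.succ - ν i.castSucc) := by
            rw [← Finset.sum_sub_distrib]
            exact Finset.sum_congr rfl fun i _ => by ring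
          rw [qq, Fin.sum_univ_succ, h4, h7]
          ring
        have h8 : 0 ≤ ∑ i ∈ EE ν β, (ν i.castSucc - ν i.succ) :=
          Finset.sum_nonneg fun i _ => sub_nonneg.2 (hν (Fin.castSucc_le_succ i))
        have h9 : (qq ν β).toNat =
            (β 0 - 1 - ν 0).toNat + (∑ i ∈ EE ν β, (ν i.castSucc - ν i.succ)).toNat := by
          rw [h3, Int.toNat_add (by omega) h8]
        rw [h9, pow_add]
        ring
      · rw [if_neg h2, if_neg (by omega), mul_zero]
    · rw [if_neg h, if_neg h, ih _ _ (tail_antitone hν) (tail_antitone hβ) (fun i => hνβ i.succ),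
        GC]
      have h0 : ν 0 ≤ β 0 := hνβ 0
      have hE : EE ν β = (EE (Fin.tail ν) (Fin.tail β)).map (Fin.succEmb _) := by
        ext i
        simp only [mem_EE, Finset.mem_map]
        induction i using Fin.cases with
        | zero =>
          have h1 : β (Fin.succ 0) ≤ β 0 := hβ (Fin.zero_le _)
          constructor
          · intro h2
            rw [Fin.castSucc_zero] at h2
            omega
          · rintro ⟨j, _, hj⟩
            exact absurd hj (Fin.succ_ne_zero j)
        | succ i =>
          constructor
          · intro h2
            exact ⟨i, h2, rfl⟩
          · rintro ⟨j, hj, hji⟩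
            have : j = i := Fin.succ_injective _ hji
            subst this
            exact hj
      have hq : qq ν β = qq (Fin.tail ν) (Fin.tail β) := by
        rw [qq, qq, Fin.sum_univ_succ, hE, Finset.sum_map]
        have : β 0 - ν 0 = 0 := by omega
        rw [this, zero_add]
        rfl
      rw [hq, hE, Finset.card_map, zero_add]

/-- Rotation by 180 degrees. -/
def rot {k : ℕ} (α : Fin k → ℤ) : Fin k → ℤ := fun i => - α i.rev

theorem rot_rot {k : ℕ} (α : Fin k → ℤ) : rot (rot α) = α := by
  funext i; simp [rot]

theorem rot_le {k : ℕ} {α β : Fin k → ℤ} (h : α ≤ β) : rot β ≤ rot α :=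
  fun i => neg_le_neg (h i.rev)

theorem rot_antitone {k : ℕ} {α : Fin k → ℤ} (h : Antitone α) : Antitone (rot α) :=
  fun _ _ hij => neg_le_neg (h (Fin.rev_le_rev.2 hij))

theorem Wp_rot {k : ℕ} (α β : Fin k → ℤ) : Wp (rot β) (rot α) = Wp α β := by
  rw [Wp, Wp, ← Equiv.prod_comp Fin.revPerm]
  refine Finset.prod_congr rfl fun i _ => ?_
  simp [ww, rot]

theorem dd_rot {k : ℕ} (α β : Fin k → ℤ) : dd (rot β) (rot α) = dd α β := by
  rw [dd, dd, Finset.card_filter, Finset.card_filter, ← Equiv.sum_comp Fin.revPerm]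
  refine Finset.sum_congr rfl fun i _ => ?_
  simp [rot]

theorem EE_rot {k : ℕ} (α β : Fin (k + 1) → ℤ) :
    EE (rot β) (rot α) = (EE α β).map Fin.revPerm.toEmbedding := by
  ext i
  simp only [EE, mem_filter, mem_univ, true_and, Finset.mem_map_equiv, rot, Fin.rev_succ,
    Fin.rev_castSucc, neg_lt_neg_iff, Fin.revPerm_symm, Fin.revPerm_apply]

theorem qq_rot {k : ℕ} (α β : Fin (k + 1) → ℤ) : qq (rot β) (rot α) = qq α β := by
  rw [qq, qq, EE_rot, Finset.sum_map, ← Equiv.sum_comp Fin.revPerm]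
  congr 2
  · refine Finset.sum_congr rfl fun i _ => ?_
    simp [rot]; ring
  · refine Finset.sum_congr rfl fun i _ => ?_
    simp [rot, Fin.rev_succ, Fin.rev_castSucc]; ring

theorem GC_rot {k : ℕ} (α β : Fin (k + 1) → ℤ) : GC (rot β) (rot α) = GC α β := by
  rw [GC, GC, qq_rot, dd_rot, EE_rot, Finset.card_map]

open Classical in
theorem sum_left {k : ℕ} (α β : Fin (k + 1) → ℤ) (hα : Antitone α) (hβ : Antitone β)
    (h : α ≤ β) :
    ∑ ν ∈ (box α β).filter Antitone, Wp α ν * GC ν β = derivative (Wp α β) := by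
  rw [← sumG (k + 1) α β hα h, Finset.sum_filter]
  refine Finset.sum_congr rfl fun ν hν => ?_
  rw [mem_box] at hν
  split_ifs with h1
  · rw [GG_closed k ν β h1 hβ hν.2]
  · have : GG (k + 1) ν β = 0 := by
      by_contra hcon
      exact h1 (GG_ne_zero _ _ _ hβ hν.2 hcon)
    rw [this, mul_zero]

open Classical in
theorem sum_right {k : ℕ} (α β : Fin (k + 1) → ℤ) (hα : Antitone α) (hβ : Antitone β)
    (h : α ≤ β) :
    ∑ ν ∈ (box α β).filter Antitone, GC α ν * Wp ν β = derivative (Wp α β) := by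
  rw [← Wp_rot α β, ← sum_left (rot β) (rot α) (rot_antitone hβ) (rot_antitone hα) (rot_le h)]
  refine Finset.sum_bij' (fun ν _ => rot ν) (fun ν _ => rot ν) ?_ ?_ ?_ ?_ ?_
  · intro ν hν
    rw [mem_filter, mem_box] at hν ⊢
    exact ⟨⟨rot_le hν.1.2, rot_le hν.1.1⟩, rot_antitone hν.2⟩
  · intro ν hν
    rw [mem_filter, mem_box] at hν ⊢
    refine ⟨⟨?_, ?_⟩, rot_antitone hν.2⟩
    · simpa [rot_rot] using rot_le hν.1.2
    · simpa [rot_rot] using rot_le hν.1.1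
  · intro ν _; exact rot_rot ν
  · intro ν _; exact rot_rot ν
  · intro ν _
    rw [Wp_rot, GC_rot, mul_comm]

end Closed

section Mat

variable {k : ℕ} (lo hi : Fin (k + 1) → ℤ)

abbrev YY : Type := {ν : Fin (k + 1) → ℤ // Antitone ν ∧ lo ≤ ν ∧ ν ≤ hi}

open Classical in
noncomputable instance : Fintype (YY lo hi) :=
  Fintype.subtype ((box lo hi).filter Antitone) (by
    intro ν; rw [mem_filter, mem_box]; tauto)

open Classical in
noncomputable def Wm : Matrix (YY lo hi) (YY lo hi) ℚ[X] :=
  fun α β => if α.1 ≤ β.1 then Wp α.1 β.1 else 0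

open Classical in
noncomputable def Gm : Matrix (YY lo hi) (YY lo hi) ℚ[X] :=
  fun α β => if α.1 ≤ β.1 then GC α.1 β.1 else 0

open Classical in
noncomputable def Zm : Matrix (YY lo hi) (YY lo hi) ℚ :=
  fun α β => if α.1 ≤ β.1 then 1 else 0

noncomputable def DD : Matrix (YY lo hi) (YY lo hi) ℚ[X] →+ Matrix (YY lo hi) (YY lo hi) ℚ[X] :=
  (derivative : ℚ[X] →ₗ[ℚ] ℚ[X]).toAddMonoidHom.mapMatrix

theorem DD_apply (M : Matrix (YY lo hi) (YY lo hi) ℚ[X]) (α β : YY lo hi) :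
    DD lo hi M α β = derivative (M α β) := rfl

theorem DD_mul (A B : Matrix (YY lo hi) (YY lo hi) ℚ[X]) :
    DD lo hi (A * B) = DD lo hi A * B + A * DD lo hi B := by
  ext1 α β
  simp only [DD_apply, Matrix.mul_apply, Matrix.add_apply, derivative_sum, derivative_mul,
    Finset.sum_add_distrib]

open Classical in
theorem sum_YY (α β : YY lo hi) (F : (Fin (k + 1) → ℤ) → ℚ[X]) :
    ∑ ν : YY lo hi, (if α.1 ≤ ν.1 ∧ ν.1 ≤ β.1 then F ν.1 else 0) =
      ∑ ν ∈ (box α.1 β.1).filter Antitone, F ν := by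
  rw [← Finset.sum_filter]
  refine Finset.sum_bij' (fun ν _ => ν.1) (fun ν hν => ⟨ν, ?_⟩) ?_ ?_ ?_ ?_ ?_
  · rw [mem_filter, mem_box] at hν
    exact ⟨hν.2, α.2.2.1.trans hν.1.1, hν.1.2.trans β.2.2.2⟩
  · intro ν hν
    rw [mem_filter] at hν
    rw [mem_filter, mem_box]
    exact ⟨hν.2, ν.2.1⟩
  · intro ν hν
    rw [mem_filter, mem_box] at hν
    rw [mem_filter]
    exact ⟨mem_univ _, hν.1⟩
  · intro ν _; rfl
  · intro ν _; rfl
  · intro ν _; rfl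

theorem Wm_Gm : Wm lo hi * Gm lo hi = DD lo hi (Wm lo hi) := by
  classical
  ext1 α β
  rw [Matrix.mul_apply, DD_apply]
  have h1 : ∀ ν : YY lo hi, Wm lo hi α ν * Gm lo hi ν β =
      if α.1 ≤ ν.1 ∧ ν.1 ≤ β.1 then Wp α.1 ν.1 * GC ν.1 β.1 else 0 := by
    intro ν
    simp only [Wm, Gm]
    by_cases h1 : α.1 ≤ ν.1 <;> by_cases h2 : ν.1 ≤ β.1 <;> simp [h1, h2]
  rw [Finset.sum_congr rfl fun ν _ => h1 ν, sum_YY lo hi α β fun ν => Wp α.1 ν * GC ν β.1]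
  by_cases h : α.1 ≤ β.1
  · rw [sum_left _ _ α.2.1 β.2.1 h, Wm, if_pos h]
  · rw [Wm, if_neg h, derivative_zero]
    refine Finset.sum_eq_zero fun ν hν => ?_
    rw [mem_filter, mem_box] at hν
    exact absurd (hν.1.1.trans hν.1.2) h

theorem Gm_Wm : Gm lo hi * Wm lo hi = DD lo hi (Wm lo hi) := by
  classical
  ext1 α β
  rw [Matrix.mul_apply, DD_apply]
  have h1 : ∀ ν : YY lo hi, Gm lo hi α ν * Wm lo hi ν β =
      if α.1 ≤ ν.1 ∧ ν.1 ≤ β.1 then GC α.1 ν.1 * Wp ν.1 β.1 else 0 := by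
    intro ν
    simp only [Wm, Gm]
    by_cases h1 : α.1 ≤ ν.1 <;> by_cases h2 : ν.1 ≤ β.1 <;> simp [h1, h2]
  rw [Finset.sum_congr rfl fun ν _ => h1 ν, sum_YY lo hi α β fun ν => GC α.1 ν * Wp ν β.1]
  by_cases h : α.1 ≤ β.1
  · rw [sum_right _ _ α.2.1 β.2.1 h, Wm, if_pos h]
  · rw [Wm, if_neg h, derivative_zero]
    refine Finset.sum_eq_zero fun ν hν => ?_
    rw [mem_filter, mem_box] at hν
    exact absurd (hν.1.1.trans hν.1.2) h

theorem Wp_self {k : ℕ} (α : Fin k → ℤ) : Wp α α = 1 := by simp [Wp, ww]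

open Classical in
theorem N_ne {α β : YY lo hi} (h : (Wm lo hi - 1) α β ≠ 0) :
    ∑ i, α.1 i + 1 ≤ ∑ i, β.1 i := by
  rw [Matrix.sub_apply, Wm] at h
  by_cases h1 : α.1 ≤ β.1
  · by_cases h2 : α = β
    · subst h2
      simp [Wp_self] at h
    · have h3 : α.1 < β.1 := lt_of_le_of_ne h1 fun h => h2 (Subtype.ext h)
      have : ∑ i, α.1 i < ∑ i, β.1 i := Fintype.sum_strictMono h3
      omega
  · have h2 : α ≠ β := by
      rintro rfl
      exact h1 le_rfl
    simp [h1, h2] at h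

open Classical in
theorem N_pow_ne (m : ℕ) : ∀ {α β : YY lo hi}, ((Wm lo hi - 1) ^ m) α β ≠ 0 →
    ∑ i, α.1 i + m ≤ ∑ i, β.1 i := by
  induction m with
  | zero =>
    intro α β h
    rw [pow_zero] at h
    have : α = β := by
      by_contra hcon
      exact h (Matrix.one_apply_ne hcon)
    subst this
    simp
  | succ m ih =>
    intro α β h
    rw [pow_succ, Matrix.mul_apply] at h
    obtain ⟨ν, _, hν⟩ := Finset.exists_ne_zero_of_sum_ne_zero h
    have h1 := ih (left_ne_zero_of_mul hν)
    have h2 := N_ne lo hi (right_ne_zero_of_mul hν)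
    push_cast
    omega

open Classical in
theorem N_nil : ∃ m, (Wm lo hi - 1) ^ m = 0 := by
  refine ⟨(∑ i, hi i - ∑ i, lo i + 1).toNat, ?_⟩
  ext1 α β
  by_contra hcon
  have h1 := N_pow_ne lo hi _ hcon
  have h2 : ∑ i, lo i ≤ ∑ i, α.1 i := Finset.sum_le_sum fun i _ => α.2.2.1 i
  have h3 : ∑ i, β.1 i ≤ ∑ i, hi i := Finset.sum_le_sum fun i _ => β.2.2.2 i
  omega

open Classical in
theorem Wm_eval_zero : (evalRingHom (0 : ℚ)).mapMatrix (Wm lo hi) = 1 := by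
  ext1 α β
  rw [RingHom.mapMatrix_apply, Matrix.map_apply, Wm]
  by_cases h2 : α = β
  · subst h2
    simp [Wp_self]
  · rw [Matrix.one_apply_ne h2]
    split_ifs with h
    · have h3 : α.1 < β.1 := lt_of_le_of_ne h fun h => h2 (Subtype.ext h)
      obtain ⟨_, i, hi⟩ := Pi.lt_def.1 h3
      rw [Wp, map_prod]
      refine Finset.prod_eq_zero (mem_univ i) ?_
      simp [ww, hi]
    · simp

open Classical in
theorem Wm_eval_one : (evalRingHom (1 : ℚ)).mapMatrix (Wm lo hi) = Zm lo hi := by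
  ext1 α β
  rw [RingHom.mapMatrix_apply, Matrix.map_apply, Wm, Zm]
  split_ifs with h
  · rw [Wp, map_prod]
    refine Finset.prod_eq_one fun i _ => ?_
    rw [ww]
    split_ifs <;> simp
  · simp

theorem GC_eval_nonneg {k : ℕ} (α β : Fin (k + 1) → ℤ) (x : ℝ) (h0 : 0 ≤ x) (h1 : x ≤ 1) :
    0 ≤ ((GC α β).map (algebraMap ℚ ℝ)).eval x := by
  rw [GC]
  split_ifs
  · simp only [Polynomial.map_mul, Polynomial.map_pow, map_X, Polynomial.map_sub,
      Polynomial.map_one, eval_mul, eval_pow, eval_X, eval_sub, eval_one]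
    have : 0 ≤ 1 - x := by linarith
    positivity
  · simp

theorem poly_nonneg (q : ℚ[X]) (h0 : q.eval 0 = 0)
    (h : ∀ x : ℝ, 0 ≤ x → x ≤ 1 → 0 ≤ ((derivative q).map (algebraMap ℚ ℝ)).eval x) :
    0 ≤ q.eval 1 := by
  set p : ℝ[X] := q.map (algebraMap ℚ ℝ) with hp
  have hm : MonotoneOn (fun x => p.eval x) (Set.Icc 0 1) := by
    apply monotoneOn_of_deriv_nonneg (convex_Icc 0 1) p.continuous.continuousOn
      p.differentiable.differentiableOn
    intro x hx
    rw [interior_Icc] at hx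
    rw [Polynomial.deriv, hp, derivative_map]
    exact h x hx.1.le hx.2.le
  have h2 := hm (Set.left_mem_Icc.2 zero_le_one) (Set.right_mem_Icc.2 zero_le_one) zero_le_one
  have e0 : p.eval 0 = 0 := by
    have := Polynomial.eval_map_apply (algebraMap ℚ ℝ) (p := q) 0
    rw [map_zero] at this
    rw [hp, this, h0, map_zero]
  have e1 : p.eval 1 = ((q.eval 1 : ℚ) : ℝ) := by
    have := Polynomial.eval_map_apply (algebraMap ℚ ℝ) (p := q) 1
    rw [map_one] at this
    rw [hp, this]
    rfl
  simp only [e0, e1] at h2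
  exact_mod_cast h2

open Classical in
theorem exp_pow_nat {R : Type*} [Ring R] [Algebra ℚ R] {a : R} (ha : IsNilpotent a) (n : ℕ) :
    IsNilpotent.exp a ^ n = IsNilpotent.exp ((n : ℚ) • a) := by
  induction n with
  | zero => simp
  | succ n ih =>
    rw [pow_succ, ih, ← IsNilpotent.exp_add_of_commute ((Commute.refl a).smul_left _)
      (ha.smul _) ha]
    congr 1
    push_cast
    rw [add_smul, one_smul]

open Classical in
theorem zeta_pow_pos : ∃ Φ : YY lo hi → YY lo hi → ℚ[X], (∀ α β i, 0 ≤ (Φ α β).coeff i) ∧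
    ∀ (n : ℕ) α β, (Zm lo hi ^ n) α β = (Φ α β).eval (n : ℚ) := by
  obtain ⟨m, hm⟩ := N_nil lo hi
  have hW : 1 + (Wm lo hi - 1) = Wm lo hi := by abel
  have hDN : DD lo hi (Wm lo hi - 1) = DD lo hi (Wm lo hi) := by
    rw [map_sub, D_one _ (DD_mul lo hi), sub_zero]
  obtain ⟨L, V, S, hL, hLn, hDL, hV1, hV2, hD⟩ := log_exists (DD lo hi) (DD_mul lo hi) hm
    (G := Gm lo hi) (by rw [hW, hDN, Wm_Gm]) (by rw [hW, hDN, Gm_Wm])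
  rw [hW] at hV1 hV2
  set φ0 := (evalRingHom (0 : ℚ)).mapMatrix (m := YY lo hi) with hφ0
  set φ1 := (evalRingHom (1 : ℚ)).mapMatrix (m := YY lo hi) with hφ1
  have hL0 : φ0 L = 0 := by
    rw [hL, map_mul, map_sub, map_one, hφ0, Wm_eval_zero, sub_self, zero_mul]
  have hV0 : φ0 V = 1 := by
    have := congrArg φ0 hV1
    rwa [map_mul, map_one, hφ0, Wm_eval_zero, mul_one] at this
  have hM0 : φ0 (V * IsNilpotent.exp L) = 1 := by
    rw [map_mul, hV0, IsNilpotent.map_exp hLn, hL0, IsNilpotent.exp_zero, one_mul]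
  have hM : V * IsNilpotent.exp L = 1 := by
    ext1 α β
    have h1 : derivative ((V * IsNilpotent.exp L) α β) = 0 := by
      rw [← DD_apply, hD]; rfl
    have h2 := eq_C_of_natDegree_eq_zero (Polynomial.derivative_eq_zero.1 h1)
    have h3 : ((V * IsNilpotent.exp L) α β).eval 0 = (1 : Matrix (YY lo hi) (YY lo hi) ℚ) α β := by
      rw [← hM0]; rfl
    rw [← coeff_zero_eq_eval_zero] at h3
    rw [h2, h3, Matrix.one_apply, Matrix.one_apply]
    split_ifs <;> simp
  have hE : IsNilpotent.exp L = Wm lo hi := by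
    calc IsNilpotent.exp L = Wm lo hi * (V * IsNilpotent.exp L) := by
          rw [← mul_assoc, hV2, one_mul]
      _ = _ := by rw [hM, mul_one]
  have hZ : Zm lo hi = IsNilpotent.exp (φ1 L) := by
    rw [← IsNilpotent.map_exp hLn, hE, hφ1, Wm_eval_one]
  have hpos : ∀ α β, 0 ≤ (φ1 L) α β := by
    intro α β
    change 0 ≤ (L α β).eval 1
    apply poly_nonneg
    · have := congrFun (congrFun hL0 α) β
      exact this
    · intro x h0 h1
      have : derivative (L α β) = Gm lo hi α β := by rw [← DD_apply, hDL]
      rw [this, Gm]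
      split_ifs
      · exact GC_eval_nonneg _ _ x h0 h1
      · simp
  have hpos2 : ∀ (j : ℕ) α β, 0 ≤ ((φ1 L) ^ j) α β := by
    intro j
    induction j with
    | zero =>
      intro α β
      rw [pow_zero, Matrix.one_apply]
      split_ifs <;> norm_num
    | succ j ih =>
      intro α β
      rw [pow_succ, Matrix.mul_apply]
      exact Finset.sum_nonneg fun ν _ => mul_nonneg (ih _ _) (hpos _ _)
  have hnil : IsNilpotent (φ1 L) := hLn.map φ1
  obtain ⟨M, hMn⟩ := hnil
  refine ⟨fun α β => ∑ j ∈ range M, C ((j.factorial : ℚ)⁻¹ * ((φ1 L) ^ j) α β) * X ^ j, ?_, ?_⟩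
  · intro α β i
    rw [finsetSum_coeff]
    refine Finset.sum_nonneg fun j _ => ?_
    rw [coeff_C_mul_X_pow]
    split_ifs
    · exact mul_nonneg (by positivity) (hpos2 _ _ _)
    · exact le_rfl
  · intro n α β
    have h1 : ((n : ℚ) • φ1 L) ^ M = 0 := by rw [_root_.smul_pow, hMn, smul_zero]
    rw [hZ, exp_pow_nat ⟨M, hMn⟩, IsNilpotent.exp_eq_sum h1, eval_finsetSum, Matrix.sum_apply]
    refine Finset.sum_congr rfl fun j _ => ?_
    rw [_root_.smul_pow]
    simp only [Matrix.smul_apply, smul_eq_mul, eval_mul, eval_C, eval_pow, eval_X]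
    ring

end Mat

section Transfer

variable {P : Type} [PartialOrder P] [Finite P]

noncomputable instance : Fintype (LowerSet P) :=
  @Fintype.ofFinite _ (Finite.of_injective (fun I : LowerSet P => (I : Set P)) SetLike.coe_injective)

open Classical in
noncomputable def Zl (P : Type) [PartialOrder P] : Matrix (LowerSet P) (LowerSet P) ℚ :=
  fun I J => if I ≤ J then 1 else 0

def condM {P : Type} [PartialOrder P] (A : Set P) (val : P → ℤ) (v : ℤ) (I J : LowerSet P) : Prop :=
  I ≤ J ∧ ∀ a ∈ A, val a = v → a ∈ J ∧ a ∉ I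

open Classical in
noncomputable def Mv {P : Type} [PartialOrder P] (A : Set P) (val : P → ℤ) (v : ℤ) :
    Matrix (LowerSet P) (LowerSet P) ℚ :=
  fun I J => if condM A val v I J then 1 else 0

/-- Partially built marked maps: cells outside `J` carry the dummy value `s + t + 1`. -/
def isF {P : Type} [PartialOrder P] (A : Set P) (val : P → ℤ) (s : ℤ) (t : ℕ) (J : LowerSet P)
    (f : P → ℤ) : Prop :=
  Monotone f ∧ (∀ x, s < f x) ∧ (∀ x, x ∈ J ↔ f x ≤ s + t) ∧ (∀ x, f x ≤ s + t + 1) ∧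
    (∀ a ∈ A, val a ≤ s + t → f a = val a)

theorem isF_finite (A : Set P) (val : P → ℤ) (s : ℤ) (t : ℕ) (J : LowerSet P) :
    Finite {f : P → ℤ // isF A val s t J f} := by
  have h : (Set.pi Set.univ fun _ : P => Set.Icc s (s + t + 1)).Finite :=
    Set.Finite.pi fun _ => Set.finite_Icc _ _
  refine Set.Finite.subset (s := Set.pi Set.univ fun _ : P => Set.Icc s (s + t + 1)) h ?_
  intro f hf
  rw [Set.mem_univ_pi]
  exact fun x => ⟨(hf.2.1 x).le, hf.2.2.2.1 x⟩

noncomputable def NF {P : Type} [PartialOrder P] (A : Set P) (val : P → ℤ) (s : ℤ) (t : ℕ)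
    (J : LowerSet P) : ℕ := Nat.card {f : P → ℤ // isF A val s t J f}

open Classical in
noncomputable def stepEquiv (A : Set P) (val : P → ℤ) (s : ℤ) (t : ℕ) (J : LowerSet P) :
    {f : P → ℤ // isF A val s (t + 1) J f} ≃
      Σ I : LowerSet P, {g : P → ℤ // condM A val (s + t + 1) I J ∧ isF A val s t I g} where
  toFun f := ⟨⟨{x | f.1 x ≤ s + t}, fun _ _ hxy hx => (f.2.1 hxy).trans hx⟩,
    fun x => min (f.1 x) (s + t + 1), by
      obtain ⟨f, h1, h2, h3, h4, h5⟩ := f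
      push_cast at h3 h4 h5
      refine ⟨⟨?_, ?_⟩, ?_, ?_, ?_, ?_, ?_⟩
      · intro x (hx : f x ≤ s + t)
        exact (h3 x).2 (by omega)
      · intro a ha hv
        have := h5 a ha (by omega)
        refine ⟨(h3 a).2 (by omega), fun (hx : f a ≤ s + t) => by omega⟩
      · intro x y hxy
        exact min_le_min_right _ (h1 hxy)
      · intro x
        have := h2 x
        simp only [lt_min_iff]
        omega
      · intro x
        change f x ≤ s + t ↔ _
        simp only [min_le_iff]
        omega
      · intro x
        exact min_le_right _ _
      · intro a ha hv
        have := h5 a ha (by omega)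
        simp only [this]
        exact min_eq_left (by omega)⟩
  invFun p := ⟨fun x => if x ∈ J then p.2.1 x else s + t + 2, by
      obtain ⟨I, g, ⟨hIJ, hc⟩, h1, h2, h3, h4, h5⟩ := p
      refine ⟨?_, ?_, ?_, ?_, ?_⟩
      · intro x y hxy
        by_cases hy : y ∈ J
        · have hx : x ∈ J := J.lower hxy hy
          simpa [hx, hy] using h1 hxy
        · have := h4 x
          by_cases hx : x ∈ J
          · simp only [hx, hy, if_true, if_false]; omega
          · simp only [hx, hy, if_false]; omega
      · intro x
        have := h2 x
        by_cases hx : x ∈ J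
        · simpa only [hx, if_true] using this
        · simp only [hx, if_false]; omega
      · intro x
        have := h4 x
        push_cast
        by_cases hx : x ∈ J
        · simp only [hx, if_true, true_iff]; omega
        · simp only [hx, if_false, false_iff]; omega
      · intro x
        have := h4 x
        push_cast
        by_cases hx : x ∈ J
        · simp only [hx, if_true]; omega
        · simp only [hx, if_false]; omega
      · intro a ha hv
        push_cast at hv
        by_cases hv2 : val a ≤ s + t
        · have h6 := h5 a ha hv2
          have h7 : a ∈ J := hIJ ((h3 a).2 (by omega))
          simp only [h7, if_true, h6]
        · obtain ⟨h6, h7⟩ := hc a ha (by omega)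
          rw [h3 a] at h7
          have h8 := h4 a
          simp only [h6, if_true]
          omega⟩
  left_inv f := by
    obtain ⟨f, h1, h2, h3, h4, h5⟩ := f
    apply Subtype.ext
    funext x
    have h3' := h3 x
    have h4' := h4 x
    push_cast at h3' h4'
    by_cases hx : x ∈ J
    · simp only [hx, if_true]
      exact min_eq_left (by have := h3'.1 hx; omega)
    · simp only [hx, if_false]
      have : ¬ f x ≤ s + (t + 1) := fun h => hx (h3'.2 h)
      omega
  right_inv p := by
    obtain ⟨I, g, ⟨hIJ, hc⟩, h1, h2, h3, h4, h5⟩ := p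
    apply Sigma.subtype_ext
    · ext x
      change (if x ∈ J then g x else s + t + 2) ≤ s + t ↔ x ∈ I
      by_cases hx : x ∈ J
      · simp only [hx, if_true]; exact (h3 x).symm
      · have : x ∉ I := fun h => hx (hIJ h)
        simp only [hx, if_false, this, iff_false]; omega
    · funext x
      change min (if x ∈ J then g x else s + t + 2) (s + t + 1) = g x
      have h4' := h4 x
      by_cases hx : x ∈ J
      · simp only [hx, if_true]; exact min_eq_left h4'
      · have : x ∉ I := fun h => hx (hIJ h)
        rw [h3 x] at this
        simp only [hx, if_false]
        rw [min_eq_right (by omega)]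
        omega

theorem NF_succ (A : Set P) (val : P → ℤ) (s : ℤ) (t : ℕ) (J : LowerSet P) :
    (NF A val s (t + 1) J : ℚ) = ∑ I, (NF A val s t I : ℚ) * Mv A val (s + t + 1) I J := by
  classical
  have hfin : ∀ I : LowerSet P,
      Finite {g : P → ℤ // condM A val (s + t + 1) I J ∧ isF A val s t I g} := fun I =>
    Set.Finite.subset (s := {g | isF A val s t I g}) (isF_finite A val s t I) fun g hg => hg.2
  rw [NF, Nat.card_congr (stepEquiv A val s t J), Nat.card_sigma]
  push_cast
  refine Finset.sum_congr rfl fun I _ => ?_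
  rw [Mv]
  split_ifs with h
  · simp only [h, true_and, mul_one, NF]
  · simp [h]

open Classical in
theorem NF_zero (A : Set P) (val : P → ℤ) (s : ℤ) (hs : ∀ a ∈ A, s < val a) (J : LowerSet P) :
    (NF A val s 0 J : ℚ) = (if ⊥ = J then 1 else 0 : ℚ) := by
  have key : ∀ f, isF A val s 0 J f ↔ (⊥ = J ∧ f = fun _ => s + 1) := by
    intro f
    constructor
    · rintro ⟨h1, h2, h3, h4, h5⟩
      push_cast at h3 h4
      refine ⟨?_, ?_⟩
      · ext x
        have := h2 x
        have h3' := h3 x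
        constructor
        · intro hx; exact absurd hx (by simp)
        · intro hx
          have := h3'.1 hx
          omega
      · funext x
        have := h2 x
        have := h4 x
        omega
    · rintro ⟨rfl, rfl⟩
      refine ⟨fun _ _ _ => le_rfl, fun _ => lt_add_one s, fun x => ?_, fun _ => by simp, ?_⟩
      · simp
      · intro a ha h
        have := hs a ha
        push_cast at h
        omega
  rw [NF]
  simp only [key]
  split_ifs with h
  · simp [h]
  · simp [h]

open Classical in
noncomputable def PM (A : Set P) (val : P → ℤ) (s : ℤ) : ℕ → Matrix (LowerSet P) (LowerSet P) ℚ
  | 0 => 1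
  | t + 1 => PM A val s t * Mv A val (s + t + 1)

open Classical in
theorem NF_eq (A : Set P) (val : P → ℤ) (s : ℤ) (hs : ∀ a ∈ A, s < val a) (t : ℕ) :
    ∀ J : LowerSet P, (NF A val s t J : ℚ) = PM A val s t ⊥ J := by
  induction t with
  | zero =>
    intro J
    rw [NF_zero A val s hs, PM, Matrix.one_apply]
  | succ t ih =>
    intro J
    rw [NF_succ, PM, Matrix.mul_apply]
    exact Finset.sum_congr rfl fun I _ => by rw [ih]

/-- Remove from `J` everything above a mark of value `w`. -/
def cut {P : Type} [PartialOrder P] (A : Set P) (lam : P → ℤ) (w : ℤ) (J : LowerSet P) :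
    LowerSet P :=
  ⟨{x | x ∈ J ∧ ∀ a ∈ A, lam a = w → ¬ a ≤ x}, fun _ _ hxy hx =>
    ⟨J.lower hxy hx.1, fun a ha hw h => hx.2 a ha hw (h.trans hxy)⟩⟩

open Classical in
noncomputable def Kw {P : Type} [PartialOrder P] (A : Set P) (lam : P → ℤ) (w : ℤ) :
    Matrix (LowerSet P) (LowerSet P) ℚ :=
  fun I J => if (∀ a ∈ A, lam a = w → a ∈ J) ∧ I = cut A lam w J then 1 else 0

theorem Z_mul_K (A : Set P) (lam : P → ℤ) (w : ℤ) : Zl P * Kw A lam w = Mv A lam w := by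
  classical
  ext1 I J
  rw [Matrix.mul_apply]
  simp only [Zl, Kw, Mv]
  have hle : I ≤ cut A lam w J ↔ I ≤ J ∧ ∀ a ∈ A, lam a = w → a ∉ I := by
    constructor
    · intro h
      exact ⟨fun x hx => (h hx).1, fun a ha hw haI => (h haI).2 a ha hw le_rfl⟩
    · rintro ⟨h1, h2⟩ x hx
      exact ⟨h1 hx, fun a ha hw hax => h2 a ha hw (I.lower hax hx)⟩
  rw [Finset.sum_eq_single (cut A lam w J)]
  · rw [ite_mul, one_mul, zero_mul, ← ite_and]
    refine if_congr ?_ rfl rfl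
    rw [hle, condM]
    constructor
    · rintro ⟨⟨h1, h2⟩, h3, _⟩
      exact ⟨h1, fun a ha hw => ⟨h3 a ha hw, h2 a ha hw⟩⟩
    · rintro ⟨h1, h2⟩
      exact ⟨⟨h1, fun a ha hw => (h2 a ha hw).2⟩, fun a ha hw => (h2 a ha hw).1, rfl⟩
  · intro I' _ h
    simp [h]
  · intro h
    exact absurd (mem_univ _) h

open Classical in
theorem PM_block (A : Set P) (lam : P → ℤ) (lo : ℤ) (n : ℕ) (hn : 1 ≤ n)
    (T : ℕ) :
    PM A (fun x => (n : ℤ) * lam x) (n * lo) (n * (T + 1)) =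
      PM A (fun x => (n : ℤ) * lam x) (n * lo) (n * T) * (Zl P ^ n * Kw A lam (lo + T + 1)) := by
  have h1 : ∀ j : ℕ, j < n → PM A (fun x => (n : ℤ) * lam x) (n * lo) (n * T + j) =
      PM A (fun x => (n : ℤ) * lam x) (n * lo) (n * T) * Zl P ^ j := by
    intro j
    induction j with
    | zero => intro _; simp
    | succ j ih =>
      intro hj
      rw [← add_assoc, PM, ih (by omega), mul_assoc, pow_succ]
      congr 2
      ext1 I J
      simp only [Mv, Zl]
      refine if_congr ?_ rfl rfl
      rw [condM]
      refine ⟨fun h => h.1, fun h => ⟨h, fun a _ ha => ?_⟩⟩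
      exfalso
      push_cast at ha
      have h2 : (n : ℤ) * (lam a - lo - T) = j + 1 := by linarith
      have h3 : (n : ℤ) ∣ (j : ℤ) + 1 := ⟨_, h2.symm⟩
      have h4 := Int.le_of_dvd (by omega) h3
      omega
  obtain ⟨m, rfl⟩ : ∃ m, n = m + 1 := ⟨n - 1, by omega⟩
  have h2 : (m + 1) * (T + 1) = ((m + 1) * T + m) + 1 := by ring
  rw [h2, PM, h1 m (by omega), mul_assoc, pow_succ, mul_assoc (Zl P ^ m), Z_mul_K]
  congr 2
  ext1 I J
  simp only [Mv]
  refine if_congr ?_ rfl rfl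
  simp only [condM]
  refine and_congr_right fun _ => forall_congr' fun a => imp_congr_right fun _ => ?_
  have : (((m + 1 : ℕ) : ℤ) * lam a = ((m + 1 : ℕ) : ℤ) * lo + (((m + 1) * T + m : ℕ) : ℤ) + 1) ↔
      lam a = lo + T + 1 := by
    push_cast
    constructor
    · intro h
      have h3 : ((m : ℤ) + 1) * (lam a) = ((m : ℤ) + 1) * (lo + T + 1) := by linarith
      exact mul_left_cancel₀ (by omega) h3
    · intro h
      rw [h]; ring
  rw [this]

open Classical in
theorem marked_pos (A : Set P)
    (hminmax : ∀ x : P, IsMin x ∨ IsMax x → x ∈ A) (lam : P → ℤ)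
    (hZ : ∃ Φ : LowerSet P → LowerSet P → ℚ[X], (∀ I J i, 0 ≤ (Φ I J).coeff i) ∧
      ∀ (n : ℕ) I J, (Zl P ^ n) I J = (Φ I J).eval (n : ℚ)) :
    ∃ p : ℚ[X], (∀ i : ℕ, 0 ≤ p.coeff i) ∧
      ∀ n : ℕ, 1 ≤ n → p.eval (n : ℚ) =
        Nat.card {f : P → ℤ // Monotone f ∧ ∀ a ∈ A, f a = (n : ℤ) * lam a} := by
  obtain ⟨Φ, hΦ, hΦZ⟩ := hZ
  obtain ⟨B, hB⟩ : ∃ B : ℕ, ∀ x, |lam x| ≤ B := by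
    have := Fintype.ofFinite P
    refine ⟨∑ x, (lam x).natAbs, fun x => ?_⟩
    rw [Int.abs_eq_natAbs]
    exact_mod_cast Finset.single_le_sum (f := fun x => (lam x).natAbs) (fun _ _ => Nat.zero_le _)
      (mem_univ x)
  set lo : ℤ := -B - 1 with hlo
  have hblock : ∀ T : ℕ, ∃ Q : LowerSet P → LowerSet P → ℚ[X], (∀ I J i, 0 ≤ (Q I J).coeff i) ∧
      ∀ n : ℕ, 1 ≤ n → ∀ I J, PM A (fun x => (n : ℤ) * lam x) (n * lo) (n * T) I J =
        (Q I J).eval (n : ℚ) := by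
    intro T
    induction T with
    | zero =>
      refine ⟨fun I J => if I = J then 1 else 0, ?_, ?_⟩
      · intro I J i
        dsimp only
        split_ifs
        · rw [coeff_one]; split_ifs <;> norm_num
        · simp
      · intro n _ I J
        rw [mul_zero, PM, Matrix.one_apply]
        by_cases h : I = J <;> simp [h]
    | succ T ih =>
      obtain ⟨Q, hQ, hQe⟩ := ih
      refine ⟨fun I J => ∑ I', Q I I' * ∑ I'', Φ I' I'' * C (Kw A lam (lo + T + 1) I'' J), ?_, ?_⟩
      · intro I J i
        rw [finsetSum_coeff]
        refine Finset.sum_nonneg fun I' _ => ?_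
        rw [coeff_mul]
        refine Finset.sum_nonneg fun x _ => mul_nonneg (hQ _ _ _) ?_
        rw [finsetSum_coeff]
        refine Finset.sum_nonneg fun I'' _ => ?_
        rw [coeff_mul_C]
        refine mul_nonneg (hΦ _ _ _) ?_
        rw [Kw]
        split_ifs <;> norm_num
      · intro n hn I J
        rw [PM_block A lam lo n hn T, Matrix.mul_apply, eval_finsetSum]
        refine Finset.sum_congr rfl fun I' _ => ?_
        rw [eval_mul, hQe n hn, Matrix.mul_apply, eval_finsetSum]
        congr 1
        refine Finset.sum_congr rfl fun I'' _ => ?_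
        rw [eval_mul, eval_C, hΦZ]
  obtain ⟨Q, hQ, hQe⟩ := hblock (2 * B + 1)
  refine ⟨Q ⊥ ⊤, hQ ⊥ ⊤, fun n hn => ?_⟩
  have hn' : (1 : ℤ) ≤ n := by exact_mod_cast hn
  have hlow : ∀ x, (n : ℤ) * lo < n * lam x := by
    intro x
    have := (abs_le.1 (hB x)).1
    exact mul_lt_mul_of_pos_left (by omega) (by omega)
  have hhigh : ∀ x, (n : ℤ) * lam x ≤ n * lo + ((n * (2 * B + 1) : ℕ) : ℤ) := by
    intro x
    have h1 := (abs_le.1 (hB x)).2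
    have h2 : (n : ℤ) * lam x ≤ n * B := mul_le_mul_of_nonneg_left h1 (by omega)
    have h3 : (n : ℤ) * lo + ((n * (2 * B + 1) : ℕ) : ℤ) = n * B := by
      rw [hlo]; push_cast; ring
    omega
  rw [← hQe n hn, ← NF_eq A _ _ (fun a _ => hlow a), NF]
  norm_cast
  apply Nat.card_congr
  apply Equiv.subtypeEquivRight
  intro f
  constructor
  · rintro ⟨h1, h2, h3, h4, h5⟩
    exact ⟨h1, fun a ha => h5 a ha (hhigh a)⟩
  · rintro ⟨h1, h2⟩
    have h3 : ∀ x, (n : ℤ) * lo < f x := by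
      intro x
      obtain ⟨m, hmx, hm⟩ := (Set.toFinite (Set.univ : Set P)).exists_le_minimal (Set.mem_univ x)
      have hmin : IsMin m := fun y hy => hm.2 (Set.mem_univ y) hy
      have := h2 m (hminmax m (Or.inl hmin))
      have h4 := h1 hmx
      have h5 := hlow m
      omega
    have h4 : ∀ x, f x ≤ (n : ℤ) * lo + ((n * (2 * B + 1) : ℕ) : ℤ) := by
      intro x
      obtain ⟨m, hmx, hm⟩ := (Set.toFinite (Set.univ : Set P)).exists_le_maximal (Set.mem_univ x)
      have hmax : IsMax m := fun y hy => hm.2 (Set.mem_univ y) hy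
      have := h2 m (hminmax m (Or.inr hmax))
      have h4 := h1 hmx
      have h5 := hhigh m
      omega
    refine ⟨h1, h3, fun x => ?_, fun x => ?_, fun a ha _ => h2 a ha⟩
    · simp only [LowerSet.mem_top, true_iff]; exact h4 x
    · have := h4 x; omega

end Transfer

section Skew

variable {m : ℕ} (lam mu : Fin (m + 1) → ℕ)

theorem skew_finite (k : ℕ) (lam mu : Fin k → ℕ) : Finite (SkewPoset k lam mu) := by
  have : Finite (Σ i : Fin k, Fin (lam i + 1)) := inferInstance
  refine Finite.of_injective (fun p : SkewPoset k lam mu =>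
    (⟨(OrderDual.ofDual p.1).1, ⟨(OrderDual.ofDual p.1).2, Nat.lt_succ_of_le p.2.2⟩⟩ :
      Σ i : Fin k, Fin (lam i + 1))) ?_
  intro p q h
  apply Subtype.ext
  have h1 : (OrderDual.ofDual p.1).1 = (OrderDual.ofDual q.1).1 := congrArg Sigma.fst h
  have h2 : (OrderDual.ofDual p.1).2 = (OrderDual.ofDual q.1).2 :=
    congrArg (fun s : (Σ i : Fin k, Fin (lam i + 1)) => (s.2 : ℕ)) h
  exact Prod.ext h1 h2

/-- The lower set of all cells to the right of the boundary `ν`. -/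
def toLow (ν : YY (fun i => (mu i : ℤ)) (fun i => (lam i : ℤ))) :
    LowerSet (SkewPoset (m + 1) lam mu) :=
  ⟨{p | ν.1 (OrderDual.ofDual p.1).1 < ((OrderDual.ofDual p.1).2 : ℤ)}, by
    intro p q hqp hp
    have h1 : (OrderDual.ofDual p.1).1 ≤ (OrderDual.ofDual q.1).1 := hqp.1
    have h2 : (OrderDual.ofDual p.1).2 ≤ (OrderDual.ofDual q.1).2 := hqp.2
    have h3 := ν.2.1 h1
    have h4 : ν.1 (OrderDual.ofDual p.1).1 < ((OrderDual.ofDual p.1).2 : ℤ) := hp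
    change ν.1 (OrderDual.ofDual q.1).1 < ((OrderDual.ofDual q.1).2 : ℤ)
    omega⟩

theorem toLow_le (ν ν' : YY (fun i => (mu i : ℤ)) (fun i => (lam i : ℤ))) :
    toLow lam mu ν ≤ toLow lam mu ν' ↔ ν'.1 ≤ ν.1 := by
  constructor
  · intro h i
    by_contra hlt'
    have hlt : ν.1 i < ν'.1 i := not_le.1 hlt'
    have hm : (mu i : ℤ) ≤ ν.1 i := ν.2.2.1 i
    have hl : ν'.1 i ≤ (lam i : ℤ) := ν'.2.2.2 i
    let p : SkewPoset (m + 1) lam mu := ⟨OrderDual.toDual (i, (ν'.1 i).toNat), by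
      change mu i < (ν'.1 i).toNat ∧ (ν'.1 i).toNat ≤ lam i
      omega⟩
    have h1 : p ∈ toLow lam mu ν := by
      change ν.1 i < ((ν'.1 i).toNat : ℤ)
      omega
    have h2 : ν'.1 i < ((ν'.1 i).toNat : ℤ) := h h1
    omega
  · intro h p hp
    have h1 : ν'.1 (OrderDual.ofDual p.1).1 ≤ ν.1 (OrderDual.ofDual p.1).1 := h _
    have h4 : ν.1 (OrderDual.ofDual p.1).1 < ((OrderDual.ofDual p.1).2 : ℤ) := hp
    change ν'.1 (OrderDual.ofDual p.1).1 < ((OrderDual.ofDual p.1).2 : ℤ)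
    omega

theorem toLow_inj : Function.Injective (toLow lam mu) := by
  intro ν ν' h
  exact Subtype.ext (le_antisymm ((toLow_le lam mu ν' ν).1 h.ge) ((toLow_le lam mu ν ν').1 h.le))

theorem toLow_surj (hlam : Antitone lam) (hmu : Antitone mu) (hml : ∀ i, mu i ≤ lam i) :
    Function.Surjective (toLow lam mu) := by
  classical
  intro I
  let Q : Fin (m + 1) → ℕ → Prop := fun i j => j ≤ mu i ∨
    ∃ h : mu i < j ∧ j ≤ lam i, (⟨OrderDual.toDual (i, j), h⟩ : SkewPoset (m + 1) lam mu) ∉ I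
  let g : Fin (m + 1) → ℕ := fun i => Nat.findGreatest (Q i) (lam i)
  have hg : ∀ i, Q i (g i) := fun i =>
    Nat.findGreatest_spec (P := Q i) (hml i) (Or.inl le_rfl)
  have hge : ∀ i j, j ≤ lam i → Q i j → j ≤ g i := fun i j h1 h2 => Nat.le_findGreatest h1 h2
  have hgl : ∀ i, g i ≤ lam i := fun i => Nat.findGreatest_le _
  have hgm : ∀ i, mu i ≤ g i := fun i => hge i _ (hml i) (Or.inl le_rfl)
  have hanti : Antitone g := by
    intro i i' hii
    by_cases h0 : g i' ≤ mu i
    · exact h0.trans (hgm i)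
    have hl : g i' ≤ lam i := (hgl i').trans (hlam hii)
    have hmi : mu i < g i' := by omega
    refine hge i _ hl (Or.inr ⟨⟨hmi, hl⟩, ?_⟩)
    rcases hg i' with h | ⟨h, hI⟩
    · have := hmu hii; omega
    · intro hmem
      exact hI (I.lower (a := (⟨OrderDual.toDual (i, g i'), ⟨hmi, hl⟩⟩ :
        SkewPoset (m + 1) lam mu)) (show _ ∧ _ from ⟨hii, le_rfl⟩) hmem)
  refine ⟨⟨fun i => (g i : ℤ), fun i i' h => Int.ofNat_le.2 (hanti h),
    fun i => Int.ofNat_le.2 (hgm i), fun i => Int.ofNat_le.2 (hgl i)⟩, ?_⟩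
  ext p
  obtain ⟨⟨i, j⟩, hj⟩ := p
  change mu i < j ∧ j ≤ lam i at hj
  change ((g i : ℤ) < (j : ℤ)) ↔ (⟨OrderDual.toDual (i, j), hj⟩ : SkewPoset (m + 1) lam mu) ∈ I
  constructor
  · intro h
    by_contra hI
    have := hge i j hj.2 (Or.inr ⟨hj, hI⟩)
    omega
  · intro h
    by_contra hlt
    have hle : j ≤ g i := by omega
    rcases hg i with h1 | ⟨h1, hI⟩
    · omega
    · exact hI (I.lower (a := (⟨OrderDual.toDual (i, j), hj⟩ :
        SkewPoset (m + 1) lam mu)) (show _ ∧ _ from ⟨le_rfl, hle⟩) h)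

open Classical in
theorem Zl_pow_pos [Finite (SkewPoset (m + 1) lam mu)]
    (hlam : Antitone lam) (hmu : Antitone mu) (hml : ∀ i, mu i ≤ lam i) :
    ∃ Φ : LowerSet (SkewPoset (m + 1) lam mu) → LowerSet (SkewPoset (m + 1) lam mu) → ℚ[X],
      (∀ I J i, 0 ≤ (Φ I J).coeff i) ∧
      ∀ (n : ℕ) I J, (Zl (SkewPoset (m + 1) lam mu) ^ n) I J = (Φ I J).eval (n : ℚ) := by
  obtain ⟨Φ, hΦ, hΦZ⟩ := zeta_pow_pos (fun i => (mu i : ℤ)) (fun i => (lam i : ℤ))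
  let e : YY (fun i => (mu i : ℤ)) (fun i => (lam i : ℤ)) ≃
      LowerSet (SkewPoset (m + 1) lam mu) :=
    Equiv.ofBijective (toLow lam mu) ⟨toLow_inj lam mu, toLow_surj lam mu hlam hmu hml⟩
  have key : ∀ (n : ℕ) α β, (Zl (SkewPoset (m + 1) lam mu) ^ n) (e α) (e β) =
      (Zm (fun i => (mu i : ℤ)) (fun i => (lam i : ℤ)) ^ n) β α := by
    intro n
    induction n with
    | zero =>
      intro α β
      rw [pow_zero, pow_zero, Matrix.one_apply, Matrix.one_apply]
      exact if_congr (e.apply_eq_iff_eq.trans eq_comm) rfl rfl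
    | succ n ih =>
      intro α β
      rw [pow_succ, pow_succ', Matrix.mul_apply, Matrix.mul_apply, ← e.sum_comp]
      refine Finset.sum_congr rfl fun ν _ => ?_
      rw [ih, mul_comm]
      congr 1
      simp only [Zl, Zm]
      exact if_congr (toLow_le lam mu ν β) rfl rfl
  refine ⟨fun I J => Φ (e.symm J) (e.symm I), fun _ _ _ => hΦ _ _ _, fun n I J => ?_⟩
  rw [← hΦZ, ← key, e.apply_symm_apply, e.apply_symm_apply]

end Skew

end SkewEhrhart

/-- **Theorem.** Marked order polytopes of skew shapes are Ehrhart positive. -/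
theorem skew_marked_order_ehrhart_positivity
    (k : ℕ) (lam mu : Fin k → ℕ) (hlam : Antitone lam) (hmu : Antitone mu)
    (hmulam : ∀ i, mu i ≤ lam i)
    (A : Set (SkewPoset k lam mu))
    (hminmax : ∀ x : SkewPoset k lam mu, IsMin x ∨ IsMax x → x ∈ A)
    (lam' : SkewPoset k lam mu → ℤ)
    (hord : ∀ x ∈ A, ∀ y ∈ A, x ≤ y → lam' x ≤ lam' y) :
    ∃ p : Polynomial ℚ, (∀ i : ℕ, 0 ≤ p.coeff i) ∧
      ∀ n : ℕ, 1 ≤ n →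
        p.eval (n : ℚ) = markedCount A (fun x => (n : ℤ) * lam' x) := by
  rcases k with _ | m
  · refine ⟨1, fun i => ?_, fun n _ => ?_⟩
    · rw [Polynomial.coeff_one]; split_ifs <;> norm_num
    · have : IsEmpty (SkewPoset 0 lam mu) := ⟨fun p => (OrderDual.ofDual p.1).1.elim0⟩
      have h1 : markedCount A (fun x => (n : ℤ) * lam' x) = 1 := by
        unfold markedCount
        rw [Nat.card_eq_one_iff_unique]
        exact ⟨⟨fun f g => Subtype.ext (funext fun x => isEmptyElim x)⟩,
          ⟨⟨fun x => isEmptyElim x, fun x => isEmptyElim x, fun x => isEmptyElim x⟩⟩⟩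
      rw [h1]; simp
  · have := SkewEhrhart.skew_finite (m + 1) lam mu
    exact SkewEhrhart.marked_pos A hminmax lam' (SkewEhrhart.Zl_pow_pos lam mu hlam hmu hmulam)
end

section
/- Let P be the cell poset of a skew shape λ/μ, let A ⊆ P be a subposet containing all minima and maxima of P, and let A = {a_0, a_1, …, a_r} be a natural labeling. Then there exists a polynomial f ∈ ℚ[t_1, …, t_r] all of whose coefficients are nonnegative such that Ω_{P,A}(λ') = f(λ'(a_1) − λ'(a_0), …, λ'(a_r) − λ'(a_{r−1})) for every map λ' : A → ℤ satisfying λ'(a_0) ≤ λ'(a_1) ≤ ⋯ ≤ λ'(a_r). -/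
namespace SkewPos
open Finset Polynomial

section H
variable {A : Type*} [CommRing A] [Algebra ℚ A]

/-- complete homogeneous `h_K(1^x)`, polynomial in `x` -/
noncomputable def H (x : A) (K : ℤ) : A :=
  if K < 0 then 0 else
    algebraMap ℚ A (1 / (K.toNat.factorial : ℚ)) * ∏ i ∈ range K.toNat, (x + (i : A))

theorem H_neg (x : A) {K : ℤ} (h : K < 0) : H x K = 0 := by simp [H, h]

theorem H_nat (x : A) (n : ℕ) : H x (n : ℤ) =
    algebraMap ℚ A (1 / (n.factorial : ℚ)) * ∏ i ∈ range n, (x + (i : A)) := by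
  simp [H]

theorem H_rec (x : A) (K : ℤ) : H (x + 1) K = H x K + H (x + 1) (K - 1) := by
  rcases lt_or_ge K 0 with h | h
  · rw [H_neg _ h, H_neg _ h, H_neg _ (by omega)]; simp
  · obtain ⟨n, rfl⟩ := Int.eq_ofNat_of_zero_le h
    cases n with
    | zero =>
      rw [H_neg (x+1) (by simp : ((0:ℕ):ℤ) - 1 < 0), H_nat, H_nat]; simp
    | succ n =>
      have e : ((n + 1 : ℕ) : ℤ) - 1 = (n : ℤ) := by push_cast; ring
      rw [e, H_nat, H_nat, H_nat, prod_range_succ, prod_range_succ']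
      have e2 : algebraMap ℚ A (1 / (n.factorial : ℚ)) =
          algebraMap ℚ A (1 / ((n+1).factorial : ℚ)) * ((n : A) + 1) := by
        have : ((n : A) + 1) = algebraMap ℚ A ((n : ℚ) + 1) := by simp
        rw [this, ← map_mul]
        congr 1
        rw [Nat.factorial_succ]
        have h1 : (n.factorial : ℚ) ≠ 0 := by positivity
        have h2 : (n : ℚ) + 1 ≠ 0 := by positivity
        push_cast
        field_simp
      rw [e2]
      have e3 : ∏ i ∈ range n, (x + ((i + 1 : ℕ) : A)) = ∏ i ∈ range n, (x + 1 + (i : A)) := by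
        apply prod_congr rfl; intros; push_cast; ring
      rw [e3]
      push_cast
      ring

theorem H_sum (x : A) (c : ℤ) (a b : ℕ) (hab : a ≤ b) :
    ∑ v ∈ Icc a b, H x ((v : ℤ) + c) = H (x + 1) ((b : ℤ) + c) - H (x + 1) ((a : ℤ) - 1 + c) := by
  induction b, hab using Nat.le_induction with
  | base =>
    simp only [Icc_self, sum_singleton]
    rw [H_rec x ((a : ℤ) + c), show (a : ℤ) + c - 1 = a - 1 + c by ring]; ring
  | succ b hb ih =>
    rw [sum_Icc_succ_top (by omega), ih, H_rec x (((b + 1 : ℕ) : ℤ) + c),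
      show (((b + 1 : ℕ) : ℤ) + c - 1) = b + c by push_cast; ring]
    ring

theorem H_map {B : Type*} [CommRing B] [Algebra ℚ B] (φ : A →ₐ[ℚ] B) (x : A) (K : ℤ) :
    φ (H x K) = H (φ x) K := by
  unfold H
  split_ifs <;> simp [map_prod]

/-- vanishing -/
theorem H_zero (m K : ℕ) (h : m < K) : H (-(m : A)) (K : ℤ) = 0 := by
  rw [H_nat, prod_eq_zero (i := m) (by simpa using h) (by simp), mul_zero]

theorem H_one (K : ℕ) : H (1 : A) (K : ℤ) = 1 := by
  rw [H_nat]
  have : ∏ i ∈ range K, ((1:A) + (i : A)) = algebraMap ℚ A (K.factorial : ℚ) := by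
    rw [← prod_range_add_one_eq_factorial]; push_cast; simp [add_comm]
  rw [this, ← map_mul]
  have h1 : (K.factorial : ℚ) ≠ 0 := by positivity
  rw [one_div_mul_cancel h1, map_one]
end H

section alt
variable {R M N : Type*} [CommRing R] [AddCommGroup M] [Module R M] [AddCommGroup N] [Module R N]

/-- antitone vectors below `l` -/
noncomputable def AV {k : ℕ} (l : Fin k → ℕ) : Finset (Fin k → ℕ) :=
  open Classical in (Fintype.piFinset (fun i => Iic (l i))).filter Antitone

theorem mem_AV {k : ℕ} (l v : Fin k → ℕ) : v ∈ AV l ↔ v ≤ l ∧ Antitone v := by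
  simp [AV, Pi.le_def]

theorem antitone_cons {n : ℕ} (x : ℕ) (v : Fin (n+1) → ℕ) :
    Antitone (Fin.cons x v : Fin (n+2) → ℕ) ↔ v 0 ≤ x ∧ Antitone v := by
  rw [Fin.antitone_iff_succ_le, Fin.antitone_iff_succ_le, Fin.forall_fin_succ]
  simp

theorem AV_sum_succ {n : ℕ} (l : Fin (n+2) → ℕ) (g : (Fin (n+2) → ℕ) → N) :
    ∑ v ∈ AV l, g v = ∑ w ∈ AV (Fin.tail l), ∑ x ∈ Icc (w 0) (l 0), g (Fin.cons x w) := by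
  rw [sum_sigma']
  symm
  refine sum_bij' (fun p _ => Fin.cons p.2 p.1) (fun v _ => ⟨Fin.tail v, v 0⟩) ?_ ?_ ?_ ?_ ?_
  · rintro ⟨w, x⟩ h
    simp only [mem_sigma, mem_AV, mem_Icc] at h
    rw [mem_AV, antitone_cons]
    refine ⟨?_, h.2.1, h.1.2⟩
    intro i
    refine Fin.cases ?_ (fun i => ?_) i
    · simpa using h.2.2
    · simpa [Fin.tail] using h.1.1 i
  · intro v h
    rw [mem_AV] at h
    simp only [mem_sigma, mem_AV, mem_Icc]
    refine ⟨⟨fun i => h.1 _, fun i j hij => h.2 (by simpa using hij)⟩, h.2 (Fin.zero_le _), h.1 0⟩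
  · rintro ⟨w, x⟩ h; simp
  · intro v h; simp
  · intro v h; simp

theorem alt_sum (n : ℕ) : ∀ (φ : M [⋀^Fin (n+1)]→ₗ[R] N) (r r' : ℕ → ℕ → M)
    (_ : ∀ i < n, ∀ a b, a ≤ b → ∑ x ∈ Icc a b, r i x = r' i b - r (i+1) a)
    (_ : ∀ b, ∑ x ∈ Icc 0 b, r n x = r' n b) (l : Fin (n+1) → ℕ) (_ : Antitone l),
    ∑ v ∈ AV l, φ (fun i => r i (v i)) = φ (fun i => r' i (l i)) := by
  induction n with
  | zero =>
    intro φ r r' _ h l hl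
    have e : (fun i : Fin 1 => r' i (l i)) = Function.update (fun _ => 0) 0 (r' 0 (l 0)) := by
      ext i; fin_cases i; simp
    rw [e, ← h, ← AlternatingMap.coe_multilinearMap, MultilinearMap.map_update_sum]
    refine sum_bij' (fun v _ => v 0) (fun x _ _ => x) ?_ ?_ ?_ ?_ ?_
    · intro v hv; rw [mem_AV] at hv; simpa using hv.1 0
    · intro x hx
      rw [mem_AV]
      refine ⟨fun i => ?_, fun i j _ => le_rfl⟩
      fin_cases i; simpa using hx
    · intro v hv; ext i; fin_cases i; rfl
    · intro x hx; rfl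
    · intro v hv
      simp only [AlternatingMap.coe_multilinearMap]
      congr 1; ext i; fin_cases i; simp
  | succ n ih =>
    intro φ r r' h hlast l hl
    rw [AV_sum_succ l]
    have key : ∀ w ∈ AV (Fin.tail l), ∑ x ∈ Icc (w 0) (l 0),
        φ (fun i => r i ((Fin.cons x w : Fin (n+2) → ℕ) i)) =
        (φ.curryLeft (r' 0 (l 0))) (fun i : Fin (n+1) => r (i+1) (w i)) := by
      intro w hw
      rw [mem_AV] at hw
      have e : ∀ x, (fun i : Fin (n+2) => r i ((Fin.cons x w : Fin (n+2) → ℕ) i)) =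
          Matrix.vecCons (r 0 x) (fun i : Fin (n+1) => r (i+1) (w i)) := by
        intro x; ext i; refine Fin.cases ?_ (fun i => ?_) i <;> simp
      simp only [e, ← AlternatingMap.curryLeft_apply_apply]
      have e4 : ∀ (s : Finset ℕ) (v : Fin (n+1) → M),
          ∑ x ∈ s, (φ.curryLeft (r 0 x)) v = (φ.curryLeft (∑ x ∈ s, r 0 x)) v := by
        intro s v
        exact (map_sum (AddMonoidHom.mk' (fun m : M => φ.curryLeft m v)
          (fun x y => by rw [map_add, AlternatingMap.add_apply])) _ _).symm
      rw [e4, h 0 (by omega) _ _ ?_, map_sub,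
        AlternatingMap.sub_apply, sub_eq_self, AlternatingMap.curryLeft_apply_apply]
      · apply AlternatingMap.map_eq_zero_of_eq _ _ (i := 0) (j := 1)
        · simp
        · simp
      · exact (hw.1 0).trans (hl (Fin.zero_le _))
    rw [sum_congr rfl key]
    rw [ih (φ.curryLeft (r' 0 (l 0))) (fun i => r (i+1)) (fun i => r' (i+1))
      (fun i hi a b hab => h (i+1) (by omega) a b hab) hlast (Fin.tail l)
      (fun i j hij => hl (by simpa using hij))]
    rw [AlternatingMap.curryLeft_apply_apply]
    congr 1
    ext i; refine Fin.cases ?_ (fun i => ?_) i <;> simp [Fin.tail]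
end alt
end SkewPos

namespace SkewPos
open Finset Polynomial

section det
variable {A : Type*} [CommRing A] [Algebra ℚ A]

/-- The Kreweras matrix of the skew shape `l/m` -/
noncomputable def DM {k : ℕ} (c : A) (m l : Fin k → ℕ) : Matrix (Fin k) (Fin k) A :=
  Matrix.of fun i j => H (c + (((i : ℕ) : A) - ((j : ℕ) : A)))
    ((l i : ℤ) + (((j : ℕ) : ℤ) - ((i : ℕ) : ℤ) - (m j : ℤ)))

theorem DM_apply {k : ℕ} (c : A) (m l : Fin k → ℕ) (i j : Fin k) :
    DM c m l i j = H (c + (((i : ℕ) : A) - ((j : ℕ) : A)))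
    ((l i : ℤ) + (((j : ℕ) : ℤ) - ((i : ℕ) : ℤ) - (m j : ℤ))) := rfl

theorem DM_sum {k : ℕ} (c : A) (m l : Fin k → ℕ) (hl : Antitone l) :
    ∑ v ∈ AV l, (DM c m v).det = (DM (c + 1) m l).det := by
  cases k with
  | zero =>
    have : AV l = {l} := by
      ext v; rw [mem_AV, mem_singleton]
      refine ⟨fun _ => Subsingleton.elim _ _, fun h => ?_⟩
      rw [h]; exact ⟨le_rfl, hl⟩
    rw [this]; simp
  | succ n =>
    have := alt_sum (R := A) n (Matrix.detRowAlternating (n := Fin (n+1)) (R := A))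
      (fun i x => fun j : Fin (n+1) => H (c + ((i : A) - ((j : ℕ) : A)))
        ((x : ℤ) + (((j : ℕ) : ℤ) - (i : ℤ) - (m j : ℤ))))
      (fun i x => fun j : Fin (n+1) => H (c + 1 + ((i : A) - ((j : ℕ) : A)))
        ((x : ℤ) + (((j : ℕ) : ℤ) - (i : ℤ) - (m j : ℤ)))) ?_ ?_ l hl
    · exact this
    · intro i hi a b hab
      ext j
      simp only [Finset.sum_apply, Pi.sub_apply]
      rw [H_sum _ _ _ _ hab]
      congr 2
      · ring
      · push_cast; ring
      · push_cast; ring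
    · intro b
      ext j
      simp only [Finset.sum_apply]
      rw [H_sum _ _ _ _ (Nat.zero_le _), H_neg (K := ((0:ℕ):ℤ) - 1 + _), sub_zero]
      · congr 1; ring
      · have := j.2
        push_cast; omega

theorem DM_vanish {k : ℕ} (c : A) (m l : Fin k → ℕ) (hl : Antitone l) (hm : Antitone m)
    (h : ¬ m ≤ l) : (DM c m l).det = 0 := by
  simp only [Pi.le_def, not_forall, not_le] at h
  obtain ⟨i, hi⟩ := h
  rw [Matrix.det_apply]
  apply sum_eq_zero
  intro σ _
  suffices ∃ i', i ≤ σ i' ∧ i' ≤ i by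
    obtain ⟨i', h1, h2⟩ := this
    rw [prod_eq_zero (mem_univ i'), smul_zero]
    rw [DM_apply, H_neg]
    have := hl h1
    have := hm h2
    have : (i' : ℕ) ≤ i := h2
    have : (i : ℕ) ≤ (σ i' : ℕ) := h1
    omega
  by_contra hc
  push Not at hc
  have h1 : (Ici i).card ≤ (Ioi i).card := by
    apply card_le_card_of_injOn (fun x => σ.symm x)
    · intro x hx
      simp only [coe_Ici, Set.mem_Ici, coe_Ioi, Set.mem_Ioi] at *
      exact hc _ (by simpa using hx)
    · exact σ.symm.injective.injOn
  have : (Ioi i).card < (Ici i).card := by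
    apply card_lt_card
    rw [ssubset_iff_of_subset Ioi_subset_Ici_self]
    exact ⟨i, by simp, by simp⟩
  omega

theorem DM_one {k : ℕ} (m l : Fin k → ℕ) (hl : Antitone l) 
    (h : m ≤ l) : (DM (1 : A) m l).det = 1 := by
  rw [Matrix.det_of_isLowerTriangular]
  · apply prod_eq_one
    intro i _
    rw [DM_apply]
    obtain ⟨d, hd⟩ := Nat.exists_eq_add_of_le (h i)
    rw [show ((l i : ℤ) + (((i : ℕ) : ℤ) - ((i : ℕ) : ℤ) - (m i : ℤ))) = (d : ℤ) by rw [hd]; push_cast; ring]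
    rw [sub_self, add_zero, H_one]
  · intro i j hij
    have hij : i < j := hij
    rw [DM_apply]
    have h1 : (i : ℕ) < j := hij
    obtain ⟨e, he⟩ := Nat.exists_eq_add_of_lt h1
    obtain ⟨d, hd⟩ := Nat.exists_eq_add_of_le ((h j).trans (hl hij.le))
    rw [hd, he, show (1 : A) + (((i : ℕ) : A) - (((i : ℕ) + e + 1 : ℕ) : A)) = -(e : A) by push_cast; ring,
      show (((m j + d : ℕ) : ℤ) + (((i + e + 1 : ℕ) : ℤ) - ((i : ℕ) : ℤ) - (m j : ℤ))) = ((d + e + 1 : ℕ) : ℤ) by push_cast; ring,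
      H_zero _ _ (by omega)]

theorem DM_map {B : Type*} [CommRing B] [Algebra ℚ B] (φ : A →ₐ[ℚ] B) {k : ℕ} (c : A)
    (m l : Fin k → ℕ) : φ (DM c m l).det = (DM (φ c) m l).det := by
  rw [AlgHom.map_det]
  congr 1
  ext i j
  simp [DM_apply, H_map]

theorem DM_blocks {a b : ℕ} (c : A) (m l : Fin (a + b) → ℕ) (hl : Antitone l) (hm : Antitone m)
    (ha : 0 < a) (hb : 0 < b) (h : l (Fin.natAdd a ⟨0, hb⟩) ≤ m (Fin.castAdd b ⟨a - 1, by omega⟩)) :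
    (DM c m l).det = (DM c (fun i => m (Fin.castAdd b i)) (fun i => l (Fin.castAdd b i))).det *
      (DM c (fun i => m (Fin.natAdd a i)) (fun i => l (Fin.natAdd a i))).det := by
  rw [← Matrix.det_submatrix_equiv_self (finSumFinEquiv (m := a) (n := b)), 
    ← Matrix.fromBlocks_toBlocks ((DM c m l).submatrix _ _)]
  rw [show ((DM c m l).submatrix (finSumFinEquiv (m := a) (n := b)) finSumFinEquiv).toBlocks₂₁ = 0 from ?_,
    Matrix.det_fromBlocks_zero₂₁]
  · congr 2
    ext i j
    simp [Matrix.toBlocks₂₂, DM_apply]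
  · ext i j
    simp only [Matrix.toBlocks₂₁, Matrix.submatrix_apply, finSumFinEquiv_apply_left,
      finSumFinEquiv_apply_right, Matrix.of_apply, DM_apply, Matrix.zero_apply]
    rw [H_neg]
    have h1 : l (Fin.natAdd a i) ≤ l (Fin.natAdd a ⟨0, hb⟩) := hl (by simp [Fin.le_def])
    have h2 : m (Fin.castAdd b ⟨a - 1, by omega⟩) ≤ m (Fin.castAdd b j) := hm (by
      have := j.2
      simp only [Fin.le_def, Fin.val_castAdd]; omega)
    have := j.2
    simp only [Fin.val_castAdd, Fin.val_natAdd]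
    push_cast
    omega
end det

theorem H_X_dvd (j K : ℕ) (h : j < K) : ∃ g : ℚ[X], H ((X : ℚ[X]) - (j : ℚ[X])) (K : ℤ) = X * g ∧
    0 ≤ (-1 : ℚ) ^ j * g.coeff 0 := by
  obtain ⟨d, rfl⟩ := Nat.exists_eq_add_of_lt h
  refine ⟨C (1 / ((j + d + 1).factorial : ℚ)) * ((∏ i ∈ range j, ((X : ℚ[X]) - (j : ℚ[X]) + (i : ℚ[X]))) *
    (∏ i ∈ range d, ((X : ℚ[X]) + (i + 1 : ℚ[X])))), ?_, ?_⟩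
  · rw [H_nat, show j + d + 1 = j + (d + 1) by ring, prod_range_add, prod_range_succ']
    have : ∀ i : ℕ, (X : ℚ[X]) - (j : ℚ[X]) + ((j + (i + 1) : ℕ) : ℚ[X]) = X + (i + 1 : ℚ[X]) := by
      intro i; push_cast; ring
    simp only [this]
    rw [Polynomial.algebraMap_eq]
    push_cast
    ring
  · rw [coeff_zero_eq_eval_zero]
    simp only [eval_mul, eval_C, eval_prod, eval_add, eval_sub, eval_X, eval_natCast, eval_one, zero_sub, zero_add]
    have e : ∏ i ∈ range j, (-(j : ℚ) + (i : ℚ)) = (-1) ^ j * ∏ i ∈ range j, ((j : ℚ) - (i : ℚ)) := by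
      rw [← card_range j, ← prod_const, card_range, ← prod_mul_distrib]
      apply prod_congr rfl; intros; ring
    rw [e]
    have e2 : ((-1 : ℚ) ^ j) * (-1) ^ j = 1 := by rw [← mul_pow]; simp
    have p1 : 0 ≤ ∏ i ∈ range j, ((j : ℚ) - (i : ℚ)) := by
      apply prod_nonneg; intro i hi
      have : (i : ℚ) < j := by exact_mod_cast (mem_range.1 hi)
      linarith
    have p2 : 0 ≤ ∏ i ∈ range d, ((i : ℚ) + 1) := prod_nonneg (fun i _ => by positivity)
    calc (0:ℚ) ≤ (((-1 : ℚ) ^ j) * (-1) ^ j) * (1 / ((j + d + 1).factorial : ℚ) *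
          ((∏ i ∈ range j, ((j : ℚ) - (i : ℚ))) * ∏ i ∈ range d, ((i : ℚ) + 1))) := by
          rw [e2]; positivity
      _ = _ := by ring

theorem DM_conn {n : ℕ} (m l : Fin (n+1) → ℕ) (hl : Antitone l) 
    (h : ∀ i, m i < l i) (hc : ∀ i : Fin n, m i.castSucc < l i.succ) (hm : Antitone m) :
    (DM (X : ℚ[X]) m l).det.coeff 0 = 0 ∧ 0 ≤ (DM (X : ℚ[X]) m l).det.coeff 1 := by
  have hrow : ∀ i j : Fin (n+1), i ≤ j → ∃ g : ℚ[X], DM (X : ℚ[X]) m l i j = X * g ∧ 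
      0 ≤ (-1 : ℚ) ^ ((j : ℕ) - (i : ℕ)) * g.coeff 0 := by
    intro i j hij
    have hij' : (i : ℕ) ≤ j := hij
    obtain ⟨e, he⟩ := Nat.exists_eq_add_of_le hij'
    obtain ⟨d, hd⟩ := Nat.exists_eq_add_of_lt ((h j).trans_le (hl hij))
    rw [DM_apply, he, hd]
    rw [show (((m j + d + 1 : ℕ) : ℤ) + (((i + e : ℕ) : ℤ) - ((i : ℕ) : ℤ) - (m j : ℤ))) = ((d + e + 1 : ℕ) : ℤ) by push_cast; ring,
      show (X : ℚ[X]) + (((i : ℕ) : ℚ[X]) - (((i : ℕ) + e : ℕ) : ℚ[X])) = X - (e : ℚ[X]) by push_cast; ring, Nat.add_sub_cancel_left]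
    exact H_X_dvd e _ (by omega)
  choose g hg hg' using fun j => hrow 0 j (Fin.zero_le _)
  set D' : Matrix (Fin (n+1)) (Fin (n+1)) ℚ[X] := (DM X m l).submatrix (finRotate (n+1)) id with hD'
  have hdet : (DM (X : ℚ[X]) m l).det = (-1) ^ n * D'.det := by
    rw [hD', Matrix.det_permute, sign_finRotate]
    push_cast
    rw [← mul_assoc, ← mul_pow]; simp
  have hD'' : D'.det = X * (D'.updateRow (Fin.last n) g).det := by
    rw [← Matrix.det_updateRow_smul]
    congr 1
    ext1 i j
    by_cases hi : i = Fin.last n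
    · subst hi
      simp [hD', hg]
    · rw [Matrix.updateRow_ne hi]
  have h0 : (D'.updateRow (Fin.last n) g).det.coeff 0 = (g (Fin.last n)).coeff 0 := by
    have hco : ∀ p : ℚ[X], p.coeff 0 = (constantCoeff : ℚ[X] →+* ℚ) p := fun p => rfl
    rw [hco, RingHom.map_det, Matrix.det_of_isLowerTriangular]
    · rw [Fin.prod_univ_castSucc, prod_eq_one]
      · simp
      · intro i _
        have hne : i.castSucc ≠ Fin.last n := (Fin.castSucc_lt_last i).ne
        simp only [RingHom.mapMatrix_apply, Matrix.map_apply, Matrix.updateRow_ne hne, hD',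
          Matrix.submatrix_apply, id, DM_apply]
        rw [show finRotate (n+1) i.castSucc = i.succ by simp]
        obtain ⟨d, hd⟩ := Nat.exists_eq_add_of_lt (hc i)
        rw [hd, constantCoeff_apply, coeff_zero_eq_eval_zero]
        rw [show (((m i.castSucc + d + 1 : ℕ) : ℤ) + (((i.castSucc : ℕ) : ℤ) - ((i.succ : ℕ) : ℤ) - (m i.castSucc : ℤ))) = (d : ℤ) by
          simp only [Fin.val_castSucc, Fin.val_succ]; push_cast; ring]
        rw [show (X : ℚ[X]) + (((i.succ : ℕ) : ℚ[X]) - ((i.castSucc : ℕ) : ℚ[X])) = X + 1 by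
          simp only [Fin.val_castSucc, Fin.val_succ]; push_cast; ring]
        have := H_map (aeval (0:ℚ)) ((X : ℚ[X]) + 1) d
        simp only [coe_aeval_eq_eval] at this
        rw [this]
        simp [H_one]
    · intro i j hij
      have hij : i < j := hij
      have hne : i ≠ Fin.last n := (hij.trans_le (Fin.le_last _)).ne
      obtain ⟨i', rfl⟩ := Fin.exists_castSucc_eq.2 hne
      simp only [RingHom.mapMatrix_apply, Matrix.map_apply, Matrix.updateRow_ne hne, hD',
          Matrix.submatrix_apply, id]
      rw [show finRotate (n+1) i'.castSucc = i'.succ by simp]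
      obtain ⟨g', hg', _⟩ := hrow i'.succ j (by
        have : (i'.castSucc : ℕ) < j := hij
        simp only [Fin.le_def, Fin.val_succ, Fin.val_castSucc] at *; omega)
      rw [hg']; simp
  rw [hdet, hD'']
  have e : (-1 : ℚ[X]) ^ n = C ((-1) ^ n) := by simp
  rw [e]
  refine ⟨by simp, ?_⟩
  rw [coeff_C_mul, coeff_X_mul, h0]
  simpa using hg' (Fin.last n)

theorem DM_low : ∀ (k : ℕ) (m l : Fin k → ℕ), Antitone m → Antitone l → m ≤ l → 
    (DM (X : ℚ[X]) m l).det.coeff 0 = (open Classical in if m = l then 1 else 0) ∧ 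
      0 ≤ (DM (X : ℚ[X]) m l).det.coeff 1 := by
  classical
  intro k
  induction k using Nat.strong_induction_on with
  | _ k ih =>
  intro m l hm hl hle
  by_cases hgap : ∃ a b : ℕ, ∃ (ha : 0 < a) (hb : 0 < b) (hab : a + b = k),
      l ⟨a, by omega⟩ ≤ m ⟨a - 1, by omega⟩
  · obtain ⟨a, b, ha, hb, rfl, hg⟩ := hgap
    have hmono : Monotone (Fin.castAdd b : Fin a → Fin (a + b)) := fun i j h => by
      rw [Fin.le_def] at *; simpa using h
    have hmono' : Monotone (Fin.natAdd a : Fin b → Fin (a + b)) := fun i j h => by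
      rw [Fin.le_def] at *; simpa using h
    rw [DM_blocks X m l hl hm ha hb (by simpa using hg)]
    obtain ⟨A0, A1⟩ := ih a (by omega) (fun i => m (Fin.castAdd b i)) (fun i => l (Fin.castAdd b i))
      (hm.comp_monotone hmono) (hl.comp_monotone hmono) (fun i => hle _)
    obtain ⟨B0, B1⟩ := ih b (by omega) (fun i => m (Fin.natAdd a i)) (fun i => l (Fin.natAdd a i))
      (hm.comp_monotone hmono') (hl.comp_monotone hmono') (fun i => hle _)
    constructor
    · rw [mul_coeff_zero, A0, B0]
      have : m = l ↔ ((fun i => m (Fin.castAdd b i)) = (fun i => l (Fin.castAdd b i))) ∧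
          ((fun i => m (Fin.natAdd a i)) = (fun i => l (Fin.natAdd a i))) := by
        constructor
        · rintro rfl; exact ⟨rfl, rfl⟩
        · rintro ⟨h1, h2⟩
          ext i
          refine Fin.addCases (fun i => congrFun h1 i) (fun i => congrFun h2 i) i
      simp only [this]
      split_ifs <;> simp_all
    · rw [mul_coeff_one, A0, B0]
      refine add_nonneg (mul_nonneg ?_ B1) (mul_nonneg A1 ?_) <;> split_ifs <;> simp
  · push Not at hgap
    cases k with
    | zero => 
      have : m = l := Subsingleton.elim _ _
      simp [this, coeff_one]
    | succ n =>
      have hc : ∀ i : Fin n, m i.castSucc < l i.succ := by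
        intro i
        have := hgap (i + 1) (n - i) (by omega) (by omega) (by omega)
        exact this
      by_cases hall : ∀ i, m i < l i
      · obtain ⟨h1, h2⟩ := DM_conn m l hl hall hc hm
        refine ⟨?_, h2⟩
        rw [h1, if_neg]
        rintro rfl
        exact lt_irrefl _ (hall 0)
      · push Not at hall
        obtain ⟨i, hi⟩ := hall
        have hn : n = 0 := by
          by_contra hn
          refine Fin.lastCases (motive := fun i => l i ≤ m i → False) ?_ ?_ i hi
          · intro h
            obtain ⟨n', rfl⟩ := Nat.exists_eq_succ_of_ne_zero hn
            have := hc (Fin.last n')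
            have h2 := hm (Fin.castSucc_lt_succ (i := Fin.last n')).le
            simp only [Fin.succ_last] at *
            omega
          · intro i h
            have := hc i
            have := hl (Fin.castSucc_lt_succ (i := i)).le
            omega
        subst hn
        have hi0 : i = 0 := Fin.ext (by omega)
        subst hi0
        have e : l 0 = m 0 := le_antisymm hi (hle 0)
        have : m = l := by ext i; rw [show i = 0 from Fin.ext (by omega), e]
        subst this
        have h1 : (DM (X : ℚ[X]) m m).det = 1 := by
          rw [Matrix.det_fin_one, DM_apply]
          have := H_nat (X : ℚ[X]) 0
          simpa using this
        rw [h1]; simp [coeff_one]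
end SkewPos

namespace SkewPos
open Finset Polynomial

/-- antitone vectors between `mu` and `lam` -/
abbrev V (k : ℕ) (lam mu : Fin k → ℕ) : Type :=
  {v : Fin k → ℕ // Antitone v ∧ mu ≤ v ∧ v ≤ lam}

noncomputable instance (k : ℕ) (lam mu : Fin k → ℕ) : Fintype (V k lam mu) := by
  classical
  exact Fintype.subtype ((AV lam).filter (fun v => mu ≤ v)) (by
    intro v; rw [mem_filter, mem_AV]; tauto)

section
variable {k : ℕ} {lam mu : Fin k → ℕ}

open Classical in
/-- zeta matrix -/
noncomputable def Z : Matrix (V k lam mu) (V k lam mu) ℚ :=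
  Matrix.of fun m l => if m.1 ≤ l.1 then 1 else 0

noncomputable def P (m l : V k lam mu) : ℚ[X] := (DM (X : ℚ[X]) m.1 l.1).det

theorem P_eval (m l : V k lam mu) (t : ℚ) : (P m l).eval t = (DM t m.1 l.1).det := by
  have := DM_map (aeval t) (X : ℚ[X]) m.1 l.1
  simpa [P, coe_aeval_eq_eval] using this

open Classical in
theorem Z_pow_succ (t : ℕ) (m l : V k lam mu) :
    ((Z : Matrix (V k lam mu) (V k lam mu) ℚ) ^ (t + 1)) m l = (P m l).eval ((t : ℚ) + 1) := by
  rw [P_eval]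
  induction t generalizing l with
  | zero =>
    simp only [zero_add, pow_one, Z, Matrix.of_apply, Nat.cast_zero]
    split_ifs with h
    · rw [DM_one _ _ l.2.1 h]
    · rw [DM_vanish _ _ _ l.2.1 m.2.1 h]
  | succ t ih =>
    rw [pow_succ, Matrix.mul_apply]
    push_cast
    rw [← DM_sum _ _ _ l.2.1]
    simp only [ih]
    simp only [Z, Matrix.of_apply, mul_ite, mul_one, mul_zero]
    rw [← sum_filter]
    rw [← sum_filter_of_ne (s := AV l.1) (p := fun v => mu ≤ v)]
    · refine sum_bij (fun v _ => v.1) ?_ ?_ ?_ ?_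
      · intro v hv
        rw [mem_filter, mem_AV]
        exact ⟨⟨(mem_filter.1 hv).2, v.2.1⟩, v.2.2.1⟩
      · intro v _ w _ h; exact Subtype.ext h
      · intro v hv
        rw [mem_filter, mem_AV] at hv
        exact ⟨⟨v, hv.1.2, hv.2, hv.1.1.trans l.2.2.2⟩, mem_filter.2 ⟨mem_univ _, hv.1.1⟩, rfl⟩
      · intro v hv; rfl
    · intro v hv hne
      rw [mem_AV] at hv
      by_contra hc
      apply hne
      apply DM_vanish _ _ _ hv.2 m.2.1
      intro h; exact hc (m.2.2.1.trans h)

theorem poly_eq_of_nat (p q : ℚ[X]) (h : ∀ t : ℕ, p.eval ((t : ℚ) + 1) = q.eval ((t : ℚ) + 1)) :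
    p = q := by
  apply Polynomial.eq_of_infinite_eval_eq
  apply Set.Infinite.mono (s := Set.range (fun t : ℕ => (t : ℚ) + 1))
  · rintro _ ⟨t, rfl⟩; exact h t
  · apply Set.infinite_range_of_injective
    intro a b hab; simpa using hab

open Classical in
theorem P_conv (m l : V k lam mu) (s : ℕ) :
    (P m l).comp (X + C ((s : ℚ) + 1)) = ∑ v, C ((P m v).eval ((s : ℚ) + 1)) * P v l := by
  apply poly_eq_of_nat
  intro t
  rw [eval_comp, eval_finsetSum]
  simp only [eval_add, eval_X, eval_C, eval_mul]
  have h := congrFun (congrFun (pow_add (Z : Matrix (V k lam mu) (V k lam mu) ℚ) (s+1) (t+1)) m) l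
  rw [Matrix.mul_apply, show s + 1 + (t + 1) = (s + t + 1) + 1 by ring] at h
  simp only [Z_pow_succ] at h
  rw [← h]
  push_cast
  congr 1; ring

theorem P_deriv (m l : V k lam mu) :
    derivative (P m l) = ∑ v, C ((P v l).coeff 1) * P m v := by
  apply poly_eq_of_nat
  intro s
  have h := congrArg (fun p => (derivative p).eval 0) (P_conv m l s)
  simp only [derivative_comp, derivative_sum, derivative_mul, derivative_C, eval_finsetSum] at h
  simp only [eval_mul, eval_comp, eval_add, eval_X, eval_C, zero_add, derivative_add, derivative_X,
    derivative_C, eval_one, one_mul, add_zero, eval_zero, zero_mul] at h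
  rw [h, eval_finsetSum]
  apply sum_congr rfl
  intro v _
  rw [eval_mul, eval_C, ← coeff_zero_eq_eval_zero, coeff_derivative]
  simp [mul_comm]

theorem P_low (m l : V k lam mu) : 
    (P m l).coeff 0 = (open Classical in if m = l then 1 else 0) ∧ 0 ≤ (P m l).coeff 1 := by
  classical
  by_cases h : m.1 ≤ l.1
  · have := DM_low k m.1 l.1 m.2.1 l.2.1 h
    simp only [← Subtype.ext_iff] at this
    exact this
  · have h0 : P m l = 0 := DM_vanish _ _ _ l.2.1 m.2.1 h
    have : m ≠ l := by rintro rfl; exact h le_rfl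
    simp [h0, this]

theorem P_nonneg (n : ℕ) (m l : V k lam mu) : 0 ≤ (P m l).coeff n := by
  induction n generalizing l with
  | zero => rw [(P_low m l).1]; split_ifs <;> simp
  | succ n ih =>
    have h := congrArg (fun p => p.coeff n) (P_deriv m l)
    simp only [coeff_derivative, finsetSum_coeff, coeff_C_mul] at h
    have h2 : 0 ≤ (P m l).coeff (n+1) * ((n : ℚ) + 1) := by
      rw [h]; exact sum_nonneg (fun v _ => mul_nonneg (P_low v l).2 (ih v))
    exact nonneg_of_mul_nonneg_left h2 (by positivity)

open Classical in
theorem Z_pow (t : ℕ) (m l : V k lam mu) :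
    ((Z : Matrix (V k lam mu) (V k lam mu) ℚ) ^ t) m l = (P m l).eval (t : ℚ) := by
  cases t with
  | zero => 
    rw [pow_zero, Matrix.one_apply, Nat.cast_zero, ← coeff_zero_eq_eval_zero, (P_low m l).1]
  | succ t => rw [Z_pow_succ]; push_cast; rfl
end
end SkewPos

namespace SkewPos
open Finset

section count
open Classical in
/-- order preserving maps on `E \ D` (extended by zero) with allowed values `Φ` -/
noncomputable def CC {α : Type*} [PartialOrder α] [Fintype α] (D E : LowerSet α) (Φ : α → Finset ℤ) :
    Finset (α → ℤ) :=
  (Fintype.piFinset (fun p => if p ∈ E ∧ p ∉ D then Φ p else {0})).filter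
    (fun f => ∀ p q, (p ∈ E ∧ p ∉ D) → (q ∈ E ∧ q ∉ D) → p ≤ q → f p ≤ f q)

variable {α : Type*} [PartialOrder α] [Fintype α]

theorem mem_CC (D E : LowerSet α) (Φ : α → Finset ℤ) (f : α → ℤ) :
    f ∈ CC D E Φ ↔ (∀ p, (p ∈ E ∧ p ∉ D) → f p ∈ Φ p) ∧ (∀ p, ¬ (p ∈ E ∧ p ∉ D) → f p = 0) ∧
      ∀ p q, (p ∈ E ∧ p ∉ D) → (q ∈ E ∧ q ∉ D) → p ≤ q → f p ≤ f q := by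
  classical
  rw [CC, mem_filter, Fintype.mem_piFinset, ← and_assoc]
  refine and_congr_left (fun _ => ?_)
  constructor
  · intro h
    refine ⟨fun p hp => ?_, fun p hp => ?_⟩
    · have := h p; rwa [if_pos hp] at this
    · have := h p; rw [if_neg hp] at this; simpa using this
  · rintro ⟨h1, h2⟩ p
    split_ifs with h
    · exact h1 p h
    · simpa using h2 p h

theorem CC_congr (D E : LowerSet α) (Φ Ψ : α → Finset ℤ) (h : ∀ p, p ∈ E → p ∉ D → Φ p = Ψ p) :
    CC D E Φ = CC D E Ψ := by
  ext f
  rw [mem_CC, mem_CC]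
  refine and_congr_left (fun _ => forall_congr' fun p => ?_)
  constructor
  · intro h1 hp; rw [← h p hp.1 hp.2]; exact h1 hp
  · intro h1 hp; rw [h p hp.1 hp.2]; exact h1 hp

theorem CC_empty (D E : LowerSet α) (Φ : α → Finset ℤ) (p : α) (h1 : p ∈ E) (h2 : p ∉ D)
    (h : Φ p = ∅) : (CC D E Φ).card = 0 := by
  rw [card_eq_zero, eq_empty_iff_forall_notMem]
  intro f hf
  rw [mem_CC] at hf
  have := hf.1 p ⟨h1, h2⟩
  simp [h] at this

/-- a unique allowed value -/
theorem CC_const (D E : LowerSet α) (Φ : α → Finset ℤ) (c : ℤ)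
    (h : ∀ p, p ∈ E → p ∉ D → Φ p = {c}) : (CC D E Φ).card = 1 := by
  classical
  rw [card_eq_one]
  refine ⟨fun p => if p ∈ E ∧ p ∉ D then c else 0, ?_⟩
  ext f
  rw [mem_CC, mem_singleton]
  constructor
  · rintro ⟨h1, h2, _⟩
    ext p
    split_ifs with hp
    · have := h1 p hp; rw [h p hp.1 hp.2] at this; simpa using this
    · exact h2 p hp
  · rintro rfl
    refine ⟨fun p hp => ?_, fun p hp => ?_, fun p q hp hq _ => ?_⟩ <;> beta_reduce
    · rw [if_pos hp, h p hp.1 hp.2]; simp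
    · rw [if_neg hp]
    · rw [if_pos hp, if_pos hq]

noncomputable instance : Fintype (LowerSet α) := Fintype.ofFinite _

open Classical in
theorem CC_split (D E : LowerSet α) (hDE : D ≤ E) (Φ : α → Finset ℤ) (c : ℤ) :
    (CC D E Φ).card = ∑ G ∈ univ.filter (fun G : LowerSet α => D ≤ G ∧ G ≤ E),
      (CC D G (fun p => (Φ p).filter (· ≤ c))).card * (CC G E (fun p => (Φ p).filter (c < ·))).card := by
  simp only [← card_product]
  rw [← card_sigma]
  symm
  refine card_bij (fun x _ => x.2.1 + x.2.2) ?_ ?_ ?_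
  · rintro ⟨G, g, h⟩ hx
    simp only [mem_sigma, mem_filter, mem_univ, true_and, mem_product, mem_CC] at hx ⊢
    obtain ⟨⟨hDG, hGE⟩, ⟨g1, g2, g3⟩, h1, h2, h3⟩ := hx
    have kG : ∀ p, p ∈ G → h p = 0 := fun p hp => h2 p (fun hh => hh.2 hp)
    have kG' : ∀ p, p ∉ G → g p = 0 := fun p hp => g2 p (fun hh => hp hh.1)
    refine ⟨?_, ?_, ?_⟩
    · rintro p ⟨pE, pD⟩
      by_cases pG : p ∈ G
      · simp [kG p pG, (g1 p ⟨pG, pD⟩).1]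
      · simp [kG' p pG, (h1 p ⟨pE, pG⟩).1]
    · intro p hp
      rw [Pi.add_apply, g2 p (fun hh => hp ⟨hGE hh.1, hh.2⟩), h2 p (fun hh => hp ⟨hh.1, fun hd => hh.2 (hDG hd)⟩), add_zero]
    · rintro p q ⟨pE, pD⟩ ⟨qE, qD⟩ hpq
      simp only [Pi.add_apply]
      by_cases pG : p ∈ G <;> by_cases qG : q ∈ G
      · rw [kG p pG, kG q qG]; simpa using g3 p q ⟨pG, pD⟩ ⟨qG, qD⟩ hpq
      · rw [kG p pG, kG' q qG]
        have := (g1 p ⟨pG, pD⟩).2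
        have := (h1 q ⟨qE, qG⟩).2
        omega
      · exact absurd (G.lower hpq qG) pG
      · rw [kG' p pG, kG' q qG]; simpa using h3 p q ⟨pE, pG⟩ ⟨qE, qG⟩ hpq
  · have aux : ∀ (G : LowerSet α) (g h : α → ℤ), D ≤ G → G ≤ E → 
        g ∈ CC D G (fun p => (Φ p).filter (· ≤ c)) → h ∈ CC G E (fun p => (Φ p).filter (c < ·)) →
        (∀ p, p ∈ G ↔ p ∈ D ∨ (p ∈ E ∧ (g + h) p ≤ c)) ∧ 
        ∀ p, (p ∈ G → g p = (g + h) p ∧ h p = 0) ∧ (p ∉ G → g p = 0 ∧ h p = (g + h) p) := by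
      intro G g h hDG hGE hg hh
      simp only [mem_filter, mem_CC] at hg hh
      obtain ⟨g1, g2, g3⟩ := hg
      obtain ⟨h1, h2, h3⟩ := hh
      have kG : ∀ p, p ∈ G → h p = 0 := fun p hp => h2 p (fun hh => hh.2 hp)
      have kG' : ∀ p, p ∉ G → g p = 0 := fun p hp => g2 p (fun hh => hp hh.1)
      refine ⟨fun p => ?_, fun p => ⟨fun hp => ?_, fun hp => ?_⟩⟩
      · constructor
        · intro hp
          by_cases pD : p ∈ D
          · exact Or.inl pD
          · refine Or.inr ⟨hGE hp, ?_⟩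
            rw [Pi.add_apply, kG p hp, add_zero]
            exact (g1 p ⟨hp, pD⟩).2
        · rintro (hp | ⟨hp, hc⟩)
          · exact hDG hp
          · by_contra hn
            rw [Pi.add_apply, kG' p hn, zero_add] at hc
            have := (h1 p ⟨hp, hn⟩).2
            omega
      · simp [kG p hp]
      · simp [kG' p hp]
    rintro ⟨G, g, h⟩ hx ⟨G', g', h'⟩ hx' heq
    simp only [mem_sigma, mem_filter, mem_univ, true_and, mem_product] at hx hx' heq
    obtain ⟨a1, a2⟩ := aux G g h hx.1.1 hx.1.2 hx.2.1 hx.2.2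
    obtain ⟨b1, b2⟩ := aux G' g' h' hx'.1.1 hx'.1.2 hx'.2.1 hx'.2.2
    have hG : G = G' := by
      ext p
      rw [SetLike.mem_coe, SetLike.mem_coe, a1, b1, heq]
    subst hG
    have hg : g = g' := by
      ext p
      by_cases hp : p ∈ G
      · rw [((a2 p).1 hp).1, ((b2 p).1 hp).1, heq]
      · rw [((a2 p).2 hp).1, ((b2 p).2 hp).1]
    have hh : h = h' := by
      ext p
      by_cases hp : p ∈ G
      · rw [((a2 p).1 hp).2, ((b2 p).1 hp).2]
      · rw [((a2 p).2 hp).2, ((b2 p).2 hp).2, heq]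
    rw [hg, hh]
  · intro f hf
    rw [mem_CC] at hf
    obtain ⟨f1, f2, f3⟩ := hf
    let G : LowerSet α := ⟨{p | p ∈ D ∨ (p ∈ E ∧ f p ≤ c)}, by
      rintro p q hqp (hp | ⟨hp, hc⟩)
      · exact Or.inl (D.lower hqp hp)
      · by_cases hq : q ∈ D
        · exact Or.inl hq
        · have hpD : p ∉ D := fun h => hq (D.lower hqp h)
          exact Or.inr ⟨E.lower hqp hp, (f3 q p ⟨E.lower hqp hp, hq⟩ ⟨hp, hpD⟩ hqp).trans hc⟩⟩
    have hG : ∀ p, p ∈ G ↔ p ∈ D ∨ (p ∈ E ∧ f p ≤ c) := fun p => Iff.rfl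
    have hDG : D ≤ G := fun p hp => Or.inl hp
    have hGE : G ≤ E := by
      rintro p (hp | hp)
      · exact hDE hp
      · exact hp.1
    refine ⟨⟨G, fun p => if p ∈ G then f p else 0, fun p => if p ∈ G then 0 else f p⟩, ?_, ?_⟩
    · simp only [mem_sigma, mem_filter, mem_univ, true_and, mem_product, mem_CC]
      refine ⟨⟨hDG, hGE⟩, ⟨?_, ?_, ?_⟩, ?_, ?_, ?_⟩
      · rintro p ⟨hp, hpD⟩
        rw [if_pos hp]
        refine ⟨f1 p ⟨hGE hp, hpD⟩, ?_⟩
        rcases hp with hp | hp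
        · exact absurd hp hpD
        · exact hp.2
      · intro p hp
        split_ifs with h
        · apply f2; intro hh; exact hp ⟨h, hh.2⟩
        · rfl
      · rintro p q ⟨hp, hpD⟩ ⟨hq, hqD⟩ hpq
        rw [if_pos hp, if_pos hq]
        exact f3 p q ⟨hGE hp, hpD⟩ ⟨hGE hq, hqD⟩ hpq
      · rintro p ⟨hp, hpG⟩
        rw [if_neg hpG]
        refine ⟨f1 p ⟨hp, fun h => hpG (hDG h)⟩, ?_⟩
        by_contra hc
        exact hpG (Or.inr ⟨hp, not_lt.1 hc⟩)
      · intro p hp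
        split_ifs with h
        · rfl
        · apply f2; intro hh; exact hp ⟨hh.1, h⟩
      · rintro p q ⟨hp, hpG⟩ ⟨hq, hqG⟩ hpq
        rw [if_neg hpG, if_neg hqG]
        exact f3 p q ⟨hp, fun h => hpG (hDG h)⟩ ⟨hq, fun h => hqG (hDG h)⟩ hpq
    · ext p
      simp only [Pi.add_apply]
      split_ifs <;> simp

open Classical in
/-- one more value -/
theorem CC_succ (D E : LowerSet α) (hDE : D ≤ E) (c : ℤ) (t : ℕ) :
    (CC D E (fun _ => Ioc c (c + (t + 1 : ℕ)))).card =
      ∑ G ∈ univ.filter (fun G : LowerSet α => D ≤ G ∧ G ≤ E),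
        (CC D G (fun _ => Ioc c (c + t))).card := by
  rw [CC_split D E hDE _ (c + t)]
  apply sum_congr rfl
  intro G _
  rw [CC_const G E _ (c + (t + 1 : ℕ)), mul_one]
  · congr 1
    apply CC_congr
    intro p _ _
    ext x; simp only [mem_filter, mem_Ioc]; push_cast; omega
  · intro p _ _
    ext x; simp only [mem_filter, mem_Ioc, mem_singleton]; push_cast; omega

theorem CC_zero (D E : LowerSet α) (c : ℤ) (hDE : D ≤ E) :
    (CC D E (fun _ => Ioc c (c + (0 : ℕ)))).card = (open Classical in if D = E then 1 else 0) := by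
  split_ifs with h
  · subst h
    apply CC_const _ _ _ 0
    intro p h1 h2; exact absurd h1 h2
  · obtain ⟨p, hp, hpD⟩ := Set.exists_of_ssubset (lt_of_le_of_ne hDE h : D < E)
    exact CC_empty D E _ p hp hpD (by simp)
end count
end SkewPos

namespace SkewPos
open Finset

section nn
variable {σ : Type*}
/-- nonnegative coefficients -/
def NN (f : MvPolynomial σ ℚ) : Prop := ∀ m, 0 ≤ f.coeff m

theorem NN.sum {ι : Type*} (s : Finset ι) (f : ι → MvPolynomial σ ℚ) (h : ∀ i ∈ s, NN (f i)) :
    NN (∑ i ∈ s, f i) := by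
  intro m; rw [MvPolynomial.coeff_sum]; exact sum_nonneg (fun i hi => h i hi m)

theorem NN.mul {f g : MvPolynomial σ ℚ} (hf : NN f) (hg : NN g) : NN (f * g) := by
  classical
  intro m; rw [MvPolynomial.coeff_mul]
  exact sum_nonneg (fun i _ => mul_nonneg (hf _) (hg _))

theorem NN.monomial (s : σ →₀ ℕ) (c : ℚ) (hc : 0 ≤ c) : NN (MvPolynomial.monomial s c) := by
  classical
  intro m; rw [MvPolynomial.coeff_monomial]; split_ifs <;> simp [hc]

theorem NN.aeval (p : Polynomial ℚ) (hp : ∀ n, 0 ≤ p.coeff n) (i : σ) :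
    NN (Polynomial.aeval (MvPolynomial.X i : MvPolynomial σ ℚ) p) := by
  rw [Polynomial.aeval_eq_sum_range]
  apply NN.sum
  intro n _
  rw [MvPolynomial.X_pow_eq_monomial, MvPolynomial.smul_monomial]
  apply NN.monomial
  simpa using hp n

theorem eval_aeval (p : Polynomial ℚ) (i : σ) (v : σ → ℚ) :
    MvPolynomial.eval v (Polynomial.aeval (MvPolynomial.X i : MvPolynomial σ ℚ) p) = p.eval (v i) := by
  rw [Polynomial.aeval_def, Polynomial.hom_eval₂, MvPolynomial.eval_X]
  rw [Polynomial.eval, Polynomial.eval₂_eq_sum, Polynomial.eval₂_eq_sum]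
  simp
end nn

section marked
variable {α : Type} [PartialOrder α] [Fintype α]

theorem CC_force (Q Q' : LowerSet α) (b : α) (c : ℤ) (Φ : α → Finset ℤ)
    (hQ' : ∀ p, p ∈ Q' ↔ p ∈ Q ∧ ¬ b ≤ p) (hb : b ∈ Q) (hΦb : Φ b = {c})
    (h1 : ∀ p ∈ Q, b ≤ p → c ∈ Φ p) (h2 : ∀ p ∈ Q, ∀ x ∈ Φ p, x ≤ c) :
    (CC ⊥ Q Φ).card = (CC ⊥ Q' Φ).card := by
  classical
  have hbot : ∀ p : α, p ∉ (⊥ : LowerSet α) := fun p => LowerSet.notMem_bot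
  refine card_bij' (fun f _ => fun p => if p ∈ Q' then f p else 0)
    (fun g _ => fun p => if p ∈ Q ∧ b ≤ p then c else g p) ?_ ?_ ?_ ?_
  · intro f hf
    simp only [mem_CC, hbot, not_false_eq_true, and_true] at hf ⊢
    obtain ⟨f1, f2, f3⟩ := hf
    refine ⟨fun p hp => ?_, fun p hp => ?_, fun p q hp hq hpq => ?_⟩
    · rw [if_pos hp]; exact f1 p ((hQ' p).1 hp).1
    · rw [if_neg hp]
    · rw [if_pos hp, if_pos hq]; exact f3 p q ((hQ' p).1 hp).1 ((hQ' q).1 hq).1 hpq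
  · intro g hg
    simp only [mem_CC, hbot, not_false_eq_true, and_true] at hg ⊢
    obtain ⟨f1, f2, f3⟩ := hg
    refine ⟨fun p hp => ?_, fun p hp => ?_, fun p q hp hq hpq => ?_⟩
    · split_ifs with h
      · exact h1 p hp h.2
      · exact f1 p ((hQ' p).2 ⟨hp, fun hh => h ⟨hp, hh⟩⟩)
    · rw [if_neg (fun h => hp h.1)]
      exact f2 p (fun h => hp ((hQ' p).1 h).1)
    · by_cases hbp : b ≤ p
      · rw [if_pos ⟨hp, hbp⟩, if_pos ⟨hq, hbp.trans hpq⟩]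
      · have hp' : p ∈ Q' := (hQ' p).2 ⟨hp, hbp⟩
        rw [if_neg (fun h => hbp h.2)]
        split_ifs with h
        · exact h2 p hp _ (f1 p hp')
        · exact f3 p q hp' ((hQ' q).2 ⟨hq, fun hh => h ⟨hq, hh⟩⟩) hpq
  · intro f hf
    simp only [mem_CC, hbot, not_false_eq_true, and_true] at hf
    obtain ⟨f1, f2, f3⟩ := hf
    ext p
    beta_reduce
    by_cases hp : p ∈ Q
    · by_cases hbp : b ≤ p
      · rw [if_pos ⟨hp, hbp⟩]
        have e1 := f1 b hb
        rw [hΦb, mem_singleton] at e1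
        have := f3 b p hb hp hbp
        have := h2 p hp _ (f1 p hp)
        omega
      · rw [if_neg (fun h => hbp h.2), if_pos ((hQ' p).2 ⟨hp, hbp⟩)]
    · rw [if_neg (fun h => hp h.1), if_neg (fun h => hp ((hQ' p).1 h).1), f2 p hp]
  · intro g hg
    simp only [mem_CC, hbot, not_false_eq_true, and_true] at hg
    obtain ⟨f1, f2, f3⟩ := hg
    ext p
    beta_reduce
    by_cases hp : p ∈ Q'
    · rw [if_pos hp, if_neg (fun h => ((hQ' p).1 hp).2 h.2)]
    · rw [if_neg hp, f2 p hp]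

open Classical in
/-- allowed values for the marked problem -/
noncomputable def Ph (A : Set α) (lam' : α → ℤ) (lo hi : ℤ) (p : α) : Finset ℤ :=
  if p ∈ A then {lam' p} else Icc lo hi

theorem marked_rec (PP : ∀ D E : LowerSet α, D ≤ E → ∃ p : Polynomial ℚ, (∀ n, 0 ≤ p.coeff n) ∧
      ∀ (c : ℤ) (t : ℕ), ((CC D E (fun _ => Ioc c (c + t))).card : ℚ) = p.eval (t : ℚ))
    (A : Set α) (r : ℕ) (a : Fin (r + 1) → α)
    (hrange : Set.range a = A) (hnat : ∀ i j : Fin (r + 1), a i < a j → i < j)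
    (hinj : Function.Injective a) (j : ℕ) :
    ∀ (hj : j < r + 1) (Q : LowerSet α) (_ : ∀ i, a i ∈ Q ↔ (i : ℕ) ≤ j),
    ∃ f : MvPolynomial (Fin r) ℚ, NN f ∧ ∀ lam' : α → ℤ,
      (∀ i j : Fin (r + 1), i ≤ j → lam' (a i) ≤ lam' (a j)) →
      ((CC ⊥ Q (Ph A lam' (lam' (a 0)) (lam' (a ⟨j, hj⟩)))).card : ℚ) =
        MvPolynomial.eval
            (fun i : Fin r => ((lam' (a i.succ) : ℚ) - (lam' (a i.castSucc) : ℚ))) f := by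
  classical
  have hmemA : ∀ p, p ∈ A ↔ ∃ i, a i = p := by intro p; rw [← hrange]; rfl
  induction j with
  | zero =>
    intro hj Q hQ
    refine ⟨MvPolynomial.monomial 0 1, NN.monomial _ _ zero_le_one, ?_⟩
    intro lam' hch
    rw [CC_const _ _ _ (lam' (a 0))]
    · simp
    · intro p hp _
      unfold Ph
      split_ifs with hA
      · obtain ⟨i, rfl⟩ := (hmemA p).1 hA
        have h0 := (hQ i).1 hp
        rw [show i = 0 from Fin.ext (by simpa using h0)]
      · simp
  | succ j ih =>
    intro hj Q hQ
    have hj' : j < r + 1 := by omega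
    set b := a ⟨j + 1, hj⟩ with hb
    let Q' : LowerSet α := ⟨{p | p ∈ Q ∧ ¬ b ≤ p}, fun p q hqp hp =>
      ⟨Q.lower hqp hp.1, fun h => hp.2 (h.trans hqp)⟩⟩
    have hQ' : ∀ p, p ∈ Q' ↔ p ∈ Q ∧ ¬ b ≤ p := fun p => Iff.rfl
    have hle : ∀ i i' : Fin (r+1), a i ≤ a i' → i ≤ i' := by
      intro i i' h
      rcases h.eq_or_lt with h | h
      · exact (hinj h).le
      · exact (hnat _ _ h).le
    have haQ' : ∀ i, a i ∈ Q' ↔ (i : ℕ) ≤ j := by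
      intro i
      rw [hQ', hQ]
      constructor
      · rintro ⟨h1, h2⟩
        by_contra h3
        apply h2
        rw [hb, show i = ⟨j + 1, hj⟩ from Fin.ext (by simp; omega)]
      · intro h
        refine ⟨by omega, fun h2 => ?_⟩
        have : j + 1 ≤ (i : ℕ) := hle _ _ h2
        omega
    have h1 : ∀ G : LowerSet α, ∃ f : MvPolynomial (Fin r) ℚ, NN f ∧
        ((∀ i, a i ∈ G ↔ (i : ℕ) ≤ j) → ∀ lam' : α → ℤ,
      (∀ i j : Fin (r + 1), i ≤ j → lam' (a i) ≤ lam' (a j)) →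
      ((CC ⊥ G (Ph A lam' (lam' (a 0)) (lam' (a ⟨j, hj'⟩)))).card : ℚ) =
        MvPolynomial.eval
            (fun i : Fin r => ((lam' (a i.succ) : ℚ) - (lam' (a i.castSucc) : ℚ))) f) := by
      intro G
      by_cases hG : ∀ i, a i ∈ G ↔ (i : ℕ) ≤ j
      · obtain ⟨f, hf, h⟩ := ih hj' G hG
        exact ⟨f, hf, fun _ => h⟩
      · exact ⟨0, fun m => by simp, fun h => absurd h hG⟩
    have h2 : ∀ G : LowerSet α, ∃ p : Polynomial ℚ, (∀ n, 0 ≤ p.coeff n) ∧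
      (G ≤ Q' → ∀ (c : ℤ) (t : ℕ), ((CC G Q' (fun _ => Ioc c (c + t))).card : ℚ) = p.eval (t : ℚ)) := by
      intro G
      by_cases hG : G ≤ Q'
      · obtain ⟨p, hp, h⟩ := PP G Q' hG
        exact ⟨p, hp, fun _ => h⟩
      · exact ⟨0, fun m => by simp, fun h => absurd h hG⟩
    choose F hF hF' using h1
    choose R hR hR' using h2
    have hjr : j < r := by omega
    refine ⟨∑ G ∈ univ.filter (fun G : LowerSet α => G ≤ Q' ∧ ∀ i, a i ∈ G ↔ (i : ℕ) ≤ j),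
      F G * Polynomial.aeval (MvPolynomial.X ⟨j, hjr⟩) (R G), ?_, ?_⟩
    · exact NN.sum _ _ (fun G _ => (hF G).mul (NN.aeval _ (hR G) _))
    · intro lam' hch
      have hc0 : lam' (a 0) ≤ lam' (a ⟨j, hj'⟩) := hch _ _ (Fin.zero_le _)
      have hc1 : lam' (a ⟨j, hj'⟩) ≤ lam' b := hch _ _ (by simp [Fin.le_def])
      rw [CC_force Q Q' b (lam' b) _ hQ' ((hQ _).2 le_rfl)]
      rotate_left
      · have : b ∈ A := (hmemA b).2 ⟨_, rfl⟩
        simp [Ph, this]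
      · intro p hp hbp
        unfold Ph
        split_ifs with hA
        · obtain ⟨i, rfl⟩ := (hmemA p).1 hA
          have h3 : j + 1 ≤ (i : ℕ) := hle _ _ hbp
          have h4 := (hQ i).1 hp
          rw [show i = ⟨j + 1, hj⟩ from Fin.ext (by simp; omega)]
          simp [hb]
        · simp only [mem_Icc]; omega
      · intro p hp x hx
        unfold Ph at hx
        split_ifs at hx with hA
        · obtain ⟨i, rfl⟩ := (hmemA p).1 hA
          rw [mem_singleton] at hx
          rw [hx]
          exact hch _ _ ((hQ i).1 hp)
        · exact (mem_Icc.1 hx).2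
      rw [CC_split ⊥ Q' bot_le _ (lam' (a ⟨j, hj'⟩))]
      push_cast
      rw [map_sum]
      symm
      apply sum_subset_zero_on_sdiff
      · intro G hG
        simp only [mem_filter, mem_univ, true_and, bot_le] at hG ⊢
        exact hG.1
      · intro G hG
        simp only [mem_sdiff, mem_filter, mem_univ, true_and, bot_le, not_and] at hG
        obtain ⟨hG1, hG2⟩ := hG
        have hG2 := hG2 hG1
        push Not at hG2
        obtain ⟨i, hi⟩ := hG2
        have hi' : (i : ℕ) ≤ j ∧ a i ∉ G := by
          rcases hi with hi | hi
          · exact absurd ((haQ' i).1 (hG1 hi.1)) (by omega)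
          · exact ⟨hi.2, hi.1⟩
        rw [CC_empty G Q' _ (a i) ((haQ' i).2 hi'.1) hi'.2]
        · simp
        · have : a i ∈ A := (hmemA _).2 ⟨_, rfl⟩
          simp only [Ph, if_pos this]
          rw [filter_singleton, if_neg]
          have := hch i ⟨j, hj'⟩ hi'.1
          omega
      · intro G hG
        simp only [mem_filter, mem_univ, true_and] at hG
        obtain ⟨hG1, hG2⟩ := hG
        rw [map_mul, ← hF' G hG2 lam' hch, eval_aeval]
        congr 1
        · congr 2
          apply CC_congr
          intro p hp _
          unfold Ph
          split_ifs with hA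
          · obtain ⟨i, rfl⟩ := (hmemA p).1 hA
            rw [filter_singleton, if_pos]
            exact hch _ _ ((hG2 i).1 hp)
          · ext x; simp only [mem_filter, mem_Icc]; omega
        · obtain ⟨t, ht⟩ := Int.eq_ofNat_of_zero_le (sub_nonneg.2 hc1)
          have e : lam' b = lam' (a ⟨j, hj'⟩) + t := by omega
          have e2 : ((lam' (a (Fin.succ ⟨j, hjr⟩)) : ℚ) - (lam' (a (Fin.castSucc ⟨j, hjr⟩)) : ℚ)) = (t : ℚ) := by
            have h5 : lam' (a (Fin.succ ⟨j, hjr⟩)) = lam' (a (Fin.castSucc ⟨j, hjr⟩)) + t := e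
            rw [h5]; push_cast; ring
          rw [e2, ← hR' G hG1 (lam' (a ⟨j, hj'⟩)) t]
          congr 2
          apply CC_congr
          intro p hp hpG
          unfold Ph
          rw [if_neg]
          · ext x; simp only [mem_filter, mem_Icc, mem_Ioc]; omega
          · intro hA
            obtain ⟨i, rfl⟩ := (hmemA p).1 hA
            exact hpG ((hG2 i).2 ((haQ' i).1 hp))

theorem marked_main (PP : ∀ D E : LowerSet α, D ≤ E → ∃ p : Polynomial ℚ, (∀ n, 0 ≤ p.coeff n) ∧
      ∀ (c : ℤ) (t : ℕ), ((CC D E (fun _ => Ioc c (c + t))).card : ℚ) = p.eval (t : ℚ))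
    (A : Set α) (hminmax : ∀ x : α, IsMin x ∨ IsMax x → x ∈ A)
    (r : ℕ) (a : Fin (r + 1) → α) (hinj : Function.Injective a)
    (hrange : Set.range a = A) (hnat : ∀ i j : Fin (r + 1), a i < a j → i < j) :
    ∃ f : MvPolynomial (Fin r) ℚ,
      (∀ m : Fin r →₀ ℕ, 0 ≤ f.coeff m) ∧
      ∀ lam' : α → ℤ,
        (∀ i j : Fin (r + 1), i ≤ j → lam' (a i) ≤ lam' (a j)) →
        (markedCount A lam' : ℚ) =
          MvPolynomial.eval
            (fun i : Fin r => ((lam' (a i.succ) : ℚ) - (lam' (a i.castSucc) : ℚ))) f := by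
  classical
  have hmemA : ∀ p, p ∈ A ↔ ∃ i, a i = p := by intro p; rw [← hrange]; rfl
  obtain ⟨f, hf, h⟩ := marked_rec PP A r a hrange hnat hinj r (by omega) ⊤
    (fun i => ⟨fun _ => by omega, fun _ => trivial⟩)
  refine ⟨f, hf, fun lam' hch => ?_⟩
  rw [← h lam' hch, markedCount]
  congr 1
  apply Nat.subtype_card
  intro g
  have hbot : ∀ p : α, p ∉ (⊥ : LowerSet α) := fun p => LowerSet.notMem_bot
  have htop : ∀ p : α, p ∈ (⊤ : LowerSet α) := fun p => trivial
  simp only [mem_CC, hbot, htop, not_false_eq_true, and_true, not_true_eq_false, forall_const,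
    false_imp_iff, true_and, implies_true]
  constructor
  · rintro ⟨h1, h2⟩
    refine ⟨fun p q hpq => h2 p q hpq, fun p hp => ?_⟩
    have := h1 p
    simpa [Ph, hp] using this
  · rintro ⟨h1, h2⟩
    refine ⟨fun p => ?_, fun p q hpq => h1 hpq⟩
    unfold Ph
    split_ifs with hA
    · simpa using h2 p hA
    · rw [mem_Icc]
      constructor
      · obtain ⟨q, hq, hqm⟩ := (Set.toFinite (Set.univ : Set α)).exists_le_minimal (Set.mem_univ p)
        have hqA : q ∈ A := hminmax q (Or.inl (by simpa [minimal_iff_isMin] using hqm))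
        obtain ⟨i, rfl⟩ := (hmemA q).1 hqA
        rw [← h2 (a 0) ((hmemA _).2 ⟨_, rfl⟩)]
        refine le_trans ?_ (h1 hq)
        rw [h2 _ hqA, h2 (a 0) ((hmemA _).2 ⟨_, rfl⟩)]
        exact hch _ _ (Fin.zero_le _)
      · obtain ⟨q, hq, hqm⟩ := (Set.toFinite (Set.univ : Set α)).exists_le_maximal (Set.mem_univ p)
        have hqA : q ∈ A := hminmax q (Or.inr (by simpa [maximal_iff_isMax] using hqm))
        obtain ⟨i, rfl⟩ := (hmemA q).1 hqA
        refine le_trans (h1 hq) ?_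
        rw [h2 _ hqA]
        exact hch _ _ (by rw [Fin.le_def]; simp; omega)
end marked
end SkewPos

namespace SkewPos
open Finset

section skew
variable {k : ℕ} {lam mu : Fin k → ℕ}

theorem skew_finite (k : ℕ) (lam mu : Fin k → ℕ) : Finite (SkewPoset k lam mu) := by
  apply Finite.of_injective (fun p : SkewPoset k lam mu =>
    ((⟨(OrderDual.ofDual p.1).1, ⟨(OrderDual.ofDual p.1).2, Nat.lt_succ_of_le p.2.2⟩⟩ :
      (i : Fin k) × Fin (lam i + 1))))
  rintro ⟨⟨i, j⟩, h⟩ ⟨⟨i', j'⟩, h'⟩ heq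
  simp only [Sigma.mk.injEq] at heq
  obtain ⟨h1, h2⟩ := heq
  have h1 : i = i' := h1
  subst h1
  have h2 := congrArg Fin.val (eq_of_heq h2)
  have h2 : j = j' := h2
  subst h2
  rfl

noncomputable instance : Fintype (SkewPoset k lam mu) :=
  @Fintype.ofFinite _ (skew_finite k lam mu)

/-- the cell `(i, j)` -/
def cell (i : Fin k) (j : ℕ) (h : mu i < j ∧ j ≤ lam i) : SkewPoset k lam mu :=
  ⟨OrderDual.toDual (i, j), h⟩

theorem cell_le (i i' : Fin k) (j j' : ℕ) (h : mu i < j ∧ j ≤ lam i) (h' : mu i' < j' ∧ j' ≤ lam i') :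
    cell i j h ≤ cell i' j' h' ↔ i' ≤ i ∧ j' ≤ j := Iff.rfl

theorem cell_cases (p : SkewPoset k lam mu) : ∃ i j h, p = cell i j h :=
  ⟨(OrderDual.ofDual p.1).1, (OrderDual.ofDual p.1).2, p.2, rfl⟩

/-- the lower set of cells beyond `v` -/
def low (v : V k lam mu) : LowerSet (SkewPoset k lam mu) :=
  ⟨{p | v.1 (OrderDual.ofDual p.1).1 < (OrderDual.ofDual p.1).2}, by
    intro p q hqp hp
    obtain ⟨i, j, h, rfl⟩ := cell_cases p
    obtain ⟨i', j', h', rfl⟩ := cell_cases q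
    rw [cell_le] at hqp
    have hp : v.1 i < j := hp
    show v.1 i' < j'
    have := v.2.1 hqp.1
    omega⟩

theorem cell_mem_low (v : V k lam mu) (i : Fin k) (j : ℕ) (h : mu i < j ∧ j ≤ lam i) :
    cell i j h ∈ low v ↔ v.1 i < j := Iff.rfl

theorem low_le (v w : V k lam mu) : low v ≤ low w ↔ w.1 ≤ v.1 := by
  constructor
  · intro h i
    show w.1 i ≤ v.1 i
    by_contra hc
    have h1 : mu i ≤ v.1 i := v.2.2.1 i
    have h2 : w.1 i ≤ lam i := w.2.2.2 i
    have hm : cell i (w.1 i) ⟨by omega, h2⟩ ∈ low v := by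
      rw [cell_mem_low]; omega
    have h3 : w.1 i < w.1 i := h hm
    exact lt_irrefl _ h3
  · intro h p hp
    obtain ⟨i, j, hij, rfl⟩ := cell_cases p
    have hp : v.1 i < j := hp
    show w.1 i < j
    have : w.1 i ≤ v.1 i := h i
    omega

theorem low_inj : Function.Injective (low : V k lam mu → _) := by
  intro v w h
  apply Subtype.ext
  exact le_antisymm ((low_le _ _).1 h.ge) ((low_le _ _).1 h.le)

theorem low_surj (hlam : Antitone lam) (hmu : Antitone mu) (hml : ∀ i, mu i ≤ lam i) :
    Function.Surjective (low : V k lam mu → _) := by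
  classical
  intro I
  let Q : Fin k → ℕ → Prop := fun i j => ∀ h : mu i < j ∧ j ≤ lam i, cell i j h ∉ I
  let v : Fin k → ℕ := fun i => Nat.findGreatest (Q i) (lam i)
  have hQmu : ∀ i, Q i (mu i) := fun i h => absurd h.1 (lt_irrefl _)
  have hv1 : ∀ i, mu i ≤ v i := fun i => Nat.le_findGreatest (hml i) (hQmu i)
  have hv2 : ∀ i, v i ≤ lam i := fun i => Nat.findGreatest_le _
  have hv3 : ∀ i, Q i (v i) := fun i => Nat.findGreatest_spec (hml i) (hQmu i)
  have hv4 : Antitone v := by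
    intro i i' hii
    apply Nat.le_findGreatest ((hv2 i').trans (hlam hii))
    intro h hI
    have h1 := hmu hii
    exact hv3 i' ⟨by omega, hv2 i'⟩ (I.lower ((cell_le _ _ _ _ _ _).2 ⟨hii, le_rfl⟩) hI)
  refine ⟨⟨v, hv4, hv1, hv2⟩, ?_⟩
  ext p
  obtain ⟨i, j, h, rfl⟩ := cell_cases p
  show v i < j ↔ cell i j h ∈ I
  constructor
  · intro hj
    have := Nat.findGreatest_is_greatest hj h.2
    by_contra hc
    exact this (fun _ => hc)
  · intro hI
    by_contra hc
    exact hv3 i ⟨by omega, hv2 i⟩ (I.lower ((cell_le _ _ _ _ _ _).2 ⟨le_rfl, by omega⟩) hI)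

open Classical in
theorem CC_Z (hlam : Antitone lam) (hmu : Antitone mu) (hml : ∀ i, mu i ≤ lam i) (c : ℤ) (t : ℕ)
    (m l : V k lam mu) (h : m.1 ≤ l.1) :
    ((CC (low l) (low m) (fun _ => Ioc c (c + t))).card : ℚ) =
      ((Z : Matrix (V k lam mu) (V k lam mu) ℚ) ^ t) m l := by
  induction t generalizing m with
  | zero =>
    rw [CC_zero _ _ _ ((low_le _ _).2 h), pow_zero, Matrix.one_apply]
    simp only [low_inj.eq_iff, eq_comm]
    split_ifs <;> simp
  | succ t ih =>
    rw [CC_succ _ _ ((low_le _ _).2 h), pow_succ', Matrix.mul_apply]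
    push_cast
    have hz : ∀ v : V k lam mu, ¬ v.1 ≤ l.1 →
        ((Z : Matrix (V k lam mu) (V k lam mu) ℚ) ^ t) v l = 0 := by
      intro v hv
      have h0 : P v l = 0 := DM_vanish _ _ _ l.2.1 v.2.1 hv
      rw [Z_pow, h0, Polynomial.eval_zero]
    rw [sum_filter]
    rw [← Function.Bijective.sum_comp ⟨low_inj, low_surj hlam hmu hml⟩]
    apply sum_congr rfl
    intro v _
    simp only [low_le, Z, Matrix.of_apply]
    by_cases h1 : v.1 ≤ l.1
    · by_cases h2 : m.1 ≤ v.1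
      · rw [if_pos ⟨h1, h2⟩, if_pos h2, one_mul]; exact ih v h1
      · rw [if_neg (fun h => h2 h.2), if_neg h2, zero_mul]
    · rw [if_neg (fun h => h1 h.1)]
      have := hz v h1
      simp only [Z] at this
      rw [this, mul_zero]

theorem skew_PP (hlam : Antitone lam) (hmu : Antitone mu) (hml : ∀ i, mu i ≤ lam i)
    (D E : LowerSet (SkewPoset k lam mu)) (hDE : D ≤ E) :
    ∃ p : Polynomial ℚ, (∀ n, 0 ≤ p.coeff n) ∧
      ∀ (c : ℤ) (t : ℕ), ((CC D E (fun _ => Ioc c (c + t))).card : ℚ) = p.eval (t : ℚ) := by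
  obtain ⟨l, rfl⟩ := low_surj hlam hmu hml D
  obtain ⟨m, rfl⟩ := low_surj hlam hmu hml E
  refine ⟨P m l, fun n => P_nonneg n m l, fun c t => ?_⟩
  rw [CC_Z hlam hmu hml c t m l ((low_le _ _).1 hDE), Z_pow]
end skew
end SkewPos

/-- **Theorem (multivariate Ehrhart positivity for marked order polytopes of skew
shapes).**  For the cell poset `P` of a skew shape, a marked subposet `A ⊆ P`
containing the minima and maxima, and a natural labeling `A = {a_0, …, a_r}`, there
is a polynomial `f ∈ ℚ[t_1, …, t_r]` with nonnegative coefficients such that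
`Ω_{P,A}(λ') = f(λ'(a_1) − λ'(a_0), …, λ'(a_r) − λ'(a_{r−1}))` for every
`λ' : A → ℤ` with `λ'(a_0) ≤ ⋯ ≤ λ'(a_r)`. -/
theorem skew_marked_order_multivariate_positivity
    (k : ℕ) (lam mu : Fin k → ℕ) (hlam : Antitone lam) (hmu : Antitone mu)
    (hmulam : ∀ i, mu i ≤ lam i)
    (A : Set (SkewPoset k lam mu))
    (hminmax : ∀ x : SkewPoset k lam mu, IsMin x ∨ IsMax x → x ∈ A)
    (r : ℕ) (a : Fin (r + 1) → SkewPoset k lam mu) (hinj : Function.Injective a)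
    (hrange : Set.range a = A)
    (hnat : ∀ i j : Fin (r + 1), a i < a j → i < j) :
    ∃ f : MvPolynomial (Fin r) ℚ,
      (∀ m : Fin r →₀ ℕ, 0 ≤ f.coeff m) ∧
      ∀ lam' : SkewPoset k lam mu → ℤ,
        (∀ i j : Fin (r + 1), i ≤ j → lam' (a i) ≤ lam' (a j)) →
        (markedCount A lam' : ℚ) =
          MvPolynomial.eval
            (fun i : Fin r => ((lam' (a i.succ) : ℚ) - (lam' (a i.castSucc) : ℚ))) f := by
  exact SkewPos.marked_main (SkewPos.skew_PP hlam hmu hmulam) A hminmax r a hinj hrange hnat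
end

section
/- Let A ⊆ P be a pair of finite posets with min(P) ∪ max(P) ⊆ A and let A = {a_0, a_1, …, a_r} be a natural labeling. Let t_0 ∈ ℤ and let t_1, …, t_r be positive integers, and define λ : A → ℤ by λ(a_i) = t_0 + t_1 + ⋯ + t_i for i = 0, …, r. Then Ω_{P,A}(λ) = Σ Π_{i=1}^{r} Ω_{I_i ∖ (I_{i−1} ∪ ↑a_i)}(t_i), where the sum runs over all strict chains I_0 ⊂ I_1 ⊂ ⋯ ⊂ I_r of ideals of P such that a_i ∈ I_i ∖ I_{i−1} for all i = 0, …, r (with the convention I_{−1} = ∅), and each factor is the order polynomial of the induced subposet I_i ∖ (I_{i−1} ∪ ↑a_i) evaluated at t_i. -/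
/-- The set of admissible chains of ideals. -/
def chainSet {α : Type} [PartialOrder α] {r : ℕ} (a : Fin (r + 1) → α) :
    Set (Fin (r + 1) → Set α) :=
  {I : Fin (r + 1) → Set α |
          (∀ i, IsLowerSet (I i)) ∧ StrictMono I ∧
          (∀ i, a i ∈ I i) ∧ (∀ i : Fin r, a i.succ ∉ I i.castSucc)}

theorem exists_le_marked {α : Type} [Finite α] [PartialOrder α]
    {A : Set α} (hminmax : ∀ x : α, IsMin x ∨ IsMax x → x ∈ A)
    {r : ℕ} {a : Fin (r + 1) → α} (hrange : Set.range a = A) (x : α) :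
    (∃ i, a i ≤ x ∧ IsMin (a i)) ∧ (∃ i, x ≤ a i) := by
  constructor
  · obtain ⟨m, hm, hmin⟩ := (Set.toFinite (Set.univ : Set α)).exists_le_minimal (Set.mem_univ x)
    have h1 : IsMin m := fun y hy => hmin.2 (Set.mem_univ y) hy
    have h2 := hminmax m (Or.inl h1)
    rw [← hrange] at h2
    obtain ⟨i, rfl⟩ := h2
    exact ⟨i, hm, h1⟩
  · obtain ⟨m, hm, hmax⟩ := (Set.toFinite (Set.univ : Set α)).exists_le_maximal (Set.mem_univ x)
    have h1 : IsMax m := fun y hy => hmax.2 (Set.mem_univ y) hy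
    have h2 := hminmax m (Or.inr h1)
    rw [← hrange] at h2
    obtain ⟨i, rfl⟩ := h2
    exact ⟨i, hm⟩

theorem chain_mem {α : Type} [PartialOrder α] {r : ℕ} {a : Fin (r + 1) → α}
    {L : Fin (r + 1) → ℤ} (hL : StrictMono L) (f : α → ℤ) (hf : Monotone f)
    (hfa : ∀ i, f (a i) = L i) : (fun i => {x | f x ≤ L i}) ∈ chainSet a := by
  refine ⟨fun i x y hyx hx => (hf hyx).trans hx, ?_, fun i => (hfa i).le, ?_⟩
  · intro i j hij
    refine ⟨fun x hx => le_trans hx (hL hij).le, fun h => ?_⟩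
    have := h (show a j ∈ {x | f x ≤ L j} from (hfa j).le)
    have h2 : f (a j) ≤ L i := this
    rw [hfa] at h2
    exact absurd (hL hij) (not_lt.mpr h2)
  · intro i h
    have h2 : f (a i.succ) ≤ L i.castSucc := h
    rw [hfa] at h2
    exact absurd (hL i.castSucc_lt_succ) (not_lt.mpr h2)

theorem exists_index {α : Type} [Finite α] [PartialOrder α]
    {A : Set α} (hminmax : ∀ x : α, IsMin x ∨ IsMax x → x ∈ A)
    {r : ℕ} {a : Fin (r + 1) → α} (hrange : Set.range a = A)
    {I : Fin (r + 1) → Set α} (hI : I ∈ chainSet a) :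
    ∃ b : α → Fin (r + 1), (∀ x i, x ∈ I i ↔ b x ≤ i) ∧ Monotone b ∧ (∀ i, b (a i) = i) ∧
      ∀ x, b x = 0 → a 0 ≤ x := by
  obtain ⟨hlow, hmono, hmem, hnot⟩ := hI
  have h1 : ∀ x, ∃ k, ∀ i, x ∈ I i ↔ k ≤ i := by
    intro x
    obtain ⟨-, i, hi⟩ := exists_le_marked hminmax hrange x
    obtain ⟨k, -, hk⟩ := (Set.toFinite {i | x ∈ I i}).exists_le_minimal
      (show i ∈ {i | x ∈ I i} from hlow i hi (hmem i))
    refine ⟨k, fun j => ⟨fun hj => ?_, fun hj => hmono.monotone hj hk.1⟩⟩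
    by_contra h
    exact h (hk.2 hj (not_le.mp h).le)
  choose b hb using h1
  have hbm : Monotone b := fun x y hxy =>
    (hb x _).mp (hlow _ hxy ((hb y _).mpr le_rfl))
  have hba : ∀ i, b (a i) = i := by
    intro i
    refine le_antisymm ((hb _ _).mp (hmem i)) ?_
    induction i using Fin.cases with
    | zero => exact Fin.zero_le _
    | succ j =>
      have := hnot j
      rw [hb] at this
      exact Fin.castSucc_lt_iff_succ_le.mp (not_le.mp this)
  refine ⟨b, hb, hbm, hba, fun x hx => ?_⟩
  obtain ⟨⟨i, hi, -⟩, -⟩ := exists_le_marked hminmax hrange x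
  have := hbm hi
  rw [hba, hx] at this
  have h0 : i = 0 := le_antisymm this (Fin.zero_le _)
  exact h0 ▸ hi

theorem fiber_equiv {α : Type} [Finite α] [PartialOrder α]
    {A : Set α} (hminmax : ∀ x : α, IsMin x ∨ IsMax x → x ∈ A)
    {r : ℕ} {a : Fin (r + 1) → α} (hrange : Set.range a = A)
    {L : Fin (r + 1) → ℤ} (hL : StrictMono L) (t : Fin r → ℕ)
    (hstep : ∀ i : Fin r, L i.succ = L i.castSucc + t i)
    {I : Fin (r + 1) → Set α} (hI : I ∈ chainSet a) :
    Nonempty ({f : α → ℤ // (Monotone f ∧ ∀ i, f (a i) = L i) ∧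
        (fun i => {x | f x ≤ L i}) = I} ≃
      (∀ i : Fin r,
        {f : {x : α // x ∈ I i.succ ∧ x ∉ I i.castSucc ∧ ¬ a i.succ ≤ x}
              → Fin (t i) // Monotone f})) := by
  classical
  obtain ⟨b, hb, hbm, hba, hb0⟩ := exists_index hminmax hrange hI
  have hblock : ∀ x (j : Fin r), (x ∈ I j.succ ∧ x ∉ I j.castSucc ∧ ¬ a j.succ ≤ x) ↔
      (b x = j.succ ∧ ¬ a j.succ ≤ x) := by
    intro x j
    rw [hb, hb, ← and_assoc, not_le, Fin.castSucc_lt_iff_succ_le]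
    refine and_congr_left fun _ => ⟨fun h => le_antisymm h.1 h.2, fun h => ⟨h.le, h.ge⟩⟩
  have hfb : ∀ f : {f : α → ℤ // (Monotone f ∧ ∀ i, f (a i) = L i) ∧
      (fun i => {x | f x ≤ L i}) = I}, ∀ x i, f.1 x ≤ L i ↔ x ∈ I i := by
    intro f x i
    exact iff_of_eq (congrArg (fun J : Fin (r+1) → Set α => x ∈ J i) f.2.2)
  refine ⟨Equiv.ofBijective (fun f i => ⟨fun x => ⟨(f.1 x.1 - L i.castSucc - 1).toNat, ?_⟩, ?_⟩)
    ⟨?_, ?_⟩⟩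
  · have h1 := (hfb f x.1 i.succ).mpr x.2.1
    have h2 := mt (hfb f x.1 i.castSucc).mp x.2.2.1
    have := hstep i
    omega
  · intro x y hxy
    have h1 : f.1 x.1 ≤ f.1 y.1 := f.2.1.1 hxy
    rw [Fin.le_def]
    dsimp only
    omega
  · intro f g hfg
    apply Subtype.ext
    funext x
    by_cases hx : ∃ j : Fin r, (x ∈ I j.succ ∧ x ∉ I j.castSucc ∧ ¬ a j.succ ≤ x)
    · obtain ⟨j, hj⟩ := hx
      have h := congrArg Fin.val (congrFun (congrArg Subtype.val (congrFun hfg j)) ⟨x, hj⟩)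
      dsimp only at h
      have h1 := mt (hfb f x j.castSucc).mp hj.2.1
      have h2 := mt (hfb g x j.castSucc).mp hj.2.1
      omega
    · have hle : a (b x) ≤ x := by
        by_contra hc
        rcases Fin.eq_zero_or_eq_succ (b x) with h0 | ⟨j, hj⟩
        · exact hc (h0 ▸ hb0 x h0)
        · exact hx ⟨j, (hblock x j).mpr ⟨hj, hj ▸ hc⟩⟩
      have key : ∀ f : {f : α → ℤ // (Monotone f ∧ ∀ i, f (a i) = L i) ∧
          (fun i => {x | f x ≤ L i}) = I}, f.1 x = L (b x) := by
        intro f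
        refine le_antisymm ((hfb f x _).mpr ((hb x _).mpr le_rfl)) ?_
        rw [← f.2.1.2]
        exact f.2.1.1 hle
      rw [key f, key g]
  · intro H
    let g : α → ℤ := fun x =>
      if h : ∃ j : Fin r, (x ∈ I j.succ ∧ x ∉ I j.castSucc ∧ ¬ a j.succ ≤ x) then
        L h.choose.castSucc + 1 + ((H h.choose).1 ⟨x, h.choose_spec⟩).val
      else L (b x)
    have g1 : ∀ x (j : Fin r) (hj : x ∈ I j.succ ∧ x ∉ I j.castSucc ∧ ¬ a j.succ ≤ x),
        g x = L j.castSucc + 1 + ((H j).1 ⟨x, hj⟩).val := by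
      intro x j hj
      have hex : ∃ j : Fin r, (x ∈ I j.succ ∧ x ∉ I j.castSucc ∧ ¬ a j.succ ≤ x) := ⟨j, hj⟩
      have e1 : g x = L hex.choose.castSucc + 1 + ((H hex.choose).1 ⟨x, hex.choose_spec⟩).val :=
        dif_pos hex
      have e2 : ∀ k (hk : x ∈ I k.succ ∧ x ∉ I k.castSucc ∧ ¬ a k.succ ≤ x),
          L k.castSucc + 1 + (((H k).1 ⟨x, hk⟩).val : ℤ) =
            L j.castSucc + 1 + ((H j).1 ⟨x, hj⟩).val := by
        intro k hk
        have : k = j := Fin.succ_injective _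
          (((hblock x k).mp hk).1.symm.trans ((hblock x j).mp hj).1)
        subst this
        rfl
      rw [e1]
      exact e2 _ _
    have g2 : ∀ x, a (b x) ≤ x → g x = L (b x) := by
      intro x hx
      refine dif_neg ?_
      rintro ⟨j, hj⟩
      have := (hblock x j).mp hj
      rw [this.1] at hx
      exact this.2 hx
    have hcase : ∀ x, a (b x) ≤ x ∨ ∃ j : Fin r, b x = j.succ ∧
        (x ∈ I j.succ ∧ x ∉ I j.castSucc ∧ ¬ a j.succ ≤ x) := by
      intro x
      by_cases hc : a (b x) ≤ x
      · exact Or.inl hc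
      · rcases Fin.eq_zero_or_eq_succ (b x) with h0 | ⟨j, hj⟩
        · exact absurd (h0 ▸ hb0 x h0) hc
        · exact Or.inr ⟨j, hj, (hblock x j).mpr ⟨hj, hj ▸ hc⟩⟩
    have gle : ∀ x, g x ≤ L (b x) := by
      intro x
      rcases hcase x with h | ⟨j, hj, h⟩
      · exact (g2 x h).le
      · rw [g1 x j h, hj, hstep]
        have := ((H j).1 ⟨x, h⟩).isLt
        omega
    have glt : ∀ x (j : Fin r), b x = j.succ → L j.castSucc < g x := by
      intro x j hj
      rcases hcase x with h | ⟨k, hk, h⟩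
      · rw [g2 x h, hj]
        exact hL j.castSucc_lt_succ
      · have : k = j := Fin.succ_injective _ (hk.symm.trans hj)
        subst this
        rw [g1 x k h]
        omega
    have giff : ∀ x i, g x ≤ L i ↔ b x ≤ i := by
      intro x i
      constructor
      · intro h
        by_contra hc
        rw [not_le] at hc
        rcases Fin.eq_zero_or_eq_succ (b x) with h0 | ⟨j, hj⟩
        · rw [h0] at hc
          exact absurd hc (Fin.not_lt_zero _)
        · rw [hj] at hc
          have h3 := hL.monotone (Fin.le_castSucc_iff.mpr hc)
          have := glt x j hj
          omega
      · intro h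
        exact (gle x).trans (hL.monotone h)
    have gmono : Monotone g := by
      intro x y hxy
      rcases (hbm hxy).lt_or_eq with h | h
      · have h1 := mt (giff y (b x)).mp (not_le.mpr h)
        exact (gle x).trans (not_le.mp h1).le
      · rcases hcase y with hy | ⟨j, hj, hy⟩
        · rw [g2 y hy, ← h]
          exact gle x
        · have hx := (hblock x j).mpr ⟨h.trans hj, fun hc => hy.2.2 (hc.trans hxy)⟩
          rw [g1 x j hx, g1 y j hy]
          have : (H j).1 ⟨x, hx⟩ ≤ (H j).1 ⟨y, hy⟩ := (H j).2 hxy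
          rw [Fin.le_def] at this
          omega
    refine ⟨⟨g, ⟨gmono, fun i => ?_⟩, ?_⟩, ?_⟩
    · rw [g2 _ (by rw [hba]), hba]
    · funext i
      ext x
      exact (giff x i).trans (hb x i).symm
    · funext j
      apply Subtype.ext
      funext x
      apply Fin.ext
      have e : g x.1 = L j.castSucc + 1 + (((H j).1 x).val : ℤ) := g1 x.1 j x.2
      change (g x.1 - L j.castSucc - 1).toNat = ((H j).1 x).val
      omega

/-- **Proposition (product formula).** For a pair of finite posets `A ⊆ P` with
`min(P) ∪ max(P) ⊆ A`, a natural labeling `A = {a_0, …, a_r}`, `t_0 ∈ ℤ` and positive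
integers `t_1, …, t_r`, and `λ(a_i) = t_0 + t_1 + ⋯ + t_i`, we have
`Ω_{P,A}(λ) = Σ Π_{i=1}^{r} Ω_{I_i ∖ (I_{i−1} ∪ ↑a_i)}(t_i)`,
summing over all strict chains `I_0 ⊂ I_1 ⊂ ⋯ ⊂ I_r` of ideals of `P` with
`a_i ∈ I_i ∖ I_{i−1}` for all `i` (where `I_{−1} = ∅`); each factor is the number of
order preserving maps from the induced subposet `I_i ∖ (I_{i−1} ∪ ↑a_i)` into the
`t_i`-chain, i.e. the order polynomial evaluated at `t_i`. -/
theorem marked_order_product_formula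
    {α : Type} [Finite α] [PartialOrder α]
    (A : Set α) (hminmax : ∀ x : α, IsMin x ∨ IsMax x → x ∈ A)
    (r : ℕ) (a : Fin (r + 1) → α) (hinj : Function.Injective a)
    (hrange : Set.range a = A)
    (hnat : ∀ i j : Fin (r + 1), a i < a j → i < j)
    (t0 : ℤ) (t : Fin r → ℕ) (ht : ∀ i, 0 < t i)
    (lam : α → ℤ) (h0 : lam (a 0) = t0)
    (hstep : ∀ i : Fin r, lam (a i.succ) = lam (a i.castSucc) + t i) :
    markedCount A lam =
      ∑ᶠ I ∈ {I : Fin (r + 1) → Set α |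
          (∀ i, IsLowerSet (I i)) ∧ StrictMono I ∧
          (∀ i, a i ∈ I i) ∧ (∀ i : Fin r, a i.succ ∉ I i.castSucc)},
        ∏ᶠ i : Fin r,
          Nat.card {f : {x : α // x ∈ I i.succ ∧ x ∉ I i.castSucc ∧ ¬ a i.succ ≤ x}
              → Fin (t i) // Monotone f} := by
  classical
  have hL : StrictMono (fun i => lam (a i)) := by
    rw [Fin.strictMono_iff_lt_succ]
    intro i
    have := hstep i
    have := ht i
    omega
  have : Fintype (chainSet a) := Fintype.ofFinite _
  change _ = ∑ᶠ I ∈ chainSet a, _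
  rw [← finsum_set_coe_eq_finsum_mem (chainSet a), finsum_eq_sum_of_fintype]
  have hX : markedCount A lam =
      Nat.card {f : α → ℤ // Monotone f ∧ ∀ i, f (a i) = lam (a i)} := by
    unfold markedCount
    refine Nat.card_congr (Equiv.subtypeEquivRight fun f => and_congr_right fun _ => ?_)
    rw [← hrange, Set.forall_mem_range]
  rw [hX]
  let c : {f : α → ℤ // Monotone f ∧ ∀ i, f (a i) = lam (a i)} → chainSet a :=
    fun f => ⟨_, chain_mem hL f.1 f.2.1 f.2.2⟩
  have hfib : ∀ I : chainSet a, Nonempty ({f // c f = I} ≃ (∀ i : Fin r,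
        {f : {x : α // x ∈ I.1 i.succ ∧ x ∉ I.1 i.castSucc ∧ ¬ a i.succ ≤ x}
              → Fin (t i) // Monotone f})) := by
    intro I
    obtain ⟨e⟩ := fiber_equiv hminmax hrange hL t hstep I.2
    refine ⟨Equiv.trans ?_ e⟩
    refine (Equiv.subtypeEquivRight (fun f => ?_)).trans
      (Equiv.subtypeSubtypeEquivSubtypeInter
        (fun f : α → ℤ => Monotone f ∧ ∀ i, f (a i) = lam (a i))
        (fun f => (fun i => {x | f x ≤ lam (a i)}) = I.1))
    exact Subtype.ext_iff
  rw [Nat.card_congr (Equiv.sigmaFiberEquiv c).symm]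
  have hfin : ∀ I : chainSet a, Finite {f // c f = I} := 
    fun I => Finite.of_equiv _ (hfib I).some.symm
  rw [Nat.card_sigma]
  refine Finset.sum_congr rfl fun I _ => ?_
  rw [Nat.card_congr (hfib I).some, Nat.card_pi, finprod_eq_prod_of_fintype]
end
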